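/- Let n ∈ ℕ. Let (C,u) be an equicharacteristic ℤ-valued field with uniformizer π such that O_u is excellent, and let (K,v) and (L,w) be henselian valued field extensions of (C,u) in which π is still a uniformizer, such that the residue field extensions Kv/Cu and Lw/Cu are separable. If Th_∃(Kv,Cu) ⊆ Th_∃(Lw,Cu) and (R4_{n+1}) holds, then Th_{∃_{n+1}}(K,C) ⊆ Th_{∃_{n+1}}(L,C) (as L_ring(C)-theories) and Th_{∃_n}(K,v,C) ⊆ Th_{∃_n}(L,w,C) (as L_val(C)-theories). -/

import Mathlib

open FirstOrder FirstOrder.Language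

universe u v w x

namespace Paper



/-! ### Syntactic fragments -/

/-- `IsExistsN n φ`: `φ` is an `∃_n`-formula, i.e. of the form `∃ x₁ … x_m ψ`
with `m ≤ n` and `ψ` quantifier-free. -/
inductive IsExistsN {L : Language} {α : Type*} : ℕ → ∀ {k : ℕ}, L.BoundedFormula α k → Prop
  | qf {n k : ℕ} {φ : L.BoundedFormula α k} : φ.IsQF → IsExistsN n φ
  | ex {n k : ℕ} {φ : L.BoundedFormula α (k + 1)} : IsExistsN n φ → IsExistsN (n + 1) φ.ex

/-- `φ` is an existential formula. -/
def IsExists {L : Language} {α : Type*} {k : ℕ} (φ : L.BoundedFormula α k) : Prop :=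
  ∃ n : ℕ, IsExistsN n φ

/-- Positive boolean combinations of formulas satisfying `P`. -/
inductive IsPosBC {L : Language} {α : Type*} (P : ∀ {k : ℕ}, L.BoundedFormula α k → Prop) :
    ∀ {k : ℕ}, L.BoundedFormula α k → Prop
  | base {k : ℕ} {φ : L.BoundedFormula α k} : P φ → IsPosBC P φ
  | inf {k : ℕ} {φ ψ : L.BoundedFormula α k} :
      IsPosBC P φ → IsPosBC P ψ → IsPosBC P (φ ⊓ ψ)
  | sup {k : ℕ} {φ ψ : L.BoundedFormula α k} :
      IsPosBC P φ → IsPosBC P ψ → IsPosBC P (φ ⊔ ψ)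

/-- The `∃₁`-fragment: positive boolean combinations of formulas of the form `η` or `∃ y η`
with `η` quantifier-free. -/
def IsE1 {L : Language} {α : Type*} {k : ℕ} (φ : L.BoundedFormula α k) : Prop :=
  IsPosBC (fun {k} φ => φ.IsQF ∨ ∃ ψ : L.BoundedFormula α (k + 1), ψ.IsQF ∧ φ = ψ.ex) φ

/-- `∃_n∃₁`-formulas: `∃ x₁ … x_m ψ` with `m ≤ n` and `ψ` in the `∃₁`-fragment. -/
inductive IsExistsNE1 {L : Language} {α : Type*} : ℕ → ∀ {k : ℕ}, L.BoundedFormula α k → Prop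
  | e1 {n k : ℕ} {φ : L.BoundedFormula α k} : IsE1 φ → IsExistsNE1 n φ
  | ex {n k : ℕ} {φ : L.BoundedFormula α (k + 1)} : IsExistsNE1 n φ → IsExistsNE1 (n + 1) φ.ex

/-- The `∃^n`-fragments, defined inductively: `∃^0`-formulas are the quantifier-free ones,
and an `∃^{n+1}`-formula is of the form `ψ` or `∃ x ψ` with `ψ` a positive boolean
combination of `∃^n`-formulas. -/
def IsExpN {L : Language} {α : Type*} : ℕ → ∀ {k : ℕ}, L.BoundedFormula α k → Prop
  | 0, _, φ => φ.IsQF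
  | n + 1, k, φ => IsPosBC (IsExpN n) φ ∨
      ∃ ψ : L.BoundedFormula α (k + 1), IsPosBC (IsExpN n) ψ ∧ φ = ψ.ex



/-! ### The language of rings with constants, and realization -/

/-- The `Language.ring`-structure on a ring. -/
noncomputable def ringStructure (M : Type*) [CommRing M] : Language.ring.Structure M :=
  (FirstOrder.Ring.compatibleRingOfRing M).toStructure

/-- The `L_ring(α)`-structure on a ring `M` with constants interpreted via `f : α → M`. -/
noncomputable def ringConStructure {α M : Type*} [CommRing M] (f : α → M) :
    (Language.ring[[α]]).Structure M :=
  letI := ringStructure M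
  letI := constantsOn.structure f
  inferInstance

/-- `M ⊨ φ` for an `L_ring(α)`-sentence, with constants interpreted via `f`. -/
def RealizeRing (M : Type*) [CommRing M] {α : Type*} (f : α → M)
    (φ : (Language.ring[[α]]).Sentence) : Prop :=
  @Sentence.Realize _ M (ringConStructure f) φ

/-- The unary relation symbol `O` for the valuation ring. -/
inductive ValRel : ℕ → Type
  | isO : ValRel 1

/-- The language with a single unary predicate `O`. -/
def oLang : Language := ⟨fun _ => Empty, ValRel⟩

/-- The language of valued fields `L_val = L_ring ∪ {O}`. -/
abbrev Lval : Language := Language.ring.sum oLang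

/-- The `oLang`-structure on `M` in which `O` is interpreted as the set `O`. -/
def oStructure {M : Type*} (O : Set M) : oLang.Structure M where
  funMap := fun f _ => f.elim
  RelMap := fun {_} r => match r with
    | .isO => fun xs => xs 0 ∈ O

/-- The `L_val(α)`-structure on a ring `M`, with `O` interpreted as the set `O` and
constants interpreted via `f : α → M`. -/
noncomputable def valConStructure {α M : Type*} [CommRing M] (O : Set M) (f : α → M) :
    (Lval[[α]]).Structure M :=
  letI := ringStructure M
  letI := oStructure O
  letI : Lval.Structure M := inferInstance
  letI := constantsOn.structure f
  inferInstance

/-- `M ⊨ φ` for an `L_val(α)`-sentence. -/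
def RealizeVal (M : Type*) [CommRing M] (O : Set M) {α : Type*} (f : α → M)
    (φ : (Lval[[α]]).Sentence) : Prop :=
  @Sentence.Realize _ M (valConStructure O f) φ



abbrev Zm0 : Type := WithZero (Multiplicative ℤ)

variable {K : Type*} [Field K] {Γ : Type*} [LinearOrderedCommGroupWithZero Γ]

/-- `π` is a uniformizer of `(K, v)`: `v π` is minimal positive
(multiplicatively: `0 < v π < 1` and `v π` is the largest value `< 1`). -/
def IsUniformizer (v : Valuation K Γ) (π : K) : Prop :=
  0 < v π ∧ v π < 1 ∧ ∀ x : K, v x < 1 → v x ≤ v π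

/-- The valuation ring of `v`, as a set. -/
def Oset (v : Valuation K Γ) : Set K := {x | v x ≤ 1}

/-- The residue field `Kv` of the valued field `(K, v)`. -/
abbrev ResF (v : Valuation K Γ) : Type _ :=
  IsLocalRing.ResidueField v.valuationSubring

/-- The residue map `O_v → Kv`. -/
abbrev resMap (v : Valuation K Γ) : v.valuationSubring →+* ResF v :=
  IsLocalRing.residue _

/-- `(K, v)` is a henselian valued field. -/
abbrev IsHenselian (v : Valuation K Γ) : Prop :=
  HenselianLocalRing v.valuationSubring

/-- compatibility of a ring homomorphism between residue fields with the residue maps,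
for an extension `(K, v)` of `(C, u)`. -/
def ResCompat {C : Type*} [Field C] {Γ₀ : Type*} [LinearOrderedCommGroupWithZero Γ₀]
    (u : Valuation C Γ₀) [Algebra C K] (v : Valuation K Γ)
    (g : ResF u →+* ResF v) : Prop :=
  ∀ (x : u.valuationSubring) (hx : algebraMap C K ↑x ∈ v.valuationSubring),
    g (resMap u x) = resMap v ⟨algebraMap C K ↑x, hx⟩

/-- `(K, v)` is complete (with respect to the valuation uniformity). -/
def IsCompleteValued (v : Valuation K Γ) : Prop :=
  letI : Valued K Γ := Valued.mk' v
  CompleteSpace K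



/-- `E/F` admits a separating transcendence basis. -/
def HasSepTransBasis (F E : Type*) [Field F] [Field E] [Algebra F E] : Prop :=
  ∃ s : Set E, AlgebraicIndependent F ((↑) : s → E) ∧
    Algebra.IsSeparable (IntermediateField.adjoin F s) E

/-- The field extension `E/F` is separable: every finitely generated subextension
admits a separating transcendence basis. -/
def IsSepExt (F E : Type*) [Field F] [Field E] [Algebra F E] : Prop :=
  ∀ s : Finset E, HasSepTransBasis F (IntermediateField.adjoin F (s : Set E))

/-- The extension given by a ring homomorphism `f : F →+* E` of fields is separable. -/
def IsSepExtHom {F E : Type*} [Field F] [Field E] (f : F →+* E) : Prop :=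
  letI := f.toAlgebra
  IsSepExt F E

/-- `trdeg(E/F) ≤ d`: there is a finite transcendence basis with at most `d` elements. -/
def TrdegLE (F E : Type*) [CommRing F] [CommRing E] [Algebra F E] (d : ℕ) : Prop :=
  ∃ s : Finset E, s.card ≤ d ∧ IsTranscendenceBasis F (Subtype.val : ((s : Set E)) → E)

/-- `F` is a large field: `F` is existentially closed in `F((t))`. -/
def LargeField (F : Type u) [Field F] : Prop :=
  ∀ φ : (Language.ring[[F]]).Sentence, IsExists φ →
    RealizeRing (LaurentSeries F) (algebraMap F (LaurentSeries F)) φ →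
    RealizeRing F (id : F → F) φ

/-- `(R4_n)`: whenever a valuation `w` on a field `E` is trivial on a large subfield `F` of `E`
with residue field `Eu = F` (via the residue map), every `∃_n`-`L_ring(F)`-sentence true in `E`
is true in `F`. -/
def R4N (n : ℕ) : Prop :=
  ∀ (E : Type u) [Field E] (Γ : Type u) [LinearOrderedCommGroupWithZero Γ]
    (w : Valuation E Γ) (F : Subfield E),
    LargeField.{u} F →
    (∀ y : F, (y : E) ≠ 0 → w y = 1) →
    (∀ y : E, w y ≤ 1 → ∃ x : F, w (y - x) < 1) →
    ∀ φ : (Language.ring[[F]]).Sentence, IsExistsN n φ →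
      RealizeRing E ((↑) : F → E) φ → RealizeRing F (id : F → F) φ

/-- Excellence of the valuation ring of an (equicharacteristic, `ℤ`-valued) valued field
`(C, u)`, via the characterization: the fraction field of the completion (i.e. the completion
of `C`) is a separable extension of `C`. -/
def ExcellentCompletion (C : Type u) [Field C] (u : Valuation C Zm0) : Prop :=
  letI : Valued C Zm0 := Valued.mk' u
  letI : Field (UniformSpace.Completion C) := UniformSpace.Completion.instField
  IsSepExtHom (UniformSpace.Completion.coeRingHom : C →+* UniformSpace.Completion C)


/-- `Th_P(K, fK) ⊆ Th_P(L, fL)`: every positive boolean combination of `L_ring(α)`-sentences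
of the fragment `P` that is true in `K` is true in `L`. -/
def ThRingSub {α : Type*} (P : ∀ {k : ℕ}, (Language.ring[[α]]).BoundedFormula Empty k → Prop)
    (K : Type*) [CommRing K] (fK : α → K) (L : Type*) [CommRing L] (fL : α → L) : Prop :=
  ∀ φ : (Language.ring[[α]]).Sentence, IsPosBC P φ →
    RealizeRing K fK φ → RealizeRing L fL φ

/-- `Th_P(K, OK, fK) ⊆ Th_P(L, OL, fL)` for `L_val(α)`-sentences. -/
def ThValSub {α : Type*} (P : ∀ {k : ℕ}, (Lval[[α]]).BoundedFormula Empty k → Prop)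
    (K : Type*) [CommRing K] (OK : Set K) (fK : α → K)
    (L : Type*) [CommRing L] (OL : Set L) (fL : α → L) : Prop :=
  ∀ φ : (Lval[[α]]).Sentence, IsPosBC P φ →
    RealizeVal K OK fK φ → RealizeVal L OL fL φ

end Paper

namespace Paper

/-! ### Existential sentences and systems of polynomial conditions -/

/-- The system of equations `P = 0` and the inequation `q ≠ 0` has a solution in `M`. -/
def Sol {R M σ : Type*} [CommRing R] [CommRing M] (f : R →+* M)
    (P : List (MvPolynomial σ R)) (q : MvPolynomial σ R) : Prop :=
  ∃ x : σ → M, (∀ p ∈ P, p.eval₂ f x = 0) ∧ q.eval₂ f x ≠ 0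

/-- A field with a ring homomorphism from `R` and a distinguished subset. -/
structure PField (R : Type v) [CommRing R] where
  /-- the underlying field -/
  carrier : Type u
  [field : Field carrier]
  /-- the interpretation of the constants -/
  hom : R →+* carrier
  /-- the distinguished subset -/
  O : Set carrier

attribute [instance] PField.field

/-- A finite system of equations, one inequation and finitely many membership conditions. -/
structure Sys (σ : Type w) (R : Type v) [CommRing R] where
  /-- polynomials required to vanish -/
  eqs : List (MvPolynomial σ R)
  /-- the polynomial required not to vanish -/
  neq : MvPolynomial σ R
  /-- polynomials with value required to be in the distinguished subset -/
  pos : List (MvPolynomial σ R)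
  /-- polynomials with value required not to be in the distinguished subset -/
  neg : List (MvPolynomial σ R)

section Systems

variable {R : Type v} [CommRing R] {σ : Type w}

/-- The tuple `y` satisfies the system `s` in `X`. -/
def Sys.Holds (s : Sys σ R) (X : PField.{u} R) (y : σ → X.carrier) : Prop :=
  (∀ p ∈ s.eqs, p.eval₂ X.hom y = 0) ∧ s.neq.eval₂ X.hom y ≠ 0 ∧
    (∀ p ∈ s.pos, p.eval₂ X.hom y ∈ X.O) ∧ ∀ p ∈ s.neg, p.eval₂ X.hom y ∉ X.O

/-- Conjunction of two systems. -/
noncomputable def Sys.and (s t : Sys σ R) : Sys σ R :=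
  ⟨s.eqs ++ t.eqs, s.neq * t.neq, s.pos ++ t.pos, s.neg ++ t.neg⟩

theorem Sys.holds_and (s t : Sys σ R) (X : PField.{u} R) (y : σ → X.carrier) :
    (s.and t).Holds X y ↔ s.Holds X y ∧ t.Holds X y := by
  simp only [Sys.Holds, Sys.and, List.mem_append, MvPolynomial.eval₂_mul, mul_ne_zero_iff]
  constructor
  · rintro ⟨h1, ⟨h2, h2'⟩, h3, h4⟩
    exact ⟨⟨fun p hp => h1 p (.inl hp), h2, fun p hp => h3 p (.inl hp), fun p hp => h4 p (.inl hp)⟩,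
      fun p hp => h1 p (.inr hp), h2', fun p hp => h3 p (.inr hp), fun p hp => h4 p (.inr hp)⟩
  · rintro ⟨⟨h1, h2, h3, h4⟩, h1', h2', h3', h4'⟩
    exact ⟨fun p hp => hp.elim (h1 p) (h1' p), ⟨h2, h2'⟩, fun p hp => hp.elim (h3 p) (h3' p),
      fun p hp => hp.elim (h4 p) (h4' p)⟩

/-- Renaming the variables of a system. -/
noncomputable def Sys.rename {τ : Type*} (ρ : σ → τ) (s : Sys σ R) : Sys τ R :=
  ⟨s.eqs.map (MvPolynomial.rename ρ), MvPolynomial.rename ρ s.neq,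
    s.pos.map (MvPolynomial.rename ρ), s.neg.map (MvPolynomial.rename ρ)⟩

theorem Sys.holds_rename {τ : Type*} (ρ : σ → τ) (s : Sys σ R) (X : PField.{u} R)
    (y : τ → X.carrier) : (s.rename ρ).Holds X y ↔ s.Holds X (y ∘ ρ) := by
  simp [Sys.Holds, Sys.rename, MvPolynomial.eval₂_rename]

/-- `Q` is uniformly equivalent to a finite disjunction of systems. -/
def IsDisj (Q : ∀ X : PField.{u} R, (σ → X.carrier) → Prop) : Prop :=
  ∃ A : List (Sys σ R), ∀ X y, Q X y ↔ ∃ s ∈ A, s.Holds X y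

variable {Q Q' : ∀ X : PField.{u} R, (σ → X.carrier) → Prop}

theorem IsDisj.or (h : IsDisj Q) (h' : IsDisj Q') : IsDisj (fun X y => Q X y ∨ Q' X y) := by
  obtain ⟨A, hA⟩ := h
  obtain ⟨B, hB⟩ := h'
  refine ⟨A ++ B, fun X y => ?_⟩
  simp [hA, hB, or_and_right, exists_or]

theorem IsDisj.and (h : IsDisj Q) (h' : IsDisj Q') : IsDisj (fun X y => Q X y ∧ Q' X y) := by
  obtain ⟨A, hA⟩ := h
  obtain ⟨B, hB⟩ := h'
  refine ⟨A.flatMap fun a => B.map fun b => a.and b, fun X y => ?_⟩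
  simp only [hA, hB, List.mem_flatMap, List.mem_map]
  constructor
  · rintro ⟨⟨s, hs, h⟩, t, ht, h'⟩
    exact ⟨_, ⟨s, hs, t, ht, rfl⟩, (Sys.holds_and _ _ _ _).2 ⟨h, h'⟩⟩
  · rintro ⟨_, ⟨s, hs, t, ht, rfl⟩, h⟩
    obtain ⟨h, h'⟩ := (Sys.holds_and _ _ _ _).1 h
    exact ⟨⟨s, hs, h⟩, t, ht, h'⟩

theorem isDisj_false : IsDisj (fun (X : PField.{u} R) (_ : σ → X.carrier) => False) :=
  ⟨[], by simp⟩

theorem isDisj_true : IsDisj (fun (X : PField.{u} R) (_ : σ → X.carrier) => True) :=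
  ⟨[⟨[], 1, [], []⟩], by simp [Sys.Holds]⟩

theorem isDisj_eq (p q : MvPolynomial σ R) :
    IsDisj (fun (X : PField.{u} R) y => p.eval₂ X.hom y = q.eval₂ X.hom y) :=
  ⟨[⟨[p - q], 1, [], []⟩], by simp [Sys.Holds, sub_eq_zero]⟩

theorem isDisj_ne (p q : MvPolynomial σ R) :
    IsDisj (fun (X : PField.{u} R) y => ¬ p.eval₂ X.hom y = q.eval₂ X.hom y) :=
  ⟨[⟨[], p - q, [], []⟩], by simp [Sys.Holds, sub_eq_zero]⟩

theorem isDisj_mem (p : MvPolynomial σ R) :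
    IsDisj (fun (X : PField.{u} R) y => p.eval₂ X.hom y ∈ X.O) :=
  ⟨[⟨[], 1, [p], []⟩], by simp [Sys.Holds]⟩

theorem isDisj_notMem (p : MvPolynomial σ R) :
    IsDisj (fun (X : PField.{u} R) y => ¬ p.eval₂ X.hom y ∈ X.O) :=
  ⟨[⟨[], 1, [], [p]⟩], by simp [Sys.Holds]⟩

end Systems

section Elim

variable {R : Type v} [CommRing R] {L : FirstOrder.Language.{w, x}}
  (S : ∀ X : PField.{u} R, L.Structure X.carrier)

/-- A structure interpretation in which terms are polynomials, and in which atomic relations are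
membership conditions. -/
structure IsPolyInterp : Prop where
  term : ∀ {k : ℕ} (t : L.Term (Empty ⊕ Fin k)), ∃ p : MvPolynomial (Fin k) R,
    ∀ (X : PField.{u} R) (y : Fin k → X.carrier),
      @Term.realize L X.carrier (S X) _ (Sum.elim (default : Empty → _) y) t = p.eval₂ X.hom y
  rel : ∀ {l : ℕ} (r : L.Relations l), ∃ i : Fin l, ∀ (X : PField.{u} R) (z : Fin l → X.carrier),
    (S X).RelMap r z ↔ z i ∈ X.O

variable {S}

theorem IsPolyInterp.isDisj_of_isQF (hS : IsPolyInterp S) {k : ℕ} {φ : L.BoundedFormula Empty k}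
    (hφ : φ.IsQF) :
    IsDisj (fun X y => @BoundedFormula.Realize L X.carrier (S X) _ _ φ default y) ∧
    IsDisj (fun X y => ¬ @BoundedFormula.Realize L X.carrier (S X) _ _ φ default y) := by
  induction hφ with
  | falsum => exact ⟨isDisj_false, by simpa [BoundedFormula.Realize] using isDisj_true⟩
  | of_isAtomic h =>
    cases h with
    | equal t₁ t₂ =>
      obtain ⟨p, hp⟩ := hS.term t₁
      obtain ⟨q, hq⟩ := hS.term t₂
      have key (X : PField.{u} R) y :
          @BoundedFormula.Realize L X.carrier (S X) _ _ (t₁.bdEqual t₂) default y ↔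
            p.eval₂ X.hom y = q.eval₂ X.hom y := by
        rw [@BoundedFormula.realize_bdEqual L _ (S X), hp, hq]
      simp only [key]
      exact ⟨isDisj_eq p q, isDisj_ne p q⟩
    | rel r ts =>
      obtain ⟨i, hi⟩ := hS.rel r
      obtain ⟨p, hp⟩ := hS.term (ts i)
      have key (X : PField.{u} R) y :
          @BoundedFormula.Realize L X.carrier (S X) _ _ (r.boundedFormula ts) default y ↔
            p.eval₂ X.hom y ∈ X.O := by
        rw [@BoundedFormula.realize_rel L _ (S X), hi, hp]
      simp only [key]
      exact ⟨isDisj_mem p, isDisj_notMem p⟩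
  | imp _ _ h₁ h₂ =>
    refine ⟨?_, ?_⟩
    · simpa only [BoundedFormula.Realize, imp_iff_not_or] using h₁.2.or h₂.1
    · simpa only [BoundedFormula.Realize, Classical.not_imp] using h₁.1.and h₂.2

theorem IsPolyInterp.exists_systems (hS : IsPolyInterp S) {n k : ℕ} {φ : L.BoundedFormula Empty k}
    (hφ : IsExistsN n φ) :
    ∃ A : List (Sys (Fin k ⊕ Fin n) R), ∀ (X : PField.{u} R) (y : Fin k → X.carrier),
      @BoundedFormula.Realize L X.carrier (S X) _ _ φ default y ↔
        ∃ s ∈ A, ∃ z : Fin n → X.carrier, s.Holds X (Sum.elim y z) := by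
  induction hφ with
  | qf h =>
    obtain ⟨A, hA⟩ := (hS.isDisj_of_isQF h).1
    refine ⟨A.map (Sys.rename Sum.inl), fun X y => ?_⟩
    simp only [hA, List.mem_map, exists_exists_and_eq_and, Sys.holds_rename, Sum.elim_comp_inl,
      exists_const]
  | @ex n k φ h ih =>
    obtain ⟨A, hA⟩ := ih
    let ρ : Fin (k + 1) ⊕ Fin n → Fin k ⊕ Fin (n + 1) :=
      Sum.elim (Fin.lastCases (Sum.inr 0) Sum.inl) (fun j => Sum.inr j.succ)
    have hρ {M : Type u} (y : Fin k → M) (a : M) (z : Fin n → M) :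
        Sum.elim y (Fin.cons a z : Fin (n + 1) → M) ∘ ρ =
          Sum.elim (Fin.snoc y a : Fin (k + 1) → M) z := by
      funext i
      rcases i with i | i
      · induction i using Fin.lastCases <;> simp [ρ]
      · simp [ρ]
    refine ⟨A.map (Sys.rename ρ), fun X y => ?_⟩
    rw [@BoundedFormula.realize_ex L _ (S X)]
    simp only [hA, List.mem_map, exists_exists_and_eq_and, Sys.holds_rename]
    constructor
    · rintro ⟨a, s, hs, z, h⟩
      exact ⟨s, hs, Fin.cons a z, by rwa [hρ]⟩
    · rintro ⟨s, hs, z, h⟩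
      refine ⟨z 0, s, hs, Fin.tail z, ?_⟩
      rwa [← hρ, Fin.cons_self_tail]

theorem IsPolyInterp.exists_systems_sentence (hS : IsPolyInterp S) {n : ℕ} {φ : L.Sentence}
    (hφ : IsExistsN n φ) :
    ∃ A : List (Sys (Fin n) R), ∀ (X : PField.{u} R),
      @Sentence.Realize L X.carrier (S X) φ ↔
        ∃ s ∈ A, ∃ z : Fin n → X.carrier, s.Holds X z := by
  obtain ⟨A, hA⟩ := hS.exists_systems hφ
  refine ⟨A.map (Sys.rename (Sum.elim finZeroElim id)), fun X => ?_⟩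
  have := hA X default
  simp only [Sentence.Realize, Formula.Realize]
  rw [this]
  simp only [List.mem_map, exists_exists_and_eq_and, Sys.holds_rename]
  have key (z : Fin n → X.carrier) :
      z ∘ (Sum.elim finZeroElim id : Fin 0 ⊕ Fin n → Fin n) = Sum.elim default z := by
    funext i
    rcases i with i | i
    · exact i.elim0
    · rfl
  simp only [key]

end Elim

section Interp

variable {R : Type v} [CommRing R]

theorem isPolyInterp_val : IsPolyInterp (L := Lval[[R]])
    (fun X : PField.{u} R => valConStructure X.O X.hom) where
  term {k} t := by
    induction t with
    | var i =>
      rcases i with i | i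
      · exact i.elim
      · exact ⟨MvPolynomial.X i, fun X y => by simp⟩
    | @func l f ts ih =>
      choose p hp using ih
      rcases f with (f | f) | f
      · cases f with
        | add =>
          refine ⟨p 0 + p 1, fun X y => ?_⟩
          rw [MvPolynomial.eval₂_add, ← hp 0, ← hp 1]
          rfl
        | mul =>
          refine ⟨p 0 * p 1, fun X y => ?_⟩
          rw [MvPolynomial.eval₂_mul, ← hp 0, ← hp 1]
          rfl
        | neg =>
          refine ⟨-p 0, fun X y => ?_⟩
          rw [← MvPolynomial.coe_eval₂Hom, map_neg, MvPolynomial.coe_eval₂Hom, ← hp 0]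
          rfl
        | zero => exact ⟨0, fun X y => by rw [MvPolynomial.eval₂_zero]; rfl⟩
        | one => exact ⟨1, fun X y => by rw [MvPolynomial.eval₂_one]; rfl⟩
      · exact f.elim
      · cases l with
        | zero =>
          exact ⟨MvPolynomial.C (σ := Fin k) (R := R) f,
            fun X y => (MvPolynomial.eval₂_C X.hom y (show R from f)).symm⟩
        | succ l => exact f.elim
  rel {l} r := by
    rcases r with (r | r) | r
    · exact r.elim
    · cases r
      exact ⟨0, fun X z => Iff.rfl⟩
    · exact r.elim

theorem isPolyInterp_ring : IsPolyInterp (L := Language.ring[[R]])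
    (fun X : PField.{u} R => ringConStructure X.hom) where
  term {k} t := by
    induction t with
    | var i =>
      rcases i with i | i
      · exact i.elim
      · exact ⟨MvPolynomial.X i, fun X y => by simp⟩
    | @func l f ts ih =>
      choose p hp using ih
      rcases f with f | f
      · cases f with
        | add =>
          refine ⟨p 0 + p 1, fun X y => ?_⟩
          rw [MvPolynomial.eval₂_add, ← hp 0, ← hp 1]
          rfl
        | mul =>
          refine ⟨p 0 * p 1, fun X y => ?_⟩
          rw [MvPolynomial.eval₂_mul, ← hp 0, ← hp 1]
          rfl
        | neg =>
          refine ⟨-p 0, fun X y => ?_⟩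
          rw [← MvPolynomial.coe_eval₂Hom, map_neg, MvPolynomial.coe_eval₂Hom, ← hp 0]
          rfl
        | zero => exact ⟨0, fun X y => by rw [MvPolynomial.eval₂_zero]; rfl⟩
        | one => exact ⟨1, fun X y => by rw [MvPolynomial.eval₂_one]; rfl⟩
      · cases l with
        | zero =>
          exact ⟨MvPolynomial.C (σ := Fin k) (R := R) f,
            fun X y => (MvPolynomial.eval₂_C X.hom y (show R from f)).symm⟩
        | succ l => exact f.elim
  rel {l} r := by
    rcases r with r | r
    · exact r.elim
    · exact r.elim

/-- Existential sentences in the language of rings are finite disjunctions of systems. -/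
theorem exists_sol_of_isExistsN {n : ℕ} {φ : (Language.ring[[R]]).Sentence}
    (hφ : IsExistsN n φ) :
    ∃ A : List (List (MvPolynomial (Fin n) R) × MvPolynomial (Fin n) R),
      ∀ (M : Type u) [Field M] (f : R →+* M),
        RealizeRing M f φ ↔ ∃ s ∈ A, Sol f s.1 s.2 := by
  obtain ⟨A, hA⟩ := isPolyInterp_ring.{u}.exists_systems_sentence hφ
  refine ⟨(A.filter fun s => s.neg.isEmpty).map fun s => (s.eqs, s.neq), fun M _ f => ?_⟩
  refine (hA ⟨M, f, Set.univ⟩).trans ?_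
  simp only [List.mem_map, List.mem_filter, List.isEmpty_iff, exists_exists_and_eq_and]
  constructor
  · rintro ⟨s, hs, z, h1, h2, -, h4⟩
    refine ⟨s, ⟨hs, List.eq_nil_iff_forall_not_mem.2 fun p hp => h4 p hp trivial⟩, z, h1, h2⟩
  · rintro ⟨s, ⟨hs, hs'⟩, z, h1, h2⟩
    exact ⟨s, hs, z, h1, h2, fun _ _ => trivial, by simp [hs']⟩

theorem exists_term_of_mvPolynomial {k : ℕ} (p : MvPolynomial (Fin k) R) :
    ∃ t : (Language.ring[[R]]).Term (Empty ⊕ Fin k),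
      ∀ (M : Type u) [Field M] (f : R →+* M) (y : Fin k → M),
        @Term.realize _ M (ringConStructure f) _ (Sum.elim (default : Empty → _) y) t = p.eval₂ f y := by
  induction p using MvPolynomial.induction_on with
  | C a =>
    refine ⟨.func (l := 0) (.inr a) Fin.elim0, fun M _ f y => ?_⟩
    rw [MvPolynomial.eval₂_C]
    rfl
  | add p q hp hq =>
    obtain ⟨s, hs⟩ := hp
    obtain ⟨t, ht⟩ := hq
    refine ⟨.func (l := 2) (.inl .add) ![s, t], fun M _ f y => ?_⟩
    rw [MvPolynomial.eval₂_add, ← hs, ← ht]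
    rfl
  | mul_X p i hp =>
    obtain ⟨s, hs⟩ := hp
    refine ⟨.func (l := 2) (.inl .mul) ![s, .var (.inr i)], fun M _ f y => ?_⟩
    rw [MvPolynomial.eval₂_mul, ← hs, MvPolynomial.eval₂_X]
    rfl

theorem exists_formula_of_sys {k : ℕ} (P : List (MvPolynomial (Fin k) R))
    (q : MvPolynomial (Fin k) R) :
    ∃ φ : (Language.ring[[R]]).BoundedFormula Empty k, φ.IsQF ∧
      ∀ (M : Type u) [Field M] (f : R →+* M) (y : Fin k → M),
        @BoundedFormula.Realize _ M (ringConStructure f) _ _ φ default y ↔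
          (∀ p ∈ P, p.eval₂ f y = 0) ∧ q.eval₂ f y ≠ 0 := by
  obtain ⟨t0, ht0⟩ := exists_term_of_mvPolynomial (0 : MvPolynomial (Fin k) R)
  induction P with
  | nil =>
    obtain ⟨t, ht⟩ := exists_term_of_mvPolynomial q
    refine ⟨(t.bdEqual t0).not, (BoundedFormula.IsAtomic.equal _ _).isQF.not, fun M _ f y => ?_⟩
    rw [@BoundedFormula.realize_not _ M (ringConStructure f),
      @BoundedFormula.realize_bdEqual _ M (ringConStructure f), ht, ht0]
    simp
  | cons p P ih =>
    obtain ⟨φ, hφ, h⟩ := ih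
    obtain ⟨t, ht⟩ := exists_term_of_mvPolynomial p
    refine ⟨t.bdEqual t0 ⊓ φ, (BoundedFormula.IsAtomic.equal _ _).isQF.inf hφ, fun M _ f y => ?_⟩
    rw [@BoundedFormula.realize_inf _ M (ringConStructure f),
      @BoundedFormula.realize_bdEqual _ M (ringConStructure f), ht, ht0, h]
    simp [and_assoc]

theorem exists_sentence_of_formula {k n : ℕ} {φ : (Language.ring[[R]]).BoundedFormula Empty k}
    (hφ : IsExistsN n φ) :
    ∃ ψ : (Language.ring[[R]]).Sentence, IsExistsN (n + k) ψ ∧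
      ∀ (M : Type u) [Field M] (f : R →+* M), RealizeRing M f ψ ↔
        ∃ y : Fin k → M, @BoundedFormula.Realize _ M (ringConStructure f) _ _ φ default y := by
  induction k generalizing n with
  | zero =>
    refine ⟨φ, hφ, fun M _ f => ?_⟩
    simp only [RealizeRing, Sentence.Realize, Formula.Realize]
    exact ⟨fun h => ⟨_, h⟩, fun ⟨y, h⟩ => by rwa [Subsingleton.elim default y]⟩
  | succ k ih =>
    obtain ⟨ψ, hψ, h⟩ := ih hφ.ex
    refine ⟨ψ, by rwa [add_right_comm] at hψ, fun M _ f => ?_⟩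
    rw [h]
    simp only [@BoundedFormula.realize_ex _ M (ringConStructure f)]
    constructor
    · rintro ⟨y, a, h⟩
      exact ⟨_, h⟩
    · rintro ⟨y, h⟩
      obtain ⟨z, a, rfl⟩ : ∃ (z : Fin k → M) (a : M), y = Fin.snoc z a :=
        ⟨fun i => y i.castSucc, y (Fin.last k), (Fin.snoc_init_self y).symm⟩
      exact ⟨z, a, h⟩

/-- A system of polynomial conditions is expressed by an existential sentence. -/
theorem exists_sentence_of_sys {n : ℕ} (P : List (MvPolynomial (Fin n) R))
    (q : MvPolynomial (Fin n) R) :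
    ∃ φ : (Language.ring[[R]]).Sentence, IsExistsN n φ ∧
      ∀ (M : Type u) [Field M] (f : R →+* M), RealizeRing M f φ ↔ Sol f P q := by
  obtain ⟨φ, hφ, h⟩ := exists_formula_of_sys.{u} P q
  obtain ⟨ψ, hψ, h'⟩ := exists_sentence_of_formula.{u} (IsExistsN.qf (n := 0) hφ)
  refine ⟨ψ, by simpa using hψ, fun M _ f => ?_⟩
  simp only [h', h, Sol]

end Interp

end Paper

namespace Paper

/-! ### Henselian valuation rings with a uniformizer -/

/-- The form of Hensel's lemma used below: equations `1 + s + h₀ s² + h₁ s³ + ⋯ = 0` with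
coefficients in `I` have a solution in `A`. -/
def Hens {K : Type*} [Field K] (I A : Set K) : Prop :=
  ∀ (d : ℕ) (h : Fin d → K), (∀ j, h j ∈ I) →
    ∃ s ∈ A, 1 + s + ∑ j : Fin d, h j * s ^ ((j : ℕ) + 2) = 0

/-- The maximal ideal of a valuation subring, as a subset of the field. -/
def mx {K : Type*} [Field K] (O : ValuationSubring K) : Set K := {x | O.valuation x < 1}

section Basic

variable {K : Type*} [Field K] {O A : ValuationSubring K}

theorem mem_mx {x : K} : x ∈ mx O ↔ O.valuation x < 1 := Iff.rfl

theorem mx_subset : mx O ⊆ O := fun x hx => (O.valuation_le_one_iff x).1 (le_of_lt hx)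

theorem inv_mem_mx_of_notMem {x : K} (hx : x ∉ O) : x⁻¹ ∈ mx O := by
  rw [mem_mx, map_inv₀]
  rw [← O.valuation_le_one_iff, not_le] at hx
  exact inv_lt_one_of_one_lt₀ hx

theorem mem_mx_iff {x : K} : x ∈ mx O ↔ x = 0 ∨ x⁻¹ ∉ O := by
  rcases eq_or_ne x 0 with rfl | h
  · simp [mem_mx]
  · rw [mem_mx, ← O.valuation_le_one_iff, not_le, map_inv₀,
      one_lt_inv₀ (zero_lt_iff.2 ((map_ne_zero _).2 h))]
    simp [h]

theorem mx_subset_mx (h : O ≤ A) : mx A ⊆ mx O := by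
  intro x hx
  rw [mem_mx_iff] at hx ⊢
  exact hx.imp_right fun hx hx' => hx (h hx')

theorem mul_mem_mx {x y : K} (hx : x ∈ mx O) (hy : y ∈ O) : x * y ∈ mx O := by
  rw [mem_mx, map_mul]
  exact mul_lt_one_of_nonneg_of_lt_one_left zero_le hx ((O.valuation_le_one_iff y).2 hy)

theorem add_mem_mx {x y : K} (hx : x ∈ mx O) (hy : y ∈ mx O) : x + y ∈ mx O :=
  O.valuation.map_add_lt hx hy

theorem neg_mem_mx {x : K} (hx : x ∈ mx O) : -x ∈ mx O := by
  rwa [mem_mx, Valuation.map_neg]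

theorem coe_mem_mx {x : O} : (x : K) ∈ mx O ↔ x ∈ IsLocalRing.maximalIdeal O :=
  (O.valuation_lt_one_iff x).symm

theorem Hens.mono {I I' B B' : Set K} (h : Hens I B) (hI : I' ⊆ I) (hB : B ⊆ B') :
    Hens I' B' := fun d a ha =>
  let ⟨s, hs, e⟩ := h d a fun j => hI (ha j)
  ⟨s, hB hs, e⟩

theorem hens_of_henselianLocalRing (h : HenselianLocalRing O) : Hens (mx O) O := by
  intro d a ha
  have ha' (j) : a j ∈ O := mx_subset (ha j)
  let b : Fin d → O := fun j => ⟨a j, ha' j⟩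
  have hb (j) : b j ∈ IsLocalRing.maximalIdeal O := coe_mem_mx.1 (ha j)
  let g : Polynomial O := Polynomial.X ^ (d + 1) +
    ∑ j : Fin d, Polynomial.C (b j) * Polynomial.X ^ (d - (j : ℕ))
  have hg : g.degree < ((d + 2 : ℕ) : WithBot ℕ) := by
    refine (Polynomial.degree_lt_iff_coeff_zero _ _).2 fun m hm => ?_
    have hm' (j : Fin d) : m ≠ d - (j : ℕ) := by omega
    simp [g, Polynomial.coeff_X_pow, Polynomial.finsetSum_coeff, hm',
      show m ≠ d + 1 by omega]
  have hmonic : (Polynomial.X ^ (d + 2) + g).Monic := Polynomial.monic_X_pow_add hg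
  have hsum (c : Fin d → O) : ∑ j, b j * c j ∈ IsLocalRing.maximalIdeal O :=
    Ideal.sum_mem _ fun j _ => Ideal.mul_mem_right _ _ (hb j)
  have hroot : (Polynomial.X ^ (d + 2) + g).eval (-1) ∈ IsLocalRing.maximalIdeal O := by
    have : (Polynomial.X ^ (d + 2) + g).eval (-1) = ∑ j, b j * (-1) ^ (d - (j : ℕ)) := by
      simp only [g, Polynomial.eval_add, Polynomial.eval_pow, Polynomial.eval_X,
        Polynomial.eval_finsetSum, Polynomial.eval_mul, Polynomial.eval_C]
      ring
    rw [this]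
    exact hsum _
  have hder : IsUnit ((Polynomial.X ^ (d + 2) + g).derivative.eval (-1)) := by
    have : (Polynomial.X ^ (d + 2) + g).derivative.eval (-1) =
        (-1) ^ (d + 1) + ∑ j, b j * (((d - (j : ℕ) : ℕ) : O) * (-1) ^ (d - (j : ℕ) - 1)) := by
      simp only [g, Polynomial.derivative_add, Polynomial.derivative_X_pow,
        Polynomial.derivative_sum, Polynomial.derivative_C_mul, Polynomial.eval_add,
        Polynomial.eval_mul, Polynomial.eval_C, Polynomial.eval_pow, Polynomial.eval_X,
        Polynomial.eval_finsetSum]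
      rw [show d + 2 - 1 = d + 1 from rfl, show d + 1 - 1 = d from rfl]
      push_cast
      ring
    rw [this]
    by_contra hn
    have h1 := (IsLocalRing.mem_maximalIdeal _).2 hn
    have h2 := (Ideal.add_mem_iff_left _ (hsum _)).1 h1
    exact (IsLocalRing.mem_maximalIdeal _).1 h2 ((isUnit_one.neg).pow _)
  obtain ⟨r, hr, hr'⟩ := h.is_henselian _ hmonic _ hroot hder
  have hru : IsUnit r := by
    by_contra hn
    have h1 := (IsLocalRing.mem_maximalIdeal _).2 hn
    have h2 := Ideal.sub_mem _ hr' h1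
    rw [sub_neg_eq_add, add_sub_cancel_left] at h2
    exact (IsLocalRing.mem_maximalIdeal _).1 h2 isUnit_one
  obtain ⟨r, rfl⟩ := hru
  have hrs : (r : O) * ((r⁻¹ : Oˣ) : O) = 1 := r.mul_inv
  refine ⟨((r⁻¹ : Oˣ) : O), Subtype.prop _, ?_⟩
  set t : O := ((r⁻¹ : Oˣ) : O)
  have key : (1 + t + ∑ j : Fin d, b j * t ^ ((j : ℕ) + 2)) * (r : O) ^ (d + 2) = 0 := by
    rw [← hr.eq_zero]
    simp only [g, Polynomial.eval_add, Polynomial.eval_pow, Polynomial.eval_X,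
      Polynomial.eval_finsetSum, Polynomial.eval_mul, Polynomial.eval_C]
    rw [add_mul, add_mul, one_mul, Finset.sum_mul, add_assoc]
    congr 2
    · rw [pow_succ', ← mul_assoc, mul_comm t, hrs, one_mul]
    · refine Finset.sum_congr rfl fun j _ => ?_
      calc b j * t ^ ((j : ℕ) + 2) * (r : O) ^ (d + 2)
          = b j * t ^ ((j : ℕ) + 2) * (r : O) ^ ((d - (j : ℕ)) + ((j : ℕ) + 2)) := by
            congr 2; omega
        _ = b j * (r : O) ^ (d - (j : ℕ)) * ((r : O) * t) ^ ((j : ℕ) + 2) := by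
            rw [pow_add, mul_pow]; ring
        _ = b j * (r : O) ^ (d - (j : ℕ)) := by rw [hrs, one_pow, mul_one]
  rw [mul_eq_zero, or_iff_left (pow_ne_zero _ r.ne_zero)] at key
  have := congrArg (Subtype.val : O → K) key
  simpa [b] using this

end Basic

end Paper

namespace Paper

section Uniformizer

variable {K : Type*} [Field K] {O : ValuationSubring K} {π : K}

theorem IsUniformizer.ne_zero {Γ : Type*} [LinearOrderedCommGroupWithZero Γ] {v : Valuation K Γ}
    (h : IsUniformizer v π) : π ≠ 0 := (Valuation.ne_zero_iff v).1 h.1.ne'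

theorem IsUniformizer.mem_mx (h : IsUniformizer O.valuation π) : π ∈ mx O := h.2.1

/-- The valuation of a uniformizer is not the square of a value. -/
theorem IsUniformizer.valuation_sq_ne (h : IsUniformizer O.valuation π) (t : K) :
    O.valuation t ^ 2 ≠ O.valuation π := by
  intro ht
  rcases lt_or_ge (O.valuation t) 1 with h1 | h1
  · have h2 := h.2.2 t h1
    have h3 : O.valuation t ^ 2 ≤ O.valuation π ^ 2 := pow_le_pow_left₀ zero_le h2 2
    rw [ht] at h3
    have h4 : O.valuation π ^ 2 < O.valuation π := by
      rw [pow_two]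
      exact mul_lt_of_lt_one_left h.1 h.2.1
    exact absurd h3 h4.not_ge
  · have := one_le_pow₀ h1 (n := 2)
    rw [ht] at this
    exact absurd h.2.1 this.not_gt

theorem IsUniformizer.valuation_ge (h : IsUniformizer O.valuation π) {z : K} (hz : z ∉ O) :
    1 ≤ O.valuation (π * z) := by
  have hz0 : z ≠ 0 := fun h0 => hz (h0 ▸ O.zero_mem)
  have h1 := h.2.2 _ (inv_mem_mx_of_notMem hz)
  rw [map_inv₀, inv_le_iff_one_le_mul₀ (zero_lt_iff.2 ((map_ne_zero _).2 hz0))] at h1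
  rwa [map_mul]

theorem IsUniformizer.one_lt_valuation (h : IsUniformizer O.valuation π) {z : K} (hz : z ∉ O) :
    1 < O.valuation (π * z ^ 2) := by
  have h1 := h.valuation_ge hz
  have h2 : 1 < O.valuation z := by
    rwa [← not_le, O.valuation_le_one_iff]
  rw [pow_two, ← mul_assoc, map_mul]
  exact h2.trans_le (le_mul_of_one_le_left zero_le h1)

theorem IsUniformizer.mem_iff_exists (h : IsUniformizer O.valuation π) (hO : Hens (mx O) O)
    (z : K) : z ∈ O ↔ ∃ y, y ^ 2 + y = π * z ^ 2 := by
  constructor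
  · intro hz
    obtain ⟨s, -, hs⟩ := hO 1 (fun _ => -(π * z ^ 2)) fun _ =>
      neg_mem_mx (mul_mem_mx h.mem_mx (O.pow_mem hz 2))
    refine ⟨-(π * z ^ 2) * s, ?_⟩
    rw [Fin.sum_univ_one, Fin.val_zero, zero_add] at hs
    linear_combination (-(π * z ^ 2)) * hs
  · rintro ⟨y, hy⟩
    by_contra hz
    have h1 := h.one_lt_valuation hz
    rw [← hy] at h1
    have hy1 : 1 < O.valuation y := by
      rw [← not_le, O.valuation_le_one_iff]
      intro hyO
      exact h1.not_ge ((O.valuation_le_one_iff _).2 (O.add_mem _ _ (O.pow_mem hyO 2) hyO))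
    have h2 : O.valuation (y ^ 2 + y) = O.valuation y ^ 2 := by
      rw [Valuation.map_add_eq_of_lt_left, map_pow]
      rw [map_pow]
      exact lt_self_pow₀ hy1 one_lt_two
    have hz0 : z ≠ 0 := fun h0 => hz (h0 ▸ O.zero_mem)
    apply h.valuation_sq_ne (y / z)
    rw [map_div₀, div_pow, ← h2, hy, map_mul, map_pow]
    exact mul_div_cancel_right₀ _ (pow_ne_zero _ ((map_ne_zero _).2 hz0))

theorem IsUniformizer.add_mem_iff (h : IsUniformizer O.valuation π) (a b : K) :
    a ^ 2 + π * b ^ 2 ∈ O ↔ a ∈ O ∧ b ∈ O := by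
  constructor
  · intro hab
    have hpi : π ∈ O := mx_subset h.mem_mx
    have hb : b ∈ O := by
      by_contra hb
      have h1 := h.one_lt_valuation hb
      have hb0 : b ≠ 0 := fun h0 => hb (h0 ▸ O.zero_mem)
      have hne : O.valuation (a ^ 2) ≠ O.valuation (π * b ^ 2) := by
        intro he
        apply h.valuation_sq_ne (a / b)
        rw [map_div₀, div_pow, ← map_pow, he, map_mul, map_pow]
        exact mul_div_cancel_right₀ _ (pow_ne_zero _ ((map_ne_zero _).2 hb0))
      have h2 := Valuation.map_add_of_distinct_val _ hne
      rw [← O.valuation_le_one_iff, h2] at hab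
      exact h1.not_ge ((le_max_right _ _).trans hab)
    refine ⟨?_, hb⟩
    by_contra ha
    have : a ^ 2 ∈ O := by
      have := O.sub_mem hab (O.mul_mem _ _ hpi (O.pow_mem hb 2))
      rwa [add_sub_cancel_right] at this
    rw [← O.valuation_le_one_iff, map_pow] at this
    rw [← O.valuation_le_one_iff, not_le] at ha
    exact (one_lt_pow₀ ha two_ne_zero).not_ge this
  · rintro ⟨ha, hb⟩
    exact O.add_mem _ _ (O.pow_mem ha 2) (O.mul_mem _ _ (mx_subset h.mem_mx) (O.pow_mem hb 2))

theorem IsUniformizer.notMem_iff (h : IsUniformizer O.valuation π) (t : K) :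
    t ∉ O ↔ π * t ≠ 0 ∧ 1 / (π * t) ∈ O := by
  rw [one_div, ← O.valuation_le_one_iff, ← O.valuation_le_one_iff, map_inv₀]
  constructor
  · intro ht
    rw [O.valuation_le_one_iff] at ht
    have := h.valuation_ge ht
    exact ⟨mul_ne_zero h.ne_zero fun h0 => ht (h0 ▸ O.zero_mem), inv_le_one_of_one_le₀ this⟩
  · rintro ⟨h0, h1⟩
    have h2 := (inv_le_one₀ (zero_lt_iff.2 ((map_ne_zero _).2 h0))).1 h1
    rw [map_mul] at h2
    rw [not_le]
    by_contra h3
    exact h2.not_gt (mul_lt_one_of_nonneg_of_lt_one_left zero_le h.2.1 (not_lt.1 h3))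

end Uniformizer

section Elimination

variable {R : Type v} [CommRing R] {n : ℕ}

/-- A pair of polynomials, regarded as a fraction, takes a value in `O`. -/
def FracMem (X : PField.{u} R) (y : Fin n → X.carrier)
    (a : MvPolynomial (Fin n) R × MvPolynomial (Fin n) R) : Prop :=
  a.2.eval₂ X.hom y ≠ 0 ∧ a.1.eval₂ X.hom y / a.2.eval₂ X.hom y ∈ X.O

/-- `X` is a henselian valued field with uniformizer `π`. -/
def HensUnif (X : PField.{u} R) (π : R) : Prop :=
  ∃ O : ValuationSubring X.carrier, X.O = O ∧ Hens (mx O) O ∧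
    IsUniformizer O.valuation (X.hom π)

theorem exists_frac (π : R) (l : List (MvPolynomial (Fin n) R × MvPolynomial (Fin n) R)) :
    ∃ b, ∀ X : PField.{u} R, HensUnif X π → ∀ y : Fin n → X.carrier,
      FracMem X y b ↔ ∀ a ∈ l, FracMem X y a := by
  induction l with
  | nil =>
    refine ⟨(0, 1), ?_⟩
    rintro X ⟨O, hO, -, -⟩ y
    simp [FracMem, hO, O.zero_mem]
  | cons a l ih =>
    obtain ⟨b, hb⟩ := ih
    refine ⟨(a.1 ^ 2 * b.2 ^ 2 + MvPolynomial.C π * (b.1 ^ 2 * a.2 ^ 2), a.2 ^ 2 * b.2 ^ 2), ?_⟩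
    intro X hX y
    simp only [List.forall_mem_cons, ← hb X hX y]
    obtain ⟨O, hO, -, hπ⟩ := hX
    simp only [FracMem, MvPolynomial.eval₂_add, MvPolynomial.eval₂_mul, MvPolynomial.eval₂_pow,
      MvPolynomial.eval₂_C, hO, SetLike.mem_coe]
    set a1 := a.1.eval₂ X.hom y
    set a2 := a.2.eval₂ X.hom y
    set b1 := b.1.eval₂ X.hom y
    set b2 := b.2.eval₂ X.hom y
    by_cases ha : a2 = 0
    · simp [ha]
    by_cases hb : b2 = 0
    · simp [hb]
    have : (a1 ^ 2 * b2 ^ 2 + X.hom π * (b1 ^ 2 * a2 ^ 2)) / (a2 ^ 2 * b2 ^ 2) =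
        (a1 / a2) ^ 2 + X.hom π * (b1 / b2) ^ 2 := by
      field_simp
    rw [this, hπ.add_mem_iff]
    simp [ha, hb]

/-- Membership conditions in systems can be eliminated at the expense of one more variable. -/
theorem exists_sol_iff_holds (π : R) (s : Sys (Fin n) R) :
    ∃ (P : List (MvPolynomial (Fin (n + 1)) R)) (q : MvPolynomial (Fin (n + 1)) R),
      ∀ X : PField.{u} R, HensUnif X π → ((∃ z, s.Holds X z) ↔ Sol X.hom P q) := by
  obtain ⟨b, hb⟩ := exists_frac π
    (s.pos.map (fun p => (p, 1)) ++ s.neg.map (fun p => (1, MvPolynomial.C π * p)))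
  let y : MvPolynomial (Fin (n + 1)) R := MvPolynomial.X (Fin.last n)
  let ρ : MvPolynomial (Fin n) R → MvPolynomial (Fin (n + 1)) R :=
    MvPolynomial.rename Fin.castSucc
  refine ⟨(ρ b.2 ^ 2 * (y ^ 2 + y) - MvPolynomial.C π * ρ b.1 ^ 2) :: s.eqs.map ρ,
    ρ s.neq * ρ b.2, fun X hX => ?_⟩
  have hs (z : Fin n → X.carrier) : s.Holds X z ↔
      (∀ p ∈ s.eqs, p.eval₂ X.hom z = 0) ∧ s.neq.eval₂ X.hom z ≠ 0 ∧ FracMem X z b := by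
    rw [hb X hX z]
    obtain ⟨O, hO, -, hπ⟩ := hX
    simp only [Sys.Holds, List.mem_append, List.mem_map, FracMem, or_imp, forall_and,
      forall_exists_index, and_imp, forall_apply_eq_imp_iff₂, hO, SetLike.mem_coe,
      MvPolynomial.eval₂_mul, MvPolynomial.eval₂_C, MvPolynomial.eval₂_one, hπ.notMem_iff]
    simp
    tauto
  have key (z : Fin n → X.carrier) (c : X.carrier) (h0 : b.2.eval₂ X.hom z ≠ 0) :
      b.2.eval₂ X.hom z ^ 2 * (c ^ 2 + c) - X.hom π * b.1.eval₂ X.hom z ^ 2 = 0 ↔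
        c ^ 2 + c = X.hom π * (b.1.eval₂ X.hom z / b.2.eval₂ X.hom z) ^ 2 := by
    rw [sub_eq_zero, div_pow, mul_div_assoc', eq_div_iff (pow_ne_zero _ h0), mul_comm]
  have hy (z : Fin n → X.carrier) (c : X.carrier) :
      (Fin.snoc z c : Fin (n + 1) → X.carrier) ∘ Fin.castSucc = z := by
    funext i; simp
  simp only [hs]
  obtain ⟨O, hO, hH, hπ⟩ := hX
  simp only [FracMem, hO, SetLike.mem_coe, hπ.mem_iff_exists hH]
  constructor
  · rintro ⟨z, h1, h2, h3, c, h4⟩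
    refine ⟨Fin.snoc z c, ?_, ?_⟩
    · simp only [List.forall_mem_cons, List.forall_mem_map, ρ, MvPolynomial.eval₂_rename, hy]
      refine ⟨?_, h1⟩
      simpa [y, MvPolynomial.eval₂_sub, MvPolynomial.eval₂_rename, hy] using (key z c h3).2 h4
    · simpa [ρ, MvPolynomial.eval₂_rename, hy] using ⟨h2, h3⟩
  · rintro ⟨z', h1, h2⟩
    obtain ⟨z, c, rfl⟩ : ∃ z c, z' = Fin.snoc z c :=
      ⟨fun i => z' i.castSucc, z' (Fin.last n), (Fin.snoc_init_self z').symm⟩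
    simp only [List.forall_mem_cons, List.forall_mem_map, ρ, MvPolynomial.eval₂_rename, hy] at h1
    simp only [ρ, MvPolynomial.eval₂_mul, MvPolynomial.eval₂_rename, hy, ne_eq, mul_eq_zero,
      not_or] at h2
    refine ⟨z, h1.2, h2.1, h2.2, c, (key z c h2.2).1 ?_⟩
    simpa [y, MvPolynomial.eval₂_sub, MvPolynomial.eval₂_rename, hy] using h1.1

theorem IsPosBC.realize_imp {L : FirstOrder.Language.{w, x}} {M N : Type*} [L.Structure M]
    [L.Structure N] {P : ∀ {k : ℕ}, L.BoundedFormula Empty k → Prop} {k : ℕ}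
    {φ : L.BoundedFormula Empty k} (hφ : IsPosBC P φ) (y : Fin k → M) (z : Fin k → N)
    (h : ∀ ψ : L.BoundedFormula Empty k, P ψ → ψ.Realize default y → ψ.Realize default z) :
    φ.Realize default y → φ.Realize default z := by
  induction hφ with
  | base hP => exact h _ hP
  | inf _ _ h1 h2 =>
    rw [BoundedFormula.realize_inf, BoundedFormula.realize_inf]
    exact And.imp h1 h2
  | sup _ _ h1 h2 =>
    rw [BoundedFormula.realize_sup, BoundedFormula.realize_sup]
    exact Or.imp h1 h2

/-- The transfer of existential sentences in the language of rings from that of systems. -/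
theorem thRingSub_of_sol {K L : Type u} [Field K] [Field L] {f : R →+* K} {g : R →+* L}
    (h : ∀ P q, Sol (σ := Fin n) f P q → Sol g P q) :
    ThRingSub (fun {_} φ => IsExistsN n φ) K f L g := by
  intro φ hφ
  refine @IsPosBC.realize_imp _ K L (ringConStructure f) (ringConStructure g) _ _ _ hφ _ _
    fun ψ hψ => ?_
  obtain ⟨A, hA⟩ := exists_sol_of_isExistsN.{u} hψ
  exact fun h1 => let ⟨s, hs, h2⟩ := (hA K f).1 h1; (hA L g).2 ⟨s, hs, h _ _ h2⟩

/-- The transfer of existential sentences in `n` variables in the language of valued fields from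
the transfer of systems in `n + 1` variables. -/
theorem thValSub_of_sol {K L : Type u} [Field K] [Field L] {f : R →+* K} {g : R →+* L}
    {OK : Set K} {OL : Set L} {π : R} (hK : HensUnif ⟨K, f, OK⟩ π) (hL : HensUnif ⟨L, g, OL⟩ π)
    (h : ∀ P q, Sol (σ := Fin (n + 1)) f P q → Sol g P q) :
    ThValSub (fun {_} φ => IsExistsN n φ) K OK f L OL g := by
  intro φ hφ
  refine @IsPosBC.realize_imp _ K L (valConStructure OK f) (valConStructure OL g) _ _ _ hφ _ _
    fun ψ hψ => ?_
  obtain ⟨A, hA⟩ := isPolyInterp_val.{u}.exists_systems_sentence hψ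
  intro h'
  obtain ⟨s, hs, h'⟩ := (hA ⟨K, f, OK⟩).1 h'
  obtain ⟨P, q, hPq⟩ := exists_sol_iff_holds.{u} π s
  exact (hA ⟨L, g, OL⟩).2 ⟨s, hs, (hPq _ hL).2 (h _ _ ((hPq _ hK).1 h'))⟩

/-- The transfer of systems from that of existential sentences. -/
theorem sol_of_thRingSub {K L : Type u} [Field K] [Field L] {f : R →+* K} {g : R →+* L}
    (h : ThRingSub (fun {_} φ => IsExists φ) K f L g) {P : List (MvPolynomial (Fin n) R)}
    {q : MvPolynomial (Fin n) R} (hs : Sol f P q) : Sol g P q := by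
  obtain ⟨φ, hφ, H⟩ := exists_sentence_of_sys.{u} P q
  exact (H L g).1 (h φ (.base ⟨n, hφ⟩) ((H K f).2 hs))

end Elimination

section FieldStatements

variable {F : Type u} [Field F] {n : ℕ}

theorem largeField_of_sol (h : ∀ (n : ℕ) (P : List (MvPolynomial (Fin n) F)) (q),
    Sol (algebraMap F (LaurentSeries F)) P q → Sol (RingHom.id F) P q) : LargeField F := by
  rintro φ ⟨n, hφ⟩ h'
  obtain ⟨A, hA⟩ := exists_sol_of_isExistsN.{u} hφ
  obtain ⟨s, hs, h'⟩ := (hA _ (algebraMap F (LaurentSeries F))).1 h'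
  exact (hA F (RingHom.id F)).2 ⟨s, hs, h _ _ _ h'⟩

/-- `(R4_n)` for systems, and a valuation ring `A` containing a subfield `F` which is a set of
representatives for the residue field. -/
theorem R4N.sol (hR4 : R4N.{u} n) {E : Type u} [Field E] (A : ValuationSubring E) (F : Subfield E)
    (hF : LargeField F) (hFA : (F : Set E) ⊆ A) (hAF : ∀ y ∈ A, ∃ x ∈ F, y - x ∈ mx A)
    {P : List (MvPolynomial (Fin n) F)} {q : MvPolynomial (Fin n) F}
    (hs : Sol F.subtype P q) : Sol (RingHom.id F) P q := by
  obtain ⟨φ, hφ, H⟩ := exists_sentence_of_sys.{u} P q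
  refine (H F (RingHom.id F)).1 (hR4 E A.ValueGroup A.valuation F hF ?_ ?_ φ hφ
    ((H E F.subtype).2 hs))
  · intro y hy
    have h1 := (A.valuation_le_one_iff _).2 (hFA y.2)
    have h2 := (A.valuation_le_one_iff _).2 (hFA (F.inv_mem y.2))
    rw [map_inv₀, inv_le_one₀ (zero_lt_iff.2 ((map_ne_zero _).2 hy))] at h2
    exact h1.antisymm h2
  · intro y hy
    obtain ⟨x, hx, h⟩ := hAF y ((A.valuation_le_one_iff _).1 hy)
    exact ⟨⟨x, hx⟩, h⟩

end FieldStatements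

end Paper

namespace Paper

/-! ### Mac Lane's criterion -/

/-- Mac Lane's condition: every relation `∑ cᵢ xᵢ ^ p = 0` over `C` with a nontrivial solution in
`K` has one in `C`. -/
def MacLane (p : ℕ) {C K : Type*} [CommRing C] [CommRing K] (f : C →+* K) : Prop :=
  ∀ (n : ℕ) (c : Fin n → C) (x : Fin n → K), (∃ i, x i ≠ 0) → ∑ i, f (c i) * x i ^ p = 0 →
    ∃ y : Fin n → C, (∃ i, y i ≠ 0) ∧ ∑ i, c i * y i ^ p = 0

/-- Mac Lane's condition for the characteristic of `C`, if it is positive. -/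
def Sep {C K : Type*} [CommRing C] [CommRing K] (f : C →+* K) : Prop :=
  ∀ p : ℕ, p.Prime → CharP C p → MacLane p f

section MacLane

variable {C K L : Type*} [CommRing C] [CommRing K] [CommRing L] {p : ℕ}

theorem MacLane.comp {g : K →+* L} {f : C →+* K} (hg : MacLane p g) (hf : MacLane p f) :
    MacLane p (g.comp f) := by
  intro n c x hx h
  obtain ⟨y, hy, h'⟩ := hg n (fun i => f (c i)) x hx h
  exact hf n c y hy h'

theorem MacLane.of_comp {g : K →+* L} {f : C →+* K} (hg : Function.Injective g)
    (h : MacLane p (g.comp f)) : MacLane p f := by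
  intro n c x ⟨i, hi⟩ h'
  refine h n c (fun i => g (x i)) ⟨i, (map_ne_zero_iff g hg).2 hi⟩ ?_
  simpa using congrArg g h'

theorem MacLane.linearIndependent_pow {C K : Type*} [Field C] [Field K] [Algebra C K] [CharP K p]
    (hp : p.Prime) (h : MacLane p (algebraMap C K)) {n : ℕ} {e : Fin n → K}
    (he : LinearIndependent C e) : LinearIndependent C fun i => e i ^ p := by
  have : Fact p.Prime := ⟨hp⟩
  rw [Fintype.linearIndependent_iff]
  simp only [Algebra.smul_def]
  induction n with
  | zero => exact fun _ _ i => i.elim0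
  | succ n ih =>
    intro c hc
    obtain ⟨y, ⟨i, hi⟩, hy⟩ := h _ c e ⟨0, he.ne_zero 0⟩ hc
    let e' : Fin n → K := fun j => e (i.succAbove j) - algebraMap C K (y (i.succAbove j) / y i) * e i
    have he' : LinearIndependent C e' := by
      rw [Fintype.linearIndependent_iff] at he ⊢
      intro d hd
      have := he (i.insertNth (-∑ j, d j * (y (i.succAbove j) / y i)) d) (by
        rw [Fin.sum_univ_succAbove _ i]
        simp only [Fin.insertNth_apply_same, Fin.insertNth_apply_succAbove]
        rw [← hd]
        simp only [e', Algebra.smul_def, mul_sub, Finset.sum_sub_distrib, map_neg, map_sum, map_mul,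
          neg_mul, Finset.sum_mul, mul_assoc]
        ring)
      intro j
      simpa using this (i.succAbove j)
    have hc' (j) : c (i.succAbove j) = 0 := by
      refine ih he' (fun j => c (i.succAbove j)) ?_ j
      have hy' := congrArg (algebraMap C K) hy
      rw [Fin.sum_univ_succAbove _ i] at hc
      rw [map_sum, Fin.sum_univ_succAbove _ i] at hy'
      simp only [map_mul, map_pow, map_zero] at hy'
      have hi' : algebraMap C K (y i) ≠ 0 := (map_ne_zero _).2 hi
      simp only [e', sub_pow_char, mul_pow, map_div₀, div_pow, mul_sub, Finset.sum_sub_distrib]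
      have : ∑ j : Fin n, algebraMap C K (c (i.succAbove j)) *
          (algebraMap C K (y (i.succAbove j)) ^ p / algebraMap C K (y i) ^ p * e i ^ p) =
          (∑ j : Fin n, algebraMap C K (c (i.succAbove j)) *
            algebraMap C K (y (i.succAbove j)) ^ p) * (e i ^ p / algebraMap C K (y i) ^ p) := by
        rw [Finset.sum_mul]
        exact Finset.sum_congr rfl fun j _ => by ring
      rw [this, eq_neg_of_add_eq_zero_right hy', eq_neg_of_add_eq_zero_right hc]
      field_simp
      ring
    have hi0 : c i = 0 := by
      rw [Fin.sum_univ_succAbove _ i] at hc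
      simpa [hc', he.ne_zero i, hp.ne_zero] using hc
    intro j
    rcases Fin.eq_self_or_eq_succAbove i j with rfl | ⟨j, rfl⟩
    · exact hi0
    · exact hc' j

theorem macLane_of_linearIndependent_pow {C K : Type*} [Field C] [Field K] [Algebra C K]
    [CharP K p] (hp : p.Prime)
    (h : ∀ (n : ℕ) (e : Fin n → K), LinearIndependent C e → LinearIndependent C fun i => e i ^ p) :
    MacLane p (algebraMap C K) := by
  have : Fact p.Prime := ⟨hp⟩
  rintro n c x ⟨i, hi⟩ hx
  let V := Submodule.span C (Set.range x)
  have : FiniteDimensional C V := FiniteDimensional.span_of_finite C (Set.finite_range x)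
  let b := Module.finBasis C V
  let e (j) : K := b j
  have he : LinearIndependent C e := b.linearIndependent.map' V.subtype V.ker_subtype
  let x' (i) : V := ⟨x i, Submodule.subset_span ⟨i, rfl⟩⟩
  have hx' (i) : x i = ∑ j, algebraMap C K (b.repr (x' i) j) * e j := by
    have h1 := congrArg Subtype.val (b.sum_repr (x' i))
    rw [Submodule.coe_sum] at h1
    simpa only [Submodule.coe_smul, Algebra.smul_def] using h1.symm
  have key := Fintype.linearIndependent_iff.1 (h _ e he)
    (fun j => ∑ i, c i * b.repr (x' i) j ^ p) (by
      rw [← hx]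
      simp only [hx', sum_pow_char, mul_pow, Finset.mul_sum, Algebra.smul_def, map_sum, map_mul,
        map_pow, Finset.sum_mul, mul_assoc]
      exact Finset.sum_comm)
  by_contra! hcon
  refine hi ((hx' i).trans (Finset.sum_eq_zero fun j _ => ?_))
  by_contra hne
  refine hcon (fun i => b.repr (x' i) j) ⟨i, fun h0 => hne ?_⟩ (key j)
  rw [h0, map_zero, zero_mul]

theorem MacLane.of_isFractionRing {R K : Type*} [CommRing R] [IsDomain R] [Field K] [Algebra R K]
    [IsFractionRing R K] {f : C →+* R} (h : MacLane p f) : MacLane p ((algebraMap R K).comp f) := by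
  rintro n c x ⟨i, hi⟩ hx
  obtain ⟨b, hb⟩ := IsLocalization.exist_integer_multiples_of_finite (nonZeroDivisors R) x
  choose z hz using hb
  have hinj := IsFractionRing.injective R K
  have hb0 : algebraMap R K b ≠ 0 := (map_ne_zero_iff _ hinj).2 (nonZeroDivisors.ne_zero b.2)
  have hz' (i) : algebraMap R K (z i) = algebraMap R K b * x i := by
    rw [hz, Algebra.smul_def]
  refine h n c z ⟨i, fun h0 => ?_⟩ (hinj ?_)
  · have := hz' i
    rw [h0, map_zero, eq_comm, mul_eq_zero] at this
    exact this.elim hb0 hi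
  · have : ∑ i, algebraMap R K (f (c i)) * algebraMap R K (z i) ^ p = 0 := by
      have h2 := congrArg (· * algebraMap R K b ^ p) hx
      simp only [zero_mul, Finset.sum_mul] at h2
      rw [← h2]
      exact Finset.sum_congr rfl fun i _ => by rw [hz', mul_pow, RingHom.comp_apply]; ring
    simpa using this

theorem macLane_mvPolynomial [CharP C p] (hp : p.Prime) (σ : Type*) :
    MacLane p (MvPolynomial.C : C →+* MvPolynomial σ C) := by
  have : Fact p.Prime := ⟨hp⟩
  have := charP_of_injective_ringHom (MvPolynomial.C_injective σ C) p
  rintro n c x ⟨i, hi⟩ hx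
  obtain ⟨m, hm⟩ := MvPolynomial.ne_zero_iff.1 hi
  refine ⟨fun i => (x i).coeff m, ⟨i, hm⟩, ?_⟩
  have h1 (i) : x i ^ p = MvPolynomial.expand p (MvPolynomial.map (frobenius C p) (x i)) := by
    rw [← MvPolynomial.map_expand, MvPolynomial.map_frobenius_expand]
  have h2 : MvPolynomial.expand p
      (∑ i, MvPolynomial.C (c i) * MvPolynomial.map (frobenius C p) (x i)) = 0 := by
    rw [← hx]
    simp [h1]
  rw [MvPolynomial.expand_eq_zero hp.pos] at h2
  have h3 := congrArg (MvPolynomial.coeff m) h2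
  simpa [MvPolynomial.coeff_sum, MvPolynomial.coeff_C_mul, MvPolynomial.coeff_map,
    frobenius_def] using h3

end MacLane

section Separable

variable {F E : Type*} [Field F] [Field E]

theorem HasSepTransBasis.macLane [Algebra F E] {p : ℕ} (hp : p.Prime) [CharP F p]
    (h : HasSepTransBasis F E) : MacLane p (algebraMap F E) := by
  obtain ⟨s, hs, hsep⟩ := h
  have : CharP E p := charP_of_injective_ringHom (algebraMap F E).injective p
  have : CharP (IntermediateField.adjoin F s) p :=
    charP_of_injective_ringHom (algebraMap F _).injective p
  have : ExpChar (IntermediateField.adjoin F s) p := .prime hp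
  have h1 : MacLane p (algebraMap (IntermediateField.adjoin F s) E) :=
    macLane_of_linearIndependent_pow hp fun n e he => by
      simpa using he.map_pow_expChar_pow_of_isSeparable p 1
  have h2 : MacLane p (algebraMap F (Algebra.adjoin F s)) := by
    have h3 := macLane_mvPolynomial (C := F) hp s
    have h4 : MacLane p (algebraMap F (Algebra.adjoin F (Set.range ((↑) : s → E)))) := by
      have : algebraMap F (Algebra.adjoin F (Set.range ((↑) : s → E))) =
        (hs.aevalEquiv : MvPolynomial s F →+* _).comp MvPolynomial.C :=
          RingHom.ext fun x => (hs.aevalEquiv.commutes x).symm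
      rw [this]
      refine MacLane.of_comp (g := (hs.aevalEquiv.symm : _ →+* MvPolynomial s F))
        hs.aevalEquiv.symm.injective ?_
      convert h3
      ext x : 1
      exact hs.aevalEquiv.symm_apply_apply _
    rwa [Subtype.range_coe] at h4
  open scoped IntermediateField.algebraAdjoinAdjoin in
  exact h1.comp (h2.of_isFractionRing (K := IntermediateField.adjoin F s))

theorem IsSepExtHom.sep {f : F →+* E} (h : IsSepExtHom f) : Sep f := by
  intro p hp hF n c x hx hcx
  classical
  let _ := f.toAlgebra
  have := (h (Finset.univ.image x)).macLane hp
  let x' (i) : IntermediateField.adjoin F (Finset.univ.image x : Set E) :=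
    ⟨x i, IntermediateField.subset_adjoin _ _ (by simp)⟩
  obtain ⟨i, hi⟩ := hx
  refine this n c x' ⟨i, fun h0 => hi (congrArg Subtype.val h0)⟩ (Subtype.ext ?_)
  rw [ZeroMemClass.coe_zero, ← hcx]
  simp [x', RingHom.algebraMap_toAlgebra]

theorem Sep.exists_isTranscendenceBasis [Algebra F E] (h : Sep (algebraMap F E)) (B : Finset E) :
    ∃ s : Finset (IntermediateField.adjoin F (B : Set E)),
      AlgebraicIndependent F ((↑) : s → IntermediateField.adjoin F (B : Set E)) ∧
      Algebra.IsSeparable (IntermediateField.adjoin F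
        (s : Set (IntermediateField.adjoin F (B : Set E))))
        (IntermediateField.adjoin F (B : Set E)) := by
  set M := IntermediateField.adjoin F (B : Set E)
  have : Algebra.EssFiniteType F M := by
    rw [IntermediateField.essFiniteType_iff]
    exact IntermediateField.fg_adjoin_finset B
  obtain hF | ⟨p, hp, hF⟩ := CharP.exists' F
  · obtain ⟨s, hs, hs'⟩ := exists_isTranscendenceBasis_and_isSeparable_of_perfectField F M
    exact ⟨s, hs.1, hs'⟩
  · have hp := hp.out
    have : ExpChar F p := .prime hp
    have : CharP M p := charP_of_injective_ringHom (algebraMap F M).injective p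
    have hM : MacLane p (algebraMap F M) :=
      MacLane.of_comp (g := algebraMap M E) (algebraMap M E).injective (h p hp hF)
    obtain ⟨s, hs, hs'⟩ :=
      exists_isTranscendenceBasis_and_isSeparable_of_linearIndepOn_pow_of_essFiniteType
        (k := F) (K := M) p hp fun s hs => by
          have := (linearIndependent_equiv s.equivFin.symm).2 hs
          have := hM.linearIndependent_pow hp this
          exact (linearIndependent_equiv s.equivFin.symm).1 this
    exact ⟨s, hs.1, hs'⟩

end Separable

end Paper

namespace Paper

/-! ### Lifting subfields of the residue field of a henselian ring -/

theorem Hens.henselianLocalRing {K : Type*} [Field K] {A : ValuationSubring K}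
    (h : Hens (mx A) A) : HenselianLocalRing A where
  is_henselian f _ a ha hu := by
    obtain ⟨w, hw⟩ := hu
    set c : A := f.eval a * ↑w⁻¹ with hc
    have hcm : (c : K) ∈ mx A := by
      rw [coe_mem_mx]
      exact Ideal.mul_mem_right _ _ ha
    set g := Polynomial.taylor a f with hg
    obtain ⟨s, hs, hs'⟩ := h f.natDegree
      (fun j => ((g.coeff ((j : ℕ) + 2) * c ^ ((j : ℕ) + 1) * ↑w⁻¹ : A) : K)) (fun j => by
        rw [coe_mem_mx] at hcm ⊢
        rw [pow_succ]
        exact Ideal.mul_mem_right _ _ (Ideal.mul_mem_left _ _ (Ideal.mul_mem_left _ _ hcm)))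
    lift s to A using hs
    have hs2 : 1 + s + ∑ j : Fin f.natDegree,
        (g.coeff ((j : ℕ) + 2) * c ^ ((j : ℕ) + 1) * ↑w⁻¹) * s ^ ((j : ℕ) + 2) = 0 := by
      apply Subtype.val_injective
      push_cast at hs' ⊢
      exact hs'
    have hwc : ↑w * c = f.eval a := by rw [hc, mul_comm, mul_assoc, Units.inv_mul, mul_one]
    refine ⟨c * s + a, ?_, ?_⟩
    · rw [Polynomial.IsRoot, ← Polynomial.taylor_eval, ← hg,
        Polynomial.eval_eq_sum_range' (n := f.natDegree + 2) (by
          rw [hg, Polynomial.natDegree_taylor]; omega),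
        Finset.sum_range_succ', Finset.sum_range_succ', Finset.sum_range]
      simp only [hg, zero_add, Polynomial.taylor_coeff_zero, Polynomial.taylor_coeff_one, ← hw]
      rw [← hg, ← hwc]
      have : ∀ j : Fin f.natDegree, g.coeff ((j : ℕ) + 1 + 1) * (c * s) ^ ((j : ℕ) + 1 + 1) =
          (w : A) * c * ((g.coeff ((j : ℕ) + 2) * c ^ ((j : ℕ) + 1) * ↑w⁻¹) * s ^ ((j : ℕ) + 2)) := by
        intro j
        have := w.mul_inv
        linear_combination (-(g.coeff ((j : ℕ) + 2) * (c * s) ^ ((j : ℕ) + 2))) * this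
      rw [Finset.sum_congr rfl fun j _ => this j, ← Finset.mul_sum]
      linear_combination (w * c) * hs2
    · rw [add_sub_cancel_right]
      rw [coe_mem_mx] at hcm
      exact Ideal.mul_mem_right _ _ hcm

section Lift

variable {F M A : Type*} [Field F] [Field M] [Algebra F M] [CommRing A]

theorem exists_lift_of_algebraicIndependent [IsLocalRing A] (ι : F →+* A)
    (φ : M →+* IsLocalRing.ResidueField A)
    (h : ∀ x, φ (algebraMap F M x) = IsLocalRing.residue A (ι x)) {s : Set M}
    (hs : AlgebraicIndependent F ((↑) : s → M)) :
    ∃ l : IntermediateField.adjoin F s →+* A, (∀ x, l (algebraMap F _ x) = ι x) ∧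
      ∀ x, IsLocalRing.residue A (l x) = φ x := by
  choose t ht using fun i : s => IsLocalRing.residue_surjective (φ i)
  obtain ⟨l₀, hl₀, hl₀'⟩ : ∃ l : Algebra.adjoin F s →+* A, (∀ x, l (algebraMap F _ x) = ι x) ∧
      ∀ x, IsLocalRing.residue A (l x) = φ x := by
    suffices ∃ l : Algebra.adjoin F (Set.range ((↑) : s → M)) →+* A,
        (∀ x, l (algebraMap F _ x) = ι x) ∧ ∀ x, IsLocalRing.residue A (l x) = φ x by
      rwa [Subtype.range_coe] at this
    refine ⟨(MvPolynomial.eval₂Hom ι t).comp (hs.aevalEquiv.symm : _ →+* MvPolynomial s F),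
      fun x => by simp, fun x => ?_⟩
    obtain ⟨y, rfl⟩ := hs.aevalEquiv.surjective x
    simp only [RingHom.comp_apply, RingHom.coe_coe, AlgEquiv.symm_apply_apply]
    induction y using MvPolynomial.induction_on with
    | C a => simp [h]
    | add p q hp hq => simp_all
    | mul_X p i hp => simp_all
  have hu (y : nonZeroDivisors (Algebra.adjoin F s)) : IsUnit (l₀ y) := by
    rw [← IsLocalRing.residue_ne_zero_iff_isUnit, hl₀', map_ne_zero]
    simp
  open scoped IntermediateField.algebraAdjoinAdjoin in
  refine ⟨IsLocalization.lift (S := IntermediateField.adjoin F s) hu, fun x => ?_, fun x => ?_⟩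
  · rw [IsScalarTower.algebraMap_apply F (Algebra.adjoin F s), IsLocalization.lift_eq, hl₀]
  · have : (IsLocalRing.residue A).comp
        (IsLocalization.lift (S := IntermediateField.adjoin F s) hu) =
        φ.comp (IntermediateField.adjoin F s).subtype :=
      IsLocalization.ringHom_ext (nonZeroDivisors (Algebra.adjoin F s)) (RingHom.ext fun y => by
        simp only [RingHom.comp_apply, IsLocalization.lift_eq, hl₀']
        rfl)
    exact congrArg (fun f => f x) this

theorem exists_lift_of_isSeparable [HenselianLocalRing A] (ι : F →+* A)
    (φ : M →+* IsLocalRing.ResidueField A)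
    (h : ∀ x, φ (algebraMap F M x) = IsLocalRing.residue A (ι x))
    [FiniteDimensional F M] [Algebra.IsSeparable F M] :
    ∃ l : M →+* A, (∀ x, l (algebraMap F _ x) = ι x) ∧
      ∀ x, IsLocalRing.residue A (l x) = φ x := by
  let _ := ι.toAlgebra
  let pb := Field.powerBasisOfFiniteOfSeparable F M
  obtain ⟨a0, ha0⟩ := IsLocalRing.residue_surjective (φ pb.gen)
  have hφ : φ.comp (algebraMap F M) = (IsLocalRing.residue A).comp ι := RingHom.ext h
  have hev (f : Polynomial F) : IsLocalRing.residue A ((f.map ι).eval a0) =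
      φ (f.eval₂ (algebraMap F M) pb.gen) := by
    rw [Polynomial.eval_map, Polynomial.hom_eval₂, ha0, ← hφ, Polynomial.hom_eval₂]
  obtain ⟨a, ha, haa0⟩ := HenselianLocalRing.is_henselian ((minpoly F pb.gen).map ι)
    ((minpoly.monic (Algebra.IsIntegral.isIntegral _)).map _) a0 (by
      rw [← IsLocalRing.residue_eq_zero_iff, hev, ← Polynomial.aeval_def, minpoly.aeval, map_zero])
    (by
      rw [Polynomial.derivative_map, ← IsLocalRing.residue_ne_zero_iff_isUnit, hev,
        ← Polynomial.aeval_def, map_ne_zero]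
      exact (Algebra.IsSeparable.isSeparable F pb.gen).aeval_derivative_ne_zero
        (minpoly.aeval _ _))
  let l : M →ₐ[F] A := pb.lift a (by
    rw [Polynomial.aeval_def, ← Polynomial.eval_map]
    exact ha)
  refine ⟨l, l.commutes, fun x => ?_⟩
  obtain ⟨f, rfl⟩ := pb.exists_eq_aeval' x
  have : l pb.gen = a := pb.lift_gen _ _
  have hres : IsLocalRing.residue A a = IsLocalRing.residue A a0 := by
    rwa [← sub_eq_zero, ← map_sub, IsLocalRing.residue_eq_zero_iff]
  rw [RingHom.coe_coe, ← Polynomial.aeval_algHom_apply, this, Polynomial.aeval_def,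
    Polynomial.hom_eval₂, hres, ha0, Polynomial.aeval_def, Polynomial.hom_eval₂, hφ]
  rfl

theorem exists_lift {E₀ : Type*} [Field E₀] [Algebra F E₀] (hsep : Sep (algebraMap F E₀))
    [HenselianLocalRing A] (ι : F →+* A) (φ : E₀ →+* IsLocalRing.ResidueField A)
    (h : ∀ x, φ (algebraMap F E₀ x) = IsLocalRing.residue A (ι x)) (B : Finset E₀) :
    ∃ l : IntermediateField.adjoin F (B : Set E₀) →+* A, (∀ x, l (algebraMap F _ x) = ι x) ∧
      ∀ x, IsLocalRing.residue A (l x) = φ x := by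
  set M := IntermediateField.adjoin F (B : Set E₀)
  obtain ⟨s, hs, hsep⟩ := hsep.exists_isTranscendenceBasis B
  let ψ : M →+* IsLocalRing.ResidueField A := φ.comp M.subtype
  obtain ⟨l₀, hl₀, hl₀'⟩ := exists_lift_of_algebraicIndependent ι ψ h hs
  have : Algebra.EssFiniteType F M := by
    rw [IntermediateField.essFiniteType_iff]
    exact IntermediateField.fg_adjoin_finset B
  have : Algebra.EssFiniteType (IntermediateField.adjoin F (s : Set M)) M := .of_comp F _ _
  have : FiniteDimensional (IntermediateField.adjoin F (s : Set M)) M :=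
    Algebra.finite_of_essFiniteType_of_isAlgebraic
  obtain ⟨l, hl, hl'⟩ := exists_lift_of_isSeparable l₀ ψ (fun x => (hl₀' x).symm)
  exact ⟨l, fun x => (hl (algebraMap F _ x)).trans (hl₀ x), hl'⟩

end Lift

end Paper

namespace Paper

open Filter

/-! ### Solutions of systems along ring homomorphisms -/

section Sol

variable {R M N σ : Type*} [CommRing R] [CommRing M] [CommRing N]
  {P : List (MvPolynomial σ R)} {q : MvPolynomial σ R}

theorem Sol.map {f : R →+* M} (h : Sol f P q) {g : M →+* N} (hg : Function.Injective g) :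
    Sol (g.comp f) P q := by
  obtain ⟨x, hx, hq⟩ := h
  have key (p : MvPolynomial σ R) : p.eval₂ (g.comp f) (fun i => g (x i)) = g (p.eval₂ f x) :=
    (MvPolynomial.eval₂_comp_left g f x p).symm
  exact ⟨fun i => g (x i), fun p hp => by rw [key, hx p hp, map_zero], by
    rwa [key, map_ne_zero_iff _ hg]⟩

theorem Sol.lift [Finite σ] {F E₀ A : Type*} [Field F] [Field E₀] [CommRing A]
    [HenselianLocalRing A] {f : F →+* E₀} (hf : Sep f) (ι : F →+* A)
    (φ : E₀ →+* IsLocalRing.ResidueField A) (h : φ.comp f = (IsLocalRing.residue A).comp ι)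
    {P : List (MvPolynomial σ F)} {q : MvPolynomial σ F} (hs : Sol f P q) : Sol ι P q := by
  classical
  cases nonempty_fintype σ
  obtain ⟨x, hx, hq⟩ := hs
  let _ := f.toAlgebra
  let B : Finset E₀ := Finset.univ.image x
  obtain ⟨l, hl, hl'⟩ := exists_lift (F := F) hf ι φ (fun x => congrArg (fun g => g x) h) B
  let M := IntermediateField.adjoin F (B : Set E₀)
  let x' (i) : M := ⟨x i, IntermediateField.subset_adjoin _ _ (by simp [B])⟩
  have key (p : MvPolynomial σ F) : p.eval₂ ι (fun i => l (x' i)) =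
      l (p.eval₂ (algebraMap F M) x') := by
    rw [MvPolynomial.eval₂_comp_left]
    congr
    exact (RingHom.ext hl).symm
  have key2 (p : MvPolynomial σ F) : p.eval₂ f x = algebraMap M E₀ (p.eval₂ (algebraMap F M) x') :=
    (MvPolynomial.eval₂_comp_left (algebraMap M E₀) (algebraMap F M) x' p).symm
  have key3 (p : MvPolynomial σ F) : p.eval₂ f x = 0 ↔ p.eval₂ ι (fun i => l (x' i)) = 0 := by
    rw [key, key2, map_eq_zero, map_eq_zero]
  exact ⟨fun i => l (x' i), fun p hp => (key3 p).1 (hx p hp), fun h0 => hq ((key3 q).2 h0)⟩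

end Sol

/-! ### Ultrapowers -/

section Ultrapower

variable {I : Type*} (U : Ultrafilter I)

/-- The ultrapower of `K` along `U`. -/
abbrev UP (K : Type*) := Germ (U : Filter I) K

/-- The class of a family in the ultrapower. -/
def UP.mk (K : Type*) [CommRing K] : (I → K) →+* UP U K := Germ.coeRingHom _

/-- The diagonal embedding. -/
def UP.diag (K : Type*) [CommRing K] : K →+* UP U K := (UP.mk U K).comp (Pi.constRingHom I K)

variable {U} {K : Type*}

section CommRing

variable [CommRing K]

theorem UP.diag_apply (x : K) : UP.diag U K x = UP.mk U K fun _ => x := rfl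

theorem UP.mk_surjective : Function.Surjective (UP.mk U K) := fun x =>
  Germ.inductionOn x fun f => ⟨f, rfl⟩

theorem UP.mk_eq {f g : I → K} : UP.mk U K f = UP.mk U K g ↔ ∀ᶠ i in U, f i = g i :=
  Germ.coe_eq

theorem UP.mk_eq_zero {f : I → K} : UP.mk U K f = 0 ↔ ∀ᶠ i in U, f i = 0 :=
  Germ.coe_eq

theorem UP.mk_ne_zero {f : I → K} : UP.mk U K f ≠ 0 ↔ ∀ᶠ i in U, f i ≠ 0 := by
  rw [Ne, UP.mk_eq_zero, Ultrafilter.eventually_not]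

theorem UP.diag_injective : Function.Injective (UP.diag U K) := fun x y h => by
  simpa [UP.diag_apply, UP.mk_eq] using h

theorem UP.sol_iff {R σ : Type*} [CommRing R] [Finite σ] {f : R →+* K}
    {P : List (MvPolynomial σ R)} {q : MvPolynomial σ R} :
    Sol ((UP.diag U K).comp f) P q ↔ Sol f P q := by
  refine ⟨fun ⟨x, hx, hq⟩ => ?_, fun h => h.map UP.diag_injective⟩
  choose y hy using fun j => UP.mk_surjective (x j)
  have key (p : MvPolynomial σ R) : p.eval₂ ((UP.diag U K).comp f) x =
      UP.mk U K fun i => p.eval₂ f fun j => y j i := by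
    obtain rfl : (fun j => UP.mk U K (y j)) = x := funext hy
    rw [UP.diag, RingHom.comp_assoc, ← Function.comp_def (UP.mk U K), ← MvPolynomial.eval₂_comp_left]
    congr 1
    ext i
    exact MvPolynomial.eval₂_comp_left (Pi.evalRingHom (fun _ => K) i) _ _ _
  simp only [key, UP.mk_eq_zero, UP.mk_ne_zero] at hx hq
  obtain ⟨i, hi, hi'⟩ := (((eventually_all_finite P.finite_toSet).2 hx).and hq).exists
  exact ⟨fun j => y j i, hi, hi'⟩

theorem UP.macLane_diag (p : ℕ) : MacLane p (UP.diag U K) := by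
  rintro n c x ⟨j, hj⟩ hx
  choose y hy using fun j => UP.mk_surjective (x j)
  obtain rfl : (fun j => UP.mk U K (y j)) = x := funext hy
  have : (∑ j, UP.diag U K (c j) * UP.mk U K (y j) ^ p) =
      UP.mk U K fun i => ∑ j, c j * y j i ^ p := by
    simp only [UP.diag_apply, ← map_pow, ← map_mul, ← map_sum]
    congr 1
    ext i
    simp
  rw [this, UP.mk_eq_zero] at hx
  obtain ⟨i, hi, hi'⟩ := ((UP.mk_ne_zero.1 hj).and hx).exists
  exact ⟨fun j => y j i, ⟨j, hi⟩, hi'⟩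

end CommRing

section Field

variable [Field K]

theorem UP.mk_inv (f : I → K) : UP.mk U K (fun i => (f i)⁻¹) = (UP.mk U K f)⁻¹ := rfl

variable (U) in
/-- The ultrapower of a valuation ring. -/
def ultra (O : ValuationSubring K) : ValuationSubring (UP U K) where
  carrier := {x | Germ.LiftPred (· ∈ O) x}
  mul_mem' {x y} hx hy := by
    obtain ⟨x, rfl⟩ := UP.mk_surjective x
    obtain ⟨y, rfl⟩ := UP.mk_surjective y
    exact (Eventually.and hx hy).mono fun i hi => mul_mem hi.1 hi.2
  add_mem' {x y} hx hy := by
    obtain ⟨x, rfl⟩ := UP.mk_surjective x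
    obtain ⟨y, rfl⟩ := UP.mk_surjective y
    exact (Eventually.and hx hy).mono fun i hi => add_mem hi.1 hi.2
  neg_mem' {x} hx := by
    obtain ⟨x, rfl⟩ := UP.mk_surjective x
    exact Eventually.mono hx fun i hi => neg_mem hi
  one_mem' := Eventually.of_forall fun _ => O.one_mem
  zero_mem' := Eventually.of_forall fun _ => O.zero_mem
  mem_or_inv_mem' x := by
    obtain ⟨x, rfl⟩ := UP.mk_surjective x
    exact Ultrafilter.eventually_or.1 (Eventually.of_forall fun i => O.mem_or_inv_mem (x i))

variable {O : ValuationSubring K}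

theorem mk_mem_ultra {f : I → K} : UP.mk U K f ∈ ultra U O ↔ ∀ᶠ i in U, f i ∈ O := Iff.rfl

theorem diag_mem_ultra {x : K} : UP.diag U K x ∈ ultra U O ↔ x ∈ O := by
  rw [UP.diag_apply, mk_mem_ultra, eventually_const]

theorem mk_mem_mx_ultra {f : I → K} : UP.mk U K f ∈ mx (ultra U O) ↔ ∀ᶠ i in U, f i ∈ mx O := by
  simp only [mem_mx_iff, UP.mk_eq_zero, ← UP.mk_inv, mk_mem_ultra, Ultrafilter.eventually_or,
    Ultrafilter.eventually_not]

theorem diag_mem_mx_ultra {x : K} : UP.diag U K x ∈ mx (ultra U O) ↔ x ∈ mx O := by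
  rw [UP.diag_apply, mk_mem_mx_ultra, eventually_const]

theorem Hens.ultra (h : Hens (mx O) O) : Hens (mx (ultra U O)) (ultra U O) := by
  intro d a ha
  choose b hb using fun j => UP.mk_surjective (a j)
  obtain rfl : (fun j => UP.mk U K (b j)) = a := funext hb
  have ha' := eventually_all.2 fun j => mk_mem_mx_ultra.1 (ha j)
  choose s hs hs' using fun i (hi : ∀ j, b j i ∈ mx O) => h d _ hi
  classical
  refine ⟨UP.mk U K fun i => if hi : ∀ j, b j i ∈ mx O then s i hi else 0, ?_, ?_⟩
  · exact ha'.mono fun i hi => by beta_reduce; rw [dif_pos hi]; exact hs i hi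
  · rw [← map_one (UP.mk U K)]
    simp only [← map_pow, ← map_mul, ← map_add, ← map_sum, UP.mk_eq_zero]
    exact ha'.mono fun i hi => by
      simpa only [Pi.add_apply, Pi.one_apply, Finset.sum_apply, Pi.mul_apply, Pi.pow_apply,
        dif_pos hi] using hs' i hi

/-- The embedding of the residue field of an ultrapower into the ultrapower of the residue
field. -/
theorem exists_residue_ultra (O : ValuationSubring K) :
    ∃ κ : IsLocalRing.ResidueField (ultra U O) →+* UP U (IsLocalRing.ResidueField O),
      ∀ (x : O) (hx : UP.diag U K x ∈ ultra U O),
        κ (IsLocalRing.residue _ ⟨UP.diag U K x, hx⟩) = UP.diag U _ (IsLocalRing.residue O x) := by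
  classical
  let g (x : K) : IsLocalRing.ResidueField O := if h : x ∈ O then IsLocalRing.residue O ⟨x, h⟩ else 0
  have hg (x : K) (h : x ∈ O) : g x = IsLocalRing.residue O ⟨x, h⟩ := dif_pos h
  let r : ultra U O →+* UP U (IsLocalRing.ResidueField O) :=
    { toFun := fun x => Germ.map g (x : UP U K)
      map_one' := by
        change UP.mk U _ _ = UP.mk U _ _
        exact congrArg _ (funext fun _ => (hg 1 O.one_mem).trans (map_one _))
      map_zero' := by
        change UP.mk U _ _ = UP.mk U _ _
        exact congrArg _ (funext fun _ => (hg 0 O.zero_mem).trans (map_zero _))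
      map_add' := by
        rintro ⟨x, hx⟩ ⟨y, hy⟩
        obtain ⟨x, rfl⟩ := UP.mk_surjective x
        obtain ⟨y, rfl⟩ := UP.mk_surjective y
        change UP.mk U _ (fun i => g (x i + y i)) = UP.mk U _ fun i => g (x i) + g (y i)
        rw [UP.mk_eq]
        filter_upwards [hx, hy] with i hx hy
        rw [hg _ hx, hg _ hy, hg _ (add_mem hx hy), ← map_add]
        rfl
      map_mul' := by
        rintro ⟨x, hx⟩ ⟨y, hy⟩
        obtain ⟨x, rfl⟩ := UP.mk_surjective x
        obtain ⟨y, rfl⟩ := UP.mk_surjective y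
        change UP.mk U _ (fun i => g (x i * y i)) = UP.mk U _ fun i => g (x i) * g (y i)
        rw [UP.mk_eq]
        filter_upwards [hx, hy] with i hx hy
        rw [hg _ hx, hg _ hy, hg _ (mul_mem hx hy), ← map_mul]
        rfl }
  refine ⟨Ideal.Quotient.lift _ r ?_, fun x hx => ?_⟩
  · rintro ⟨x, hx⟩ hx'
    obtain ⟨x, rfl⟩ := UP.mk_surjective x
    rw [← coe_mem_mx] at hx'
    change UP.mk U _ (fun i => g (x i)) = 0
    rw [UP.mk_eq_zero]
    filter_upwards [hx, mk_mem_mx_ultra.1 hx'] with i hx hx'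
    rw [hg _ hx, IsLocalRing.residue_eq_zero_iff]
    exact coe_mem_mx.1 hx'
  · change UP.mk U _ (fun i => g x) = UP.mk U _ fun _ => _
    rw [hg _ x.2]
    rfl

end Field

end Ultrapower

/-! ### Precompleteness of countable ultrapowers -/

section Precomplete

variable {K : Type*} [Field K]

/-- `O` is precomplete for the `π`-adic topology. -/
def Prec (O : ValuationSubring K) (π : K) : Prop :=
  ∀ f : ℕ → K, (∀ n, ∃ y ∈ O, f (n + 1) - f n = π ^ n * y) →
    ∃ x, ∀ n, ∃ y ∈ O, x - f n = π ^ n * y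

theorem prec_ultra (O : ValuationSubring K) {π : K} (hπ : π ∈ O) :
    Prec (ultra (hyperfilter ℕ) O) (UP.diag (hyperfilter ℕ) K π) := by
  classical
  intro f hf
  choose y hy hfy using hf
  choose g hg using fun n => UP.mk_surjective (f n)
  choose z hz using fun n => UP.mk_surjective (y n)
  obtain rfl : (fun n => UP.mk _ K (g n)) = f := funext hg
  obtain rfl : (fun n => UP.mk _ K (z n)) = y := funext hz
  let D (n i : ℕ) : Prop := ∀ m < n, z m i ∈ O ∧ g (m + 1) i - g m i = π ^ m * z m i
  have hD (n : ℕ) : ∀ᶠ i in hyperfilter ℕ, D n i := by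
    refine (eventually_all_finite (Set.finite_lt_nat n)).2 fun m _ => ?_
    have h1 := hfy m
    simp only [UP.diag_apply, ← map_pow, ← map_mul, ← map_sub, UP.mk_eq] at h1
    exact (mk_mem_ultra.1 (hy m)).and h1
  let N (i : ℕ) : ℕ := Nat.findGreatest (fun n => D n i) i
  refine ⟨UP.mk _ K fun i => g (N i) i, fun n => ?_⟩
  have hsum (i : ℕ) : ∀ M, n ≤ M → D M i → ∃ t ∈ O, g M i - g n i = π ^ n * t := by
    intro M hM
    induction M, hM using Nat.le_induction with
    | base => exact fun _ => ⟨0, O.zero_mem, by simp⟩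
    | succ M hM ih =>
      intro hd
      obtain ⟨t, ht, he⟩ := ih fun m hm => hd m (hm.trans (Nat.lt_succ_self _))
      obtain ⟨h1, h2⟩ := hd M (Nat.lt_succ_self _)
      refine ⟨t + π ^ (M - n) * z M i, add_mem ht (mul_mem (pow_mem hπ _) h1), ?_⟩
      have : π ^ M = π ^ n * π ^ (M - n) := by rw [← pow_add, Nat.add_sub_cancel' hM]
      rw [this] at h2
      linear_combination he + h2
  have hev : ∀ᶠ i in hyperfilter ℕ, ∃ t ∈ O, g (N i) i - g n i = π ^ n * t := by
    have h1 : ∀ᶠ i in hyperfilter ℕ, n ≤ i :=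
      Nat.hyperfilter_le_atTop (eventually_ge_atTop n)
    filter_upwards [hD n, h1] with i hi hi'
    refine hsum i (N i) (Nat.le_findGreatest hi' hi) ?_
    exact Nat.findGreatest_spec (P := fun n => D n i) (Nat.zero_le i) fun m hm =>
      absurd hm (Nat.not_lt_zero m)
  obtain ⟨t, ht⟩ := hev.choice
  refine ⟨UP.mk _ K t, ht.mono fun i hi => hi.1, ?_⟩
  simp only [UP.diag_apply, ← map_pow, ← map_mul, ← map_sub, UP.mk_eq]
  exact ht.mono fun i hi => hi.2

end Precomplete

end Paper

namespace Paper

open Filter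

/-! ### Embedding the residue field into an ultrapower -/

theorem exists_residue_embedding {E F : Type u} [Field E] [Field F] {A : ValuationSubring E}
    (hA : Hens (mx A) A) (ι : F →+* A) (hsep : Sep ((IsLocalRing.residue A).comp ι)) :
    ∃ (I : Type u) (U : Ultrafilter I) (τ : IsLocalRing.ResidueField A →+* UP U E),
      (∀ x, τ x ∈ ultra U A) ∧
      (∀ a : A, UP.diag U E a - τ (IsLocalRing.residue A a) ∈ mx (ultra U A)) ∧
      ∀ x : F, τ (IsLocalRing.residue A (ι x)) = UP.diag U E (ι x) := by
  classical
  have := hA.henselianLocalRing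
  let k := IsLocalRing.ResidueField A
  let _ : Algebra F k := ((IsLocalRing.residue A).comp ι).toAlgebra
  choose l hl hl' using exists_lift (F := F) (E₀ := k) hsep ι (RingHom.id k) fun x => rfl
  let U : Ultrafilter (Finset k) := Ultrafilter.of atTop
  let t (x : k) (B : Finset k) : E :=
    if h : x ∈ IntermediateField.adjoin F (B : Set k) then l B ⟨x, h⟩ else 0
  have ht {x : k} {B : Finset k} (h : x ∈ IntermediateField.adjoin F (B : Set k)) :
    t x B = l B ⟨x, h⟩ := dif_pos h
  have hU (x : k) : ∀ᶠ B : Finset k in U, x ∈ IntermediateField.adjoin F (B : Set k) := by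
    filter_upwards [Ultrafilter.of_le _ (eventually_ge_atTop {x})] with B hB
    exact IntermediateField.subset_adjoin _ _ (hB (Finset.mem_singleton_self x))
  let τ : k →+* UP U E :=
    { toFun := fun x => UP.mk U E (t x)
      map_one' := by
        rw [← map_one (UP.mk U E), UP.mk_eq]
        filter_upwards with B
        rw [ht (one_mem _)]
        exact congrArg Subtype.val (map_one (l B))
      map_zero' := by
        rw [UP.mk_eq_zero]
        filter_upwards with B
        rw [ht (zero_mem _)]
        exact congrArg Subtype.val (map_zero (l B))
      map_add' := fun x y => by
        rw [← map_add, UP.mk_eq]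
        filter_upwards [hU x, hU y] with B hx hy
        rw [ht (add_mem hx hy), Pi.add_apply, ht hx, ht hy]
        exact congrArg Subtype.val (map_add (l B) ⟨x, hx⟩ ⟨y, hy⟩)
      map_mul' := fun x y => by
        rw [← map_mul, UP.mk_eq]
        filter_upwards [hU x, hU y] with B hx hy
        rw [ht (mul_mem hx hy), Pi.mul_apply, ht hx, ht hy]
        exact congrArg Subtype.val (map_mul (l B) ⟨x, hx⟩ ⟨y, hy⟩) }
  refine ⟨_, U, τ, fun x => ?_, fun a => ?_, fun x => ?_⟩
  · change UP.mk U E (t x) ∈ _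
    rw [mk_mem_ultra]
    filter_upwards [hU x] with B hB
    rw [ht hB]
    exact Subtype.prop _
  · change UP.diag U E a - UP.mk U E (t _) ∈ _
    rw [UP.diag_apply, ← map_sub, mk_mem_mx_ultra]
    filter_upwards [hU (IsLocalRing.residue A a)] with B hB
    rw [Pi.sub_apply, ht hB]
    refine (coe_mem_mx (x := a - l B ⟨_, hB⟩)).2 ?_
    rw [← IsLocalRing.residue_eq_zero_iff, map_sub, hl', RingHom.id_apply, sub_self]
  · change UP.mk U E (t _) = _
    rw [UP.diag_apply, UP.mk_eq]
    filter_upwards with B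
    have h : IsLocalRing.residue A (ι x) ∈ IntermediateField.adjoin F (B : Set k) :=
      (IntermediateField.adjoin F (B : Set k)).algebraMap_mem x
    rw [ht h]
    exact congrArg Subtype.val (hl B x)

/-! ### Coarsenings -/

section Coarse

variable {K : Type*} [Field K]

/-- The coarsening `O[1/π]` of the valuation ring `O`. -/
def coarse (O : ValuationSubring K) (π : K) (hπ : π ∈ O) : ValuationSubring K where
  carrier := {x | ∃ n : ℕ, π ^ n * x ∈ O}
  mul_mem' := by
    rintro x y ⟨n, hn⟩ ⟨m, hm⟩
    exact ⟨n + m, by convert mul_mem hn hm using 1; ring⟩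
  add_mem' := by
    rintro x y ⟨n, hn⟩ ⟨m, hm⟩
    refine ⟨n + m, ?_⟩
    convert add_mem (mul_mem (pow_mem hπ m) hn) (mul_mem (pow_mem hπ n) hm) using 1
    ring
  neg_mem' := by
    rintro x ⟨n, hn⟩
    exact ⟨n, by rw [mul_neg]; exact neg_mem hn⟩
  one_mem' := ⟨0, by simp [O.one_mem]⟩
  zero_mem' := ⟨0, by simp [O.zero_mem]⟩
  mem_or_inv_mem' x := (O.mem_or_inv_mem x).imp (fun h => ⟨0, by simpa⟩) fun h => ⟨0, by simpa⟩

variable {O : ValuationSubring K} {π : K} (hπ : π ∈ O)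

theorem mem_coarse {x : K} : x ∈ coarse O π hπ ↔ ∃ n : ℕ, π ^ n * x ∈ O := Iff.rfl

theorem le_coarse : O ≤ coarse O π hπ := fun x hx => ⟨0, by simpa⟩

theorem inv_mem_coarse (h0 : π ≠ 0) : π⁻¹ ∈ coarse O π hπ :=
  ⟨1, by simp [h0, O.one_mem]⟩

theorem mem_mx_coarse (h0 : π ≠ 0) (hπ' : π⁻¹ ∉ O) {x : K} :
    x ∈ mx (coarse O π hπ) ↔ ∀ n : ℕ, ∃ y ∈ O, x = π ^ n * y := by
  rw [mem_mx_iff]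
  constructor
  · rintro (rfl | hx) n
    · exact ⟨0, O.zero_mem, by simp⟩
    · rw [mem_coarse, not_exists] at hx
      refine ⟨(π ^ n)⁻¹ * x, ?_, by rw [mul_inv_cancel_left₀ (pow_ne_zero _ h0)]⟩
      have := (O.mem_or_inv_mem _).resolve_left (hx n)
      rwa [mul_inv, inv_inv] at this
  · rintro h
    refine or_iff_not_imp_left.2 fun hx0 hx => ?_
    obtain ⟨n, hn⟩ := hx
    obtain ⟨y, hy, hxy⟩ := h (n + 1)
    refine hπ' ?_
    convert mul_mem hn hy using 1
    have hy0 : y ≠ 0 := by rintro rfl; simp_all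
    rw [hxy]
    field_simp
    ring

/-- The valuation ring induced on the residue field of a coarsening. -/
noncomputable def resRing {O A : ValuationSubring K} (h : O ≤ A) :
    ValuationSubring (IsLocalRing.ResidueField A) where
  __ := ((IsLocalRing.residue A).comp (ValuationSubring.inclusion O A h)).range
  mem_or_inv_mem' x := by
    obtain ⟨⟨a, ha⟩, rfl⟩ := IsLocalRing.residue_surjective x
    by_cases haO : a ∈ O
    · exact Or.inl ⟨⟨a, haO⟩, rfl⟩
    · have haO' := (O.mem_or_inv_mem a).resolve_left haO
      refine Or.inr ⟨⟨a⁻¹, haO'⟩, eq_inv_of_mul_eq_one_left ?_⟩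
      rw [RingHom.comp_apply, ← map_mul, ← map_one (IsLocalRing.residue A)]
      congr 1
      refine Subtype.ext (inv_mul_cancel₀ ?_)
      rintro rfl
      exact haO O.zero_mem

variable {A : ValuationSubring K} (h : O ≤ A)

/-- The residue map onto the valuation ring induced on the residue field of a coarsening. -/
noncomputable def toResRing : O →+* resRing h :=
  ((IsLocalRing.residue A).comp (ValuationSubring.inclusion O A h)).rangeRestrict

theorem coe_toResRing (x : O) : (toResRing h x : IsLocalRing.ResidueField A) =
    IsLocalRing.residue A ⟨x, h x.2⟩ := rfl

theorem toResRing_surjective : Function.Surjective (toResRing h) :=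
  RingHom.rangeRestrict_surjective _

theorem toResRing_eq_zero {x : O} : toResRing h x = 0 ↔ (x : K) ∈ mx A := by
  rw [Subtype.ext_iff, ZeroMemClass.coe_zero, coe_toResRing, IsLocalRing.residue_eq_zero_iff,
    ← coe_mem_mx]

theorem isAdicComplete_resRing (hπ : π ∈ O) (h0 : π ≠ 0) (hπ' : π⁻¹ ∉ O) (hp : Prec O π) :
    IsAdicComplete (Ideal.span {toResRing (le_coarse hπ) ⟨π, hπ⟩})
      (resRing (le_coarse hπ)) := by
  set t := toResRing (le_coarse hπ) with ht
  have hsurj : Function.Surjective t := toResRing_surjective _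
  have hmem (n : ℕ) (x : O) : t x ∈ Ideal.span {t ⟨π, hπ⟩} ^ n ↔ ∃ y ∈ O, (x : K) = π ^ n * y := by
    rw [Ideal.span_singleton_pow, Ideal.mem_span_singleton]
    constructor
    · rintro ⟨z, hz⟩
      obtain ⟨z, rfl⟩ := hsurj z
      rw [← map_pow, ← map_mul, ← sub_eq_zero, ← map_sub, toResRing_eq_zero,
        mem_mx_coarse hπ h0 hπ'] at hz
      obtain ⟨y, hy, hz⟩ := hz n
      refine ⟨y + z, add_mem hy z.2, ?_⟩
      push_cast at hz
      linear_combination hz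
    · rintro ⟨y, hy, hx⟩
      refine ⟨t ⟨y, hy⟩, ?_⟩
      rw [← map_pow, ← map_mul]
      exact congrArg t (Subtype.ext hx)
  have hmodEq (n : ℕ) (x y : O) : t x ≡ t y
      [SMOD Ideal.span {t ⟨π, hπ⟩} ^ n • (⊤ : Submodule (resRing (le_coarse hπ)) (resRing (le_coarse hπ)))] ↔
      ∃ z ∈ O, (x : K) - y = π ^ n * z := by
    rw [SModEq.sub_mem, smul_eq_mul, Ideal.mul_top, ← map_sub, hmem]
    rfl
  refine { haus' := fun x hx => ?_, prec' := fun f hf => ?_ }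
  · obtain ⟨x, rfl⟩ := hsurj x
    rw [toResRing_eq_zero, mem_mx_coarse hπ h0 hπ']
    intro n
    have := hx n
    rw [← map_zero t, hmodEq] at this
    simpa using this
  · choose g hg using fun n => hsurj (f n)
    obtain rfl : (fun n => t (g n)) = f := funext hg
    obtain ⟨x, hx⟩ := hp (fun n => g n) fun n => by
      obtain ⟨z, hz, hz'⟩ := (hmodEq _ _ _).1 (hf (Nat.le_succ n))
      exact ⟨-z, neg_mem hz, by rw [mul_neg, ← hz']; ring⟩
    have hxO : x ∈ O := by
      obtain ⟨y, hy, hy'⟩ := hx 0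
      have : x = g 0 + y := by rw [pow_zero, one_mul] at hy'; rw [← hy']; ring
      rw [this]
      exact add_mem (g 0).2 hy
    refine ⟨t ⟨x, hxO⟩, fun n => ?_⟩
    rw [hmodEq]
    obtain ⟨y, hy, hy'⟩ := hx n
    exact ⟨-y, neg_mem hy, by rw [mul_neg, ← hy']; ring⟩

end Coarse

end Paper

namespace Paper

open PowerSeries

/-! ### Mac Lane's criterion and power series -/

section MacLane

variable {p : ℕ}

theorem coeff_pow_char {R : Type*} [CommRing R] (hp : p.Prime) [CharP R p] (f : PowerSeries R)
    (n : ℕ) : coeff n (f ^ p) = if p ∣ n then coeff (n / p) f ^ p else 0 := by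
  have : ExpChar R p := .prime hp
  have h : PowerSeries.map (frobenius R p) (PowerSeries.expand p hp.ne_zero f) = f ^ p :=
    MvPowerSeries.map_frobenius_expand p hp.ne_zero
  rw [← h, PowerSeries.coeff_map, PowerSeries.coeff_expand]
  split_ifs
  · rfl
  · exact map_zero _

theorem macLane_powerSeries {F : Type*} [Field F] (hp : p.Prime) [CharP F p] :
    MacLane p (PowerSeries.C : F →+* PowerSeries F) := by
  rintro n c x ⟨i, hi⟩ hx
  obtain ⟨m, hm⟩ := (PowerSeries.exists_coeff_ne_zero_iff_ne_zero).2 hi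
  refine ⟨fun i => coeff m (x i), ⟨i, hm⟩, ?_⟩
  have := congrArg (coeff (p * m)) hx
  simpa [PowerSeries.coeff_C_mul, coeff_pow_char hp, Nat.mul_div_cancel_left _ hp.pos] using this

theorem sep_laurentSeries (F : Type*) [Field F] : Sep (algebraMap F (LaurentSeries F)) := by
  intro p hp hF
  have := (macLane_powerSeries (F := F) hp).of_isFractionRing (K := LaurentSeries F)
  intro n c x hx h
  refine this n c x hx (Eq.trans (Finset.sum_congr rfl fun i _ => ?_) h)
  congr 1

theorem exists_functionals {C K : Type*} [Field C] [Field K] [Algebra C K] [CharP K p]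
    (hp : p.Prime) (h : MacLane p (algebraMap C K)) {a : K} (ha : a ≠ 0) :
    ∃ l m : K →ₗ[C] C, l a ≠ 0 ∧ ∀ x, m (x ^ p) = l x ^ p := by
  have : Fact p.Prime := ⟨hp⟩
  classical
  let b := Module.Basis.ofVectorSpace C K
  have hb : LinearIndependent C fun i => b i ^ p := by
    rw [linearIndependent_iff_finset_linearIndependent]
    intro s
    have h1 : LinearIndependent C (fun i : Fin s.card => b (s.equivFin.symm i)) :=
      b.linearIndependent.comp (fun i => (s.equivFin.symm i : _))
        (Subtype.val_injective.comp s.equivFin.symm.injective)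
    exact (linearIndependent_equiv s.equivFin.symm).1 (h.linearIndependent_pow hp h1)
  obtain ⟨i, hi⟩ : ∃ i, b.coord i a ≠ 0 := by
    by_contra! hcon
    exact ha (b.ext_elem fun i => by simpa using hcon i)
  obtain ⟨m, hm⟩ := LinearMap.exists_extend
    ((Finsupp.lapply i).comp hb.repr : Submodule.span C (Set.range fun i => b i ^ p) →ₗ[C] C)
  have hm' (j) : m (b j ^ p) = if j = i then 1 else 0 := by
    have := congrArg (fun g => g ⟨b j ^ p, Submodule.subset_span ⟨j, rfl⟩⟩) hm
    simp only [LinearMap.comp_apply, Submodule.subtype_apply] at this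
    rw [this]
    change hb.repr _ i = _
    rw [hb.repr_eq_single j _ rfl, Finsupp.single_apply]
  refine ⟨b.coord i, m, hi, fun x => ?_⟩
  have hx := b.linearCombination_repr x
  rw [Finsupp.linearCombination_apply, Finsupp.sum] at hx
  conv_lhs => rw [← hx]
  rw [sum_pow_char, map_sum]
  simp only [smul_pow, map_smul, hm', smul_eq_mul, mul_ite, mul_one, mul_zero, Finset.sum_ite_eq',
    Finsupp.mem_support_iff, Module.Basis.coord_apply]
  split_ifs with h0
  · rfl
  · rw [not_not.1 h0, zero_pow hp.ne_zero]

theorem macLane_map_powerSeries {C K : Type*} [Field C] [Field K] (hp : p.Prime) [CharP K p]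
    {f : C →+* K} (h : MacLane p f) : MacLane p (PowerSeries.map f) := by
  let _ := f.toAlgebra
  have : CharP C p := f.charP f.injective p
  rintro n c x ⟨i, hi⟩ hx
  obtain ⟨d, hd⟩ := (PowerSeries.exists_coeff_ne_zero_iff_ne_zero).2 hi
  obtain ⟨l, m, hl, hlm⟩ := exists_functionals hp h hd
  refine ⟨fun i => PowerSeries.mk fun d => l (coeff d (x i)), ⟨i, fun h0 => hl ?_⟩, ?_⟩
  · simpa using congrArg (coeff d) h0
  · ext e
    have h1 := congrArg (fun y => m (coeff e y)) hx
    simp only [map_sum, PowerSeries.coeff_mul, PowerSeries.coeff_map, map_zero,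
      coeff_pow_char hp, PowerSeries.coeff_mk] at h1 ⊢
    refine Eq.trans (Finset.sum_congr rfl fun i _ => Finset.sum_congr rfl fun j _ => ?_) h1
    rw [show f (coeff j.1 (c i)) = algebraMap C K (coeff j.1 (c i)) from rfl, ← Algebra.smul_def,
      map_smul, smul_eq_mul]
    split_ifs
    · rw [hlm]
    · rw [map_zero]

end MacLane

/-! ### Evaluation of power series in adically complete rings -/

section Eval

variable {k S : Type*} [CommRing k] [CommRing S] (j : k →+* S) (t : S)

theorem mk_eval₂_trunc (n : ℕ) (P : Polynomial k) :
    Ideal.Quotient.mk (Ideal.span {t} ^ n) ((trunc n (P : PowerSeries k)).eval₂ j t) =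
      Ideal.Quotient.mk (Ideal.span {t} ^ n) (P.eval₂ j t) := by
  have h : Polynomial.X ^ n ∣ trunc n (P : PowerSeries k) - P := by
    rw [Polynomial.X_pow_dvd_iff]
    intro d hd
    rw [Polynomial.coeff_sub, coeff_trunc, if_pos hd, Polynomial.coeff_coe, sub_self]
  obtain ⟨Q, hQ⟩ := h
  rw [Ideal.Quotient.eq, ← Polynomial.eval₂_sub, hQ, Polynomial.eval₂_mul, Polynomial.eval₂_X_pow,
    Ideal.span_singleton_pow]
  exact Ideal.mul_mem_right _ _ (Ideal.mem_span_singleton_self _)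

/-- Evaluation of power series modulo `t ^ n`. -/
noncomputable def evalMod (n : ℕ) : PowerSeries k →+* S ⧸ Ideal.span {t} ^ n where
  toFun f := Ideal.Quotient.mk _ ((trunc n f).eval₂ j t)
  map_zero' := by rw [map_zero, Polynomial.eval₂_zero, map_zero]
  map_add' f g := by rw [map_add, Polynomial.eval₂_add, map_add]
  map_one' := by
    have := mk_eval₂_trunc j t n 1
    rw [Polynomial.coe_one] at this
    rw [this, Polynomial.eval₂_one, map_one]
  map_mul' f g := by
    rw [← trunc_trunc_mul_trunc, ← Polynomial.coe_mul, mk_eval₂_trunc, Polynomial.eval₂_mul, map_mul]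

theorem evalMod_comp {m n : ℕ} (hle : m ≤ n) :
    (Ideal.Quotient.factorPow (Ideal.span {t}) hle).comp (evalMod j t n) = evalMod j t m := by
  ext f
  change Ideal.Quotient.mk _ ((trunc n f).eval₂ j t) = Ideal.Quotient.mk _ ((trunc m f).eval₂ j t)
  rw [← trunc_trunc_of_le f hle, mk_eval₂_trunc]

variable [IsAdicComplete (Ideal.span {t}) S]

/-- Evaluation of power series at `t` in a `t`-adically complete ring. -/
noncomputable def evalPS : PowerSeries k →+* S :=
  IsAdicComplete.liftRingHom (Ideal.span {t}) (evalMod j t) (evalMod_comp j t)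

theorem mk_evalPS (n : ℕ) (f : PowerSeries k) :
    Ideal.Quotient.mk (Ideal.span {t} ^ n) (evalPS j t f) =
      Ideal.Quotient.mk (Ideal.span {t} ^ n) ((trunc n f).eval₂ j t) :=
  IsAdicComplete.mk_liftRingHom (Ideal.span {t}) (evalMod j t) (evalMod_comp j t) n f

variable {t}

theorem eq_of_forall_mk {x y : S} (h : ∀ n, Ideal.Quotient.mk (Ideal.span {t} ^ n) x =
    Ideal.Quotient.mk (Ideal.span {t} ^ n) y) : x = y := by
  rw [← sub_eq_zero]
  refine IsHausdorff.haus (I := Ideal.span {t}) inferInstance _ fun n => ?_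
  rw [SModEq.zero, smul_eq_mul, Ideal.mul_top]
  exact Ideal.Quotient.eq.1 (h n)

theorem evalPS_coe (P : Polynomial k) : evalPS j t P = P.eval₂ j t :=
  eq_of_forall_mk (t := t) fun n => by rw [mk_evalPS, mk_eval₂_trunc]

theorem evalPS_C (a : k) : evalPS j t (PowerSeries.C a) = j a := by
  rw [← Polynomial.coe_C, evalPS_coe, Polynomial.eval₂_C]

theorem evalPS_X : evalPS j t PowerSeries.X = t := by
  rw [← Polynomial.coe_X, evalPS_coe, Polynomial.eval₂_X]

theorem evalPS_surjective (h : ∀ x, ∃ a y, x = j a + t * y) :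
    Function.Surjective (evalPS j t) := by
  choose a b hab using h
  intro x
  refine ⟨PowerSeries.mk fun n => a (b^[n] x), eq_of_forall_mk (t := t) fun n => ?_⟩
  rw [mk_evalPS]
  have key (n : ℕ) : x = (trunc n (PowerSeries.mk fun n => a (b^[n] x))).eval₂ j t +
      t ^ n * b^[n] x := by
    induction n with
    | zero => simp
    | succ n ih =>
      rw [trunc_succ, Polynomial.eval₂_add, Polynomial.eval₂_monomial, coeff_mk,
        Function.iterate_succ_apply']
      conv_lhs => rw [ih, hab (b^[n] x)]
      ring
  conv_rhs => rw [key n]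
  rw [map_add, left_eq_add, Ideal.Quotient.eq_zero_iff_mem, Ideal.span_singleton_pow]
  exact Ideal.mul_mem_right _ _ (Ideal.mem_span_singleton_self _)

theorem evalPS_injective (h : ∀ a, t ∣ j a → a = 0) (ht : ∀ x, t * x = 0 → x = 0) :
    Function.Injective (evalPS j t) := by
  rw [injective_iff_map_eq_zero]
  intro f hf
  ext n
  have key (f : PowerSeries k) (hf : evalPS j t f = 0) : constantCoeff f = 0 ∧
      evalPS j t (PowerSeries.mk fun n => coeff (n + 1) f) = 0 := by
    rw [eq_X_mul_shift_add_const f, map_add, map_mul, evalPS_X, evalPS_C] at hf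
    have h0 := h _ ⟨-evalPS j t (PowerSeries.mk fun n => coeff (n + 1) f), by linear_combination hf⟩
    refine ⟨h0, ht _ ?_⟩
    rwa [h0, map_zero, add_zero] at hf
  induction n generalizing f with
  | zero => simpa using (key f hf).1
  | succ n ih => simpa using ih _ (key f hf).2

end Eval

theorem ringHom_ext_of_complete {R S : Type*} [CommRing R] [CommRing S] {c : Set R} {π : R}
    {f g : R →+* S} [IsHausdorff (Ideal.span {f π}) S] (hc : ∀ x ∈ c, f x = g x) (hπ : f π = g π)
    (h : ∀ x, ∃ a ∈ c, ∃ y, x = a + π * y) : f = g := by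
  ext x
  rw [← sub_eq_zero]
  refine IsHausdorff.haus (I := Ideal.span {f π}) inferInstance _ fun n => ?_
  rw [SModEq.zero, smul_eq_mul, Ideal.mul_top, Ideal.span_singleton_pow, Ideal.mem_span_singleton]
  induction n generalizing x with
  | zero => simp
  | succ n ih =>
    obtain ⟨a, ha, y, rfl⟩ := h x
    have : f (a + π * y) - g (a + π * y) = f π * (f y - g y) := by
      rw [map_add, map_add, map_mul, map_mul, hc a ha, hπ]
      ring
    rw [this, pow_succ']
    exact mul_dvd_mul_left _ (ih y)

end Paper

namespace Paper

open Filter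

/-! ### Fields with a nontrivial henselian valuation are large -/

theorem toResRing_uniformizer_ne_zero {K : Type*} [Field K] {O : ValuationSubring K} {π : K}
    (hπ : π ∈ O) (h0 : π ≠ 0) : toResRing (le_coarse hπ) ⟨π, hπ⟩ ≠ 0 := by
  rw [Ne, toResRing_eq_zero, mem_mx_iff, not_or, not_not]
  exact ⟨h0, inv_mem_coarse hπ h0⟩

theorem uniformizer_dvd_toResRing {K : Type*} [Field K] {O : ValuationSubring K} {π : K}
    (hπ : π ∈ mx O) {x : O}
    (h : toResRing (le_coarse (mx_subset hπ)) ⟨π, mx_subset hπ⟩ ∣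
      toResRing (le_coarse (mx_subset hπ)) x) : (x : K) ∈ mx O := by
  obtain ⟨y, hy⟩ := h
  obtain ⟨y, rfl⟩ := toResRing_surjective _ y
  rw [← map_mul, ← sub_eq_zero, ← map_sub, toResRing_eq_zero] at hy
  have := add_mem_mx (mx_subset_mx (le_coarse (mx_subset hπ)) hy) (mul_mem_mx hπ y.2)
  simpa using this

/-- Solutions in `F((t))` give solutions in any henselian valued field `(E, B)` containing `F` in
which `B` is precomplete for an element `π` and trivial on `F`. -/
theorem Sol.of_laurentSeries {F E σ : Type*} [Field F] [Field E] [Finite σ]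
    {B : ValuationSubring E}
    (hB : Hens (mx B) B) (ι : F →+* B) {π : E} (hπ : π ∈ mx B) (h0 : π ≠ 0) (hp : Prec B π)
    {P : List (MvPolynomial σ F)} {q : MvPolynomial σ F}
    (h : Sol (algebraMap F (LaurentSeries F)) P q) : Sol (B.subtype.comp ι) P q := by
  have hπB := mx_subset hπ
  have hπ' : π⁻¹ ∉ B := ((mem_mx_iff.1 hπ).resolve_left h0)
  let A := coarse B π hπB
  have hBA : B ≤ A := le_coarse hπB
  have hA : HenselianLocalRing A := (hB.mono (mx_subset_mx hBA) hBA).henselianLocalRing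
  have := isAdicComplete_resRing hπB h0 hπ' hp
  let t := toResRing hBA ⟨π, hπB⟩
  let j := (toResRing hBA).comp ι
  have hinj : Function.Injective (evalPS j t) := by
    refine evalPS_injective j (fun a ha => ?_) fun x hx =>
      (mul_eq_zero.1 hx).resolve_left (toResRing_uniformizer_ne_zero hπB h0)
    have := uniformizer_dvd_toResRing hπ (x := ι a) ha
    rw [coe_mem_mx] at this
    by_contra h
    exact (IsLocalRing.mem_maximalIdeal _).1 this ((IsUnit.mk0 a h).map ι)
  have hinj' : Function.Injective ((resRing hBA).subtype.comp (evalPS j t)) :=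
    Subtype.val_injective.comp hinj
  let φ : LaurentSeries F →+* IsLocalRing.ResidueField A := IsFractionRing.lift hinj'
  have := h.lift (sep_laurentSeries F) ((ValuationSubring.inclusion B A hBA).comp ι) φ (by
    ext a
    have : algebraMap F (LaurentSeries F) a =
        algebraMap (PowerSeries F) (LaurentSeries F) (PowerSeries.C a) := rfl
    rw [RingHom.comp_apply, this, IsFractionRing.lift_algebraMap, RingHom.comp_apply, evalPS_C]
    rfl)
  exact this.map (g := A.subtype) Subtype.val_injective

theorem largeField_of_hens {F : Type u} [Field F] (V : ValuationSubring F) (hV : Hens (mx V) V)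
    (hne : ∃ a, a ∉ V) : LargeField F := by
  refine largeField_of_sol fun n P q h => ?_
  obtain ⟨a, ha⟩ := hne
  have ha0 : a ≠ 0 := fun h => ha (h ▸ V.zero_mem)
  have : (⨅ c : F, 𝓟 {i : Fˣ | c * i ∈ mx V}).NeBot := by
    refine iInf_neBot_of_directed (fun c d => ?_) fun c => ?_
    · have key (c d : F) (h : V.valuation c ≤ V.valuation d) :
          {i : Fˣ | d * i ∈ mx V} ⊆ {i : Fˣ | c * i ∈ mx V} := fun i hi => by
        simp only [Set.mem_ofPred_eq, mem_mx, map_mul] at hi ⊢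
        exact (mul_le_mul_left h _).trans_lt hi
      rcases le_total (V.valuation c) (V.valuation d) with h | h
      · exact ⟨d, principal_mono.2 (key c d h), le_rfl⟩
      · exact ⟨c, le_rfl, principal_mono.2 (key d c h)⟩
    · rw [principal_neBot_iff]
      rcases eq_or_ne c 0 with rfl | hc
      · exact ⟨1, by simp [mem_mx]⟩
      · refine ⟨Units.mk0 (c⁻¹ * a⁻¹) (by simp [hc, ha0]), ?_⟩
        simpa [hc] using inv_mem_mx_of_notMem ha
  let U := Ultrafilter.of (⨅ c : F, 𝓟 {i : Fˣ | c * i ∈ mx V})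
  let V₁ := ultra U V
  let τ : UP U F := UP.mk U F fun i => i
  have hτ (c : F) : UP.diag U F c * τ ∈ mx V₁ := by
    rw [UP.diag_apply, ← map_mul, mk_mem_mx_ultra]
    exact Ultrafilter.of_le _ (mem_iInf_of_mem c (mem_principal_self _))
  have hτ0 : τ ≠ 0 := UP.mk_ne_zero.2 (Eventually.of_forall fun i => i.ne_zero)
  let B : ValuationSubring (UP U F) :=
    { carrier := {x | ∃ c : F, c ≠ 0 ∧ UP.diag U F c * x ∈ V₁}
      mul_mem' := by
        rintro x y ⟨c, hc, hx⟩ ⟨d, hd, hy⟩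
        refine ⟨c * d, mul_ne_zero hc hd, ?_⟩
        convert mul_mem hx hy using 1
        rw [map_mul]
        ring
      one_mem' := ⟨1, one_ne_zero, by simp⟩
      add_mem' := by
        have key (c d : F) (x y : UP U F) (hc : c ≠ 0) (hcd : c * d⁻¹ ∈ V) (hd : d ≠ 0)
            (hx : UP.diag U F c * x ∈ V₁) (hy : UP.diag U F d * y ∈ V₁) :
            UP.diag U F c * (x + y) ∈ V₁ := by
          have := add_mem hx (mul_mem ((diag_mem_ultra (U := U)).2 hcd) hy)
          convert this using 1
          rw [mul_add, ← mul_assoc, ← map_mul, inv_mul_cancel_right₀ hd]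
        rintro x y ⟨c, hc, hx⟩ ⟨d, hd, hy⟩
        rcases V.mem_or_inv_mem (c * d⁻¹) with h | h
        · exact ⟨c, hc, key c d x y hc h hd hx hy⟩
        · exact ⟨d, hd, by rw [add_comm]; exact key d c y x hd (by simpa using h) hc hy hx⟩
      zero_mem' := ⟨1, one_ne_zero, by simp⟩
      neg_mem' := by
        rintro x ⟨c, hc, hx⟩
        exact ⟨c, hc, by simpa using neg_mem hx⟩
      mem_or_inv_mem' := fun x => (V₁.mem_or_inv_mem x).imp
        (fun h => ⟨1, one_ne_zero, by simpa using h⟩) fun h => ⟨1, one_ne_zero, by simpa using h⟩ }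
  have hVB : V₁ ≤ B := fun x h => ⟨1, one_ne_zero, by simpa using h⟩
  have hFB (c : F) : UP.diag U F c ∈ B := by
    rcases eq_or_ne c 0 with rfl | hc
    · rw [map_zero]
      exact B.zero_mem
    · exact ⟨c⁻¹, inv_ne_zero hc, by
        rw [← map_mul, inv_mul_cancel₀ hc, map_one]
        exact V₁.one_mem⟩
  have hB : Hens (mx B) B := (hV.ultra (U := U)).mono (mx_subset_mx hVB) hVB
  have hτB : τ ∈ mx B := by
    rw [mem_mx_iff]
    right
    rintro ⟨c, hc, hcτ⟩
    have := hτ c⁻¹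
    rw [mem_mx_iff] at this
    refine this.resolve_left (mul_ne_zero (by simpa [map_eq_zero_iff _ UP.diag_injective]) hτ0) ?_
    convert hcτ using 1
    rw [mul_inv, map_inv₀, inv_inv]
  have h1 := h.of_laurentSeries (hB.ultra (U := hyperfilter ℕ))
    ((((UP.diag (hyperfilter ℕ) _).comp (UP.diag U F)).codRestrict
      (ultra (hyperfilter ℕ) B).toSubring) fun c => diag_mem_ultra.2 (hFB c))
    (diag_mem_mx_ultra.2 hτB) (by simpa [map_eq_zero_iff _ UP.diag_injective] using hτ0)
    (prec_ultra B (mx_subset hτB))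
  exact UP.sol_iff.1 (UP.sol_iff.1 h1)

end Paper

namespace Paper

/-! ### Stages and the transfer from a valued field to its residue field -/

/-- Restriction of the codomain of a ring homomorphism to a valuation ring. -/
def codVal {R E : Type*} [CommRing R] [Field E] (f : R →+* E) (A : ValuationSubring E)
    (h : ∀ x, f x ∈ A) : R →+* A :=
  f.codRestrict A.toSubring h

theorem sol_comp_iff {R S M σ : Type*} [CommRing R] [CommRing S] [CommRing M] {f : R →+* S}
    {g : S →+* M} {P : List (MvPolynomial σ R)} {q : MvPolynomial σ R} :
    Sol (g.comp f) P q ↔ Sol g (P.map (MvPolynomial.map f)) (MvPolynomial.map f q) := by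
  simp only [Sol, List.forall_mem_map, MvPolynomial.eval₂_map]

theorem macLane_of_equiv {R S : Type*} [CommRing R] [CommRing S] (e : R ≃+* S) (p : ℕ) :
    MacLane p (e : R →+* S) := by
  refine MacLane.of_comp (g := (e.symm : S →+* R)) e.symm.injective fun n c x hx h => ⟨x, hx, ?_⟩
  simpa using h

theorem residue_eq_iff {E : Type*} [Field E] {A : ValuationSubring E} {x y : A} :
    IsLocalRing.residue A x = IsLocalRing.residue A y ↔ (x : E) - y ∈ mx A := by
  rw [← sub_eq_zero, ← map_sub, IsLocalRing.residue_eq_zero_iff, ← coe_mem_mx]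
  rfl

/-- A henselian valued field `(E, O)` over `C` with a coarsening `A` of `O` and a subfield `F` of
`A` containing `C` over which the residue field of `A` is separable. -/
structure Stage (C : Type u) [Field C] (π : C) where
  /-- the field -/
  E : Type u
  [field : Field E]
  /-- the structure map -/
  f : C →+* E
  /-- the fine valuation ring -/
  O : ValuationSubring E
  /-- the coarse valuation ring -/
  A : ValuationSubring E
  /-- the subfield -/
  F : Subfield E
  le : O ≤ A
  hens : Hens (mx O) O
  f_mem : ∀ c, f c ∈ F
  F_le : ∀ x : F, (x : E) ∈ A
  sep : Sep ((IsLocalRing.residue A).comp (codVal F.subtype A F_le))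
  inv_notMem : (f π)⁻¹ ∉ O

attribute [instance] Stage.field

namespace Stage

variable {C : Type u} [Field C] {π : C}

/-- The map to the residue field of the coarse valuation. -/
noncomputable def toRes (S : Stage C π) : C →+* IsLocalRing.ResidueField S.A :=
  (IsLocalRing.residue S.A).comp (codVal S.f S.A fun c => S.F_le ⟨_, S.f_mem c⟩)

/-- `S'` is an extension of `S` in which the residues of `S` have representatives. -/
structure Rel (S S' : Stage C π) where
  /-- the embedding -/
  j : S.E →+* S'.E
  comm : ∀ c, j (S.f c) = S'.f c
  mem_O : ∀ x, j x ∈ S'.O ↔ x ∈ S.O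
  mem_A : ∀ x, j x ∈ S'.A ↔ x ∈ S.A
  mem_F : ∀ x ∈ S.F, j x ∈ S'.F
  exists_sub_mem : ∀ y ∈ S.A, ∃ x ∈ S'.F, j y - x ∈ mx S'.A
  sol : ∀ (n : ℕ) (P : List (MvPolynomial (Fin n) C)) (q), Sol S'.toRes P q → Sol S.toRes P q

theorem exists_rel (S : Stage C π) : ∃ S' : Stage C π, Nonempty (Rel S S') := by
  have hA : Hens (mx S.A) S.A := S.hens.mono (mx_subset_mx S.le) S.le
  obtain ⟨I, U, τ, hτA, hτ, hτF⟩ := exists_residue_embedding hA (codVal S.F.subtype S.A S.F_le)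
    S.sep
  obtain ⟨κ, hκ⟩ := exists_residue_ultra (U := U) S.A
  let F' : Subfield (UP U S.E) := τ.fieldRange
  have hF' (x : F') : (x : UP U S.E) ∈ ultra U S.A := by
    obtain ⟨_, y, rfl⟩ := x
    exact hτA y
  have hκτ : (κ.comp ((IsLocalRing.residue _).comp (codVal τ (ultra U S.A) hτA))) =
      UP.diag U (IsLocalRing.ResidueField S.A) := by
    ext x
    obtain ⟨a, rfl⟩ := IsLocalRing.residue_surjective x
    rw [← hκ a (diag_mem_ultra.2 a.2)]
    refine congrArg κ (residue_eq_iff.2 ?_)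
    rw [← neg_sub]
    exact neg_mem_mx (hτ a)
  have hmem (c : C) : UP.diag U S.E (S.f c) ∈ F' :=
    ⟨_, hτF ⟨S.f c, S.f_mem c⟩⟩
  let S' : Stage C π :=
    { E := UP U S.E
      f := (UP.diag U S.E).comp S.f
      O := ultra U S.O
      A := ultra U S.A
      F := F'
      le := fun x hx => by
        obtain ⟨x, rfl⟩ := UP.mk_surjective x
        exact (mk_mem_ultra.1 hx).mono fun i hi => S.le hi
      hens := S.hens.ultra
      f_mem := hmem
      F_le := hF'
      sep := by
        intro p _ _
        have h1 : MacLane p ((IsLocalRing.residue _).comp (codVal τ (ultra U S.A) hτA)) := by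
          refine MacLane.of_comp κ.injective ?_
          rw [hκτ]
          exact UP.macLane_diag p
        let e : IsLocalRing.ResidueField S.A ≃+* F' := RingEquiv.ofBijective τ.rangeRestrictField
          τ.rangeRestrictField_bijective
        have h2 := h1.comp (macLane_of_equiv e.symm p)
        convert h2 using 1
        ext x
        obtain ⟨y, rfl⟩ := e.surjective x
        simp only [RingHom.comp_apply, RingHom.coe_coe, e.symm_apply_apply]
        rfl
      inv_notMem := by
        rw [RingHom.comp_apply, ← map_inv₀, diag_mem_ultra]
        exact S.inv_notMem }
  refine ⟨S', ⟨UP.diag U S.E, fun c => rfl, fun x => diag_mem_ultra, fun x => diag_mem_ultra,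
    fun x hx => ⟨_, hτF ⟨x, hx⟩⟩, fun y hy => ⟨_, ⟨_, rfl⟩, hτ ⟨y, hy⟩⟩, fun n P q h => ?_⟩⟩
  have := h.map κ.injective
  rw [← UP.sol_iff (U := U)]
  convert this using 1
  ext c
  exact (hκ (codVal S.f S.A (fun c => S.F_le ⟨_, S.f_mem c⟩) c) _).symm

end Stage

theorem exists_colimit (E : ℕ → Type u) [∀ n, Field (E n)] (j : ∀ n, E n →+* E (n + 1)) :
    ∃ (E' : Type u) (_ : Field E') (e : ∀ n, E n →+* E'), (∀ n x, e (n + 1) (j n x) = e n x) ∧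
      ∀ x, ∃ n y, e n y = x := by
  let T (m n : ℕ) (h : m ≤ n) : E m →+* E n :=
    Nat.leRecOn h (fun {k} g => (j k).comp g) (RingHom.id _)
  have hself (m) : T m m le_rfl = RingHom.id _ := Nat.leRecOn_self _
  have hsucc (m n) (h : m ≤ n) : T m (n + 1) (h.trans n.le_succ) = (j n).comp (T m n h) :=
    Nat.leRecOn_succ h _
  have : DirectedSystem E (T · · ·) := by
    refine ⟨fun m x => by rw [hself]; rfl, fun n k m hij hjk x => ?_⟩
    induction n, hjk using Nat.le_induction with
    | base => rw [hself]; rfl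
    | succ n hn ih => rw [hsucc _ _ hn, hsucc _ _ (hij.trans hn), RingHom.comp_apply, ih]; rfl
  refine ⟨DirectLimit E T, inferInstance, fun n =>
    { toFun x := ⟦⟨n, x⟩⟧
      map_one' := (DirectLimit.one_def n).symm
      map_zero' := (DirectLimit.zero_def n).symm
      map_mul' x y := (DirectLimit.mul_def n x y).symm
      map_add' x y := (DirectLimit.add_def n x y).symm }, fun n x => ?_, fun x => ?_⟩
  · have h := DirectLimit.mk_apply (f := T) n (n + 1) x n.le_succ
    rw [hsucc n n le_rfl, hself] at h
    exact h
  · obtain ⟨n, y, rfl⟩ := DirectLimit.exists_eq_mk T x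
    exact ⟨n, y, rfl⟩

end Paper

namespace Paper

theorem eq_zero_of_mem_mx {E : Type*} [Field E] {A : ValuationSubring E} {F : Subfield E}
    (hFA : ∀ x : F, (x : E) ∈ A) {x : E} (hx : x ∈ F) (h : x ∈ mx A) : x = 0 :=
  (mem_mx_iff.1 h).resolve_right fun h' => h' (hFA ⟨x⁻¹, inv_mem hx⟩)

theorem Hens.comap {E : Type*} [Field E] {O A : ValuationSubring E} {F : Subfield E}
    (h : Hens (mx O) O) (hOA : O ≤ A) (hFA : ∀ x : F, (x : E) ∈ A)
    (hres : ∀ y ∈ A, ∃ x ∈ F, y - x ∈ mx A) :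
    Hens (mx (O.comap F.subtype)) (O.comap F.subtype : Set F) := by
  intro d a ha
  have hmx (x : F) (hx : x ∈ mx (O.comap F.subtype)) : (x : E) ∈ mx O := by
    rw [mem_mx_iff] at hx ⊢
    exact hx.imp (fun h => by rw [h]; rfl) id
  obtain ⟨s, hs, hs0⟩ := h d (fun i => a i) fun i => hmx _ (ha i)
  obtain ⟨x, hxF, hx⟩ := hres s (hOA hs)
  have hxO : x ∈ O := by
    have := sub_mem hs (mx_subset (mx_subset_mx hOA hx))
    rwa [sub_sub_cancel] at this
  refine ⟨⟨x, hxF⟩, hxO, Subtype.ext ?_⟩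
  refine eq_zero_of_mem_mx hFA (Subtype.prop _) ?_
  have hsA := hOA hs
  have hxA := hOA hxO
  have key : IsLocalRing.residue A ⟨s, hsA⟩ = IsLocalRing.residue A ⟨x, hxA⟩ := residue_eq_iff.2 hx
  let b (i : Fin d) : A := ⟨a i, hFA (a i)⟩
  have h1 : (1 + ⟨s, hsA⟩ + ∑ i, b i * ⟨s, hsA⟩ ^ ((i : ℕ) + 2) : A) = 0 := by
    apply Subtype.ext
    push_cast
    exact hs0
  have h2 : IsLocalRing.residue A (1 + ⟨x, hxA⟩ + ∑ i, b i * ⟨x, hxA⟩ ^ ((i : ℕ) + 2)) = 0 := by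
    have := congrArg (IsLocalRing.residue A) h1
    simpa only [map_add, map_sum, map_mul, map_pow, key, map_zero, map_one] using this
  rw [IsLocalRing.residue_eq_zero_iff, ← coe_mem_mx] at h2
  push_cast at h2 ⊢
  exact h2

namespace Stage

variable {C : Type u} [Field C] {π : C}

/-- Along a chain of stages, solutions in the union can be found in the residue field of the
first stage. -/
theorem sol_toRes (S₀ : Stage C π) {n : ℕ} (hR4 : R4N.{u} n) {P : List (MvPolynomial (Fin n) C)}
    {q : MvPolynomial (Fin n) C} (h : Sol S₀.f P q) : Sol S₀.toRes P q := by
  choose next hnext using fun S : Stage C π => S.exists_rel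
  obtain ⟨S, rfl, hS⟩ : ∃ S : ℕ → Stage C π, S 0 = S₀ ∧ ∀ n, Nonempty (Rel (S n) (S (n + 1))) :=
    ⟨fun n => Nat.rec S₀ (fun _ S => next S) n, rfl, fun n => hnext _⟩
  let r (n : ℕ) : Rel (S n) (S (n + 1)) := (hS n).some
  have hsol (m : ℕ) (h : Sol (S m).toRes P q) : Sol (S 0).toRes P q := by
    induction m with
    | zero => exact h
    | succ m ih => exact ih ((r m).sol _ _ _ h)
  obtain ⟨E, hE, e, he, he'⟩ :=
    exists_colimit (fun n => (S n).E) (fun n => (r n).j)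
  have trans (m n : ℕ) (hmn : m ≤ n) (y : (S m).E) : ∃ z : (S n).E, e n z = e m y ∧
      (z ∈ (S n).O ↔ y ∈ (S m).O) ∧ (z ∈ (S n).A ↔ y ∈ (S m).A) ∧ (y ∈ (S m).F → z ∈ (S n).F) := by
    induction n, hmn using Nat.le_induction with
    | base => exact ⟨y, rfl, Iff.rfl, Iff.rfl, id⟩
    | succ n _ ih =>
      obtain ⟨z, h1, h2, h3, h4⟩ := ih
      exact ⟨(r n).j z, (he n z).trans h1, ((r n).mem_O z).trans h2, ((r n).mem_A z).trans h3,
        fun h => (r n).mem_F z (h4 h)⟩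
  have common {d : ℕ} (x : Fin d → E) (n₀ : ℕ) : ∃ n ≥ n₀, ∃ y : Fin d → (S n).E,
      ∀ i, e n (y i) = x i := by
    choose m y hy using fun i => he' (x i)
    choose z hz using fun i => trans (m i) (n₀ + ∑ i, m i)
      ((Finset.single_le_sum (fun _ _ => Nat.zero_le _) (Finset.mem_univ i)).trans
        (Nat.le_add_left _ _)) (y i)
    exact ⟨_, Nat.le_add_right _ _, z, fun i => (hz i).1.trans (hy i)⟩
  have common₂ (x y : E) : ∃ n, ∃ x' y' : (S n).E, e n x' = x ∧ e n y' = y := by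
    obtain ⟨n, -, z, hz⟩ := common ![x, y] 0
    exact ⟨n, z 0, z 1, hz 0, hz 1⟩
  have hinj (m n : ℕ) (x : (S m).E) (y : (S n).E) (h : e m x = e n y) :
      (x ∈ (S m).O ↔ y ∈ (S n).O) ∧ (x ∈ (S m).A ↔ y ∈ (S n).A) := by
    obtain ⟨x', hx, hx₁, hx₂, -⟩ := trans m (max m n) (le_max_left _ _) x
    obtain ⟨y', hy, hy₁, hy₂, -⟩ := trans n (max m n) (le_max_right _ _) y
    obtain rfl : x' = y' := (e _).injective (by rw [hx, hy, h])
    exact ⟨hx₁.symm.trans hy₁, hx₂.symm.trans hy₂⟩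
  -- valuation rings in the union
  have colim (V : ∀ n, ValuationSubring (S n).E)
      (hV : ∀ m n (x : (S m).E) (y : (S n).E), e m x = e n y → (x ∈ V m ↔ y ∈ V n)) :
      ∃ W : ValuationSubring E, ∀ n x, e n x ∈ W ↔ x ∈ V n := by
    have key (n x) : (∃ m, ∃ y ∈ V m, e m y = e n x) ↔ x ∈ V n :=
      ⟨fun ⟨m, y, hy, h⟩ => (hV _ _ _ _ h).1 hy, fun h => ⟨n, x, h, rfl⟩⟩
    refine ⟨{ carrier := {x | ∃ m, ∃ y ∈ V m, e m y = x}
              mul_mem' := fun {x y} hx hy => ?_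
              one_mem' := ⟨0, 1, one_mem _, map_one _⟩
              add_mem' := fun {x y} hx hy => ?_
              zero_mem' := ⟨0, 0, zero_mem _, map_zero _⟩
              neg_mem' := ?_
              mem_or_inv_mem' := fun x => ?_ }, key⟩
    · obtain ⟨n, x, y, rfl, rfl⟩ := common₂ x y
      exact ⟨n, x * y, mul_mem ((key n x).1 hx) ((key n y).1 hy), map_mul ..⟩
    · obtain ⟨n, x, y, rfl, rfl⟩ := common₂ x y
      exact ⟨n, x + y, add_mem ((key n x).1 hx) ((key n y).1 hy), map_add ..⟩
    · rintro _ ⟨n, x, hx, rfl⟩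
      exact ⟨n, -x, neg_mem hx, map_neg ..⟩
    · obtain ⟨n, x, rfl⟩ := he' x
      exact ((V n).mem_or_inv_mem x).imp (fun h => ⟨n, x, h, rfl⟩) fun h => ⟨n, x⁻¹, h, map_inv₀ ..⟩
  obtain ⟨O, hO⟩ := colim (fun n => (S n).O) fun m n x y h => (hinj m n x y h).1
  obtain ⟨A, hA⟩ := colim (fun n => (S n).A) fun m n x y h => (hinj m n x y h).2
  have mxW (V : ∀ n, ValuationSubring (S n).E) (W : ValuationSubring E)
      (hW : ∀ n x, e n x ∈ W ↔ x ∈ V n) (n x) : e n x ∈ mx W ↔ x ∈ mx (V n) := by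
    rw [mem_mx_iff, mem_mx_iff, ← map_inv₀, hW, map_eq_zero]
  have hmono : Monotone fun n => (S n).F.map (e n) := by
    refine monotone_nat_of_le_succ fun n => ?_
    rintro _ ⟨x, hx, rfl⟩
    exact ⟨_, (r n).mem_F x hx, he n x⟩
  let F : Subfield E := ⨆ n, (S n).F.map (e n)
  have hF (x : E) : x ∈ F ↔ ∃ n, ∃ y ∈ (S n).F, e n y = x :=
    Subfield.mem_iSup_of_directed hmono.directed_le
  have hOA : O ≤ A := fun x hx => by
    obtain ⟨n, x, rfl⟩ := he' x
    exact (hA n x).2 ((S n).le ((hO n x).1 hx))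
  have hFA (x : F) : (x : E) ∈ A := by
    obtain ⟨n, y, hy, h⟩ := (hF x).1 x.2
    rw [← h, hA]
    exact (S n).F_le ⟨y, hy⟩
  have hres (y : E) (hy : y ∈ A) : ∃ x ∈ F, y - x ∈ mx A := by
    obtain ⟨n, y, rfl⟩ := he' y
    obtain ⟨x, hx, h⟩ := (r n).exists_sub_mem y ((hA n y).1 hy)
    refine ⟨e (n + 1) x, (hF _).2 ⟨_, x, hx, rfl⟩, ?_⟩
    rw [← he, ← map_sub]
    exact (mxW _ A hA _ _).2 h
  have hens : Hens (mx O) O := by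
    intro d a ha
    obtain ⟨n, -, b, hb⟩ := common a 0
    obtain rfl : (fun i => e n (b i)) = a := funext hb
    obtain ⟨s, hs, h⟩ := (S n).hens d b fun i => (mxW _ O hO _ _).1 (ha i)
    refine ⟨e n s, (hO n s).2 hs, ?_⟩
    simpa using congrArg (e n) h
  let f : C →+* E := (e 0).comp (S 0).f
  have hf (n c) : e n ((S n).f c) = f c := by
    induction n with
    | zero => rfl
    | succ n ih => rw [← ih, ← (r n).comm, he]
  have hfF (c) : f c ∈ F := (hF _).2 ⟨0, _, (S 0).f_mem c, rfl⟩
  have hlarge : LargeField F := by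
    refine largeField_of_hens (O.comap F.subtype) (hens.comap hOA hFA hres)
      ⟨⟨f π, hfF π⟩⁻¹, fun hmem => (S 0).inv_notMem ?_⟩
    have : (f π)⁻¹ ∈ O := hmem
    rwa [RingHom.comp_apply, ← map_inv₀, hO 0] at this
  let c : C →+* F := f.codRestrict F hfF
  have h1 : Sol (F.subtype.comp c) P q := h.map (e 0).injective
  have h2 := hR4.sol A F hlarge (fun x hx => hFA ⟨x, hx⟩) hres (sol_comp_iff.1 h1)
  rw [← sol_comp_iff] at h2
  obtain ⟨x, hx, hq⟩ := h2
  choose m y hyF hy using fun i => (hF _).1 (x i).2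
  choose z hz using fun i => trans (m i) (∑ i, m i)
      (Finset.single_le_sum (fun _ _ => Nat.zero_le _) (Finset.mem_univ i)) (y i)
  generalize hN : ∑ i, m i = N at z hz
  refine hsol N ?_
  let cN : C →+* (S N).F := (S N).f.codRestrict (S N).F (S N).f_mem
  have h3 : Sol cN P q := by
    let z' (i) : (S N).F := ⟨z i, (hz i).2.2.2 (hyF i)⟩
    have hz' (i) : e N (z' i) = x i := (hz i).1.trans (hy i)
    have key (p : MvPolynomial (Fin n) C) : e N (p.eval₂ cN z' : (S N).F) =
        (p.eval₂ ((RingHom.id F).comp c) x : F) := by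
      have e1 := MvPolynomial.hom_eval₂ p cN ((e N).comp (S N).F.subtype) z'
      have e2 := MvPolynomial.hom_eval₂ p ((RingHom.id F).comp c) F.subtype x
      refine e1.trans (Eq.trans ?_ e2.symm)
      congr 1
      · ext a
        exact hf N a
      · exact funext hz'
    refine ⟨z', fun p hp => ?_, fun h0 => hq ?_⟩
    · have := key p
      rw [hx p hp] at this
      exact Subtype.ext ((map_eq_zero (e N)).1 this)
    · have := key q
      rw [h0] at this
      exact Subtype.ext (this.symm.trans (map_zero _))
  exact h3.map (g := (IsLocalRing.residue _).comp (codVal (S N).F.subtype (S N).A (S N).F_le))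
    (RingHom.injective _)

end Stage

end Paper

namespace Paper

open MvPolynomial

/-! ### Separable extensions are formally smooth -/

theorem subsingleton_h1Cotangent_iff {K L : Type*} [Field K] [Field L] [Algebra K L] :
    Subsingleton (Algebra.H1Cotangent K L) ↔ ∀ x : MvPolynomial L K, aeval id x = 0 →
      (∀ i, aeval id (pderiv i x) = 0) →
        x ∈ RingHom.ker (aeval id : MvPolynomial L K →ₐ[K] L) ^ 2 := by
  let _ : Algebra (MvPolynomial L K) L := (aeval (R := K) (id : L → L)).toAlgebra
  have : IsScalarTower K (MvPolynomial L K) L := .of_algHom (aeval (R := K) (id : L → L))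
  have hsurj : Function.Surjective (algebraMap (MvPolynomial L K) L) := fun a =>
    ⟨X a, aeval_X (R := K) (id : L → L) a⟩
  rw [← Algebra.FormallySmooth.kerCotangentToTensor_injective_iff hsurj, injective_iff_map_eq_zero]
  have key (x : RingHom.ker (algebraMap (MvPolynomial L K) L)) :
      KaehlerDifferential.kerCotangentToTensor K (MvPolynomial L K) L (Ideal.toCotangent _ x) = 0 ↔
        ∀ i, aeval id (pderiv i x.1) = 0 := by
    rw [KaehlerDifferential.kerCotangentToTensor_toCotangent, ← (Module.Basis.baseChange L
      (KaehlerDifferential.mvPolynomialBasis K L)).repr.map_eq_zero_iff, Finsupp.ext_iff]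
    refine forall_congr' fun i => ?_
    rw [Module.Basis.baseChange_repr_tmul, KaehlerDifferential.mvPolynomialBasis_repr_apply,
      Algebra.smul_def, mul_one]
    rfl
  constructor
  · intro h x hx hd
    have := h (Ideal.toCotangent _ ⟨x, hx⟩) ((key ⟨x, hx⟩).2 hd)
    exact (Ideal.toCotangent_eq_zero _ _).1 this
  · intro h x hx
    obtain ⟨x, rfl⟩ := Ideal.toCotangent_surjective _ x
    exact (Ideal.toCotangent_eq_zero _ _).2 (h x x.2 ((key x).1 hx))

theorem formallySmooth_of_sep {K L : Type*} [Field K] [Field L] [Algebra K L]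
    (h : Sep (algebraMap K L)) : Algebra.FormallySmooth K L := by
  refine ⟨inferInstance, subsingleton_h1Cotangent_iff.2 fun x hx hd => ?_⟩
  obtain ⟨s, hs, hsep⟩ := h.exists_isTranscendenceBasis x.vars
  have hM : Algebra.FormallySmooth K (IntermediateField.adjoin K (x.vars : Set L)) := by
    have : Algebra.IsSeparable
        (IntermediateField.adjoin K (Set.range ((↑) : s → IntermediateField.adjoin K
          (x.vars : Set L)))) (IntermediateField.adjoin K (x.vars : Set L)) := by
      convert! hsep <;> simp
    exact .of_algebraicIndependent_of_isSeparable hs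
  obtain ⟨M, hM', y, rfl⟩ : ∃ M : IntermediateField K L, Algebra.FormallySmooth K M ∧
      ∃ y : MvPolynomial M K, rename M.val y = x := by
    obtain ⟨y, hy⟩ := exists_rename_eq_of_vars_subset_range x (Subtype.val : x.vars → L)
      Subtype.val_injective (by simp)
    exact ⟨_, hM, rename (fun i => ⟨i, IntermediateField.subset_adjoin _ _ i.2⟩) y,
      by rw [rename_rename]; exact hy⟩
  have hcomp (z : MvPolynomial M K) : aeval id (rename M.val z) = (aeval id z : M) := by
    rw [aeval_rename]
    exact (aeval_algebraMap_apply (B := L) (id : M → M) z)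
  have := subsingleton_h1Cotangent_iff.1 hM'.subsingleton_h1Cotangent y
    (by rw [hcomp] at hx; exact_mod_cast hx) fun i => by
      have := hd i
      rw [show (i : L) = M.val i from rfl, pderiv_rename (f := (M.val : M → L)) M.val.injective, hcomp] at this
      exact_mod_cast this
  have h2 := Ideal.mem_map_of_mem (rename M.val : MvPolynomial M K →ₐ[K] MvPolynomial L K) this
  rw [Ideal.map_pow] at h2
  refine Ideal.pow_right_mono (Ideal.map_le_iff_le_comap.2 fun z hz => ?_) 2 h2
  rw [Ideal.mem_comap, RingHom.mem_ker, hcomp, (RingHom.mem_ker).1 hz]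
  rfl

end Paper

namespace Paper

open Filter

/-! ### The completion of a discretely valued field -/

section Completion

variable {K Γ : Type*} [Field K] [LinearOrderedCommGroupWithZero Γ] [hv : Valued K Γ]

theorem smodEq_span_pow_iff {t : K} (h0 : t ≠ 0) (ht : t ∈ hv.v.valuationSubring) (n : ℕ)
    (x y : hv.v.valuationSubring) :
    x ≡ y [SMOD Ideal.span {(⟨t, ht⟩ : hv.v.valuationSubring)} ^ n •
      (⊤ : Submodule hv.v.valuationSubring hv.v.valuationSubring)] ↔
      hv.v ((x : K) - y) ≤ hv.v t ^ n := by
  rw [SModEq.sub_mem, smul_eq_mul, Ideal.mul_top, Ideal.span_singleton_pow,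
    Ideal.mem_span_singleton, ← map_pow]
  have htn : hv.v (t ^ n) ≠ 0 := by simpa using fun h => absurd h h0
  constructor
  · rintro ⟨z, hz⟩
    have hz' : (x : K) - y = t ^ n * z := congrArg Subtype.val hz
    rw [hz', map_mul]
    exact mul_le_of_le_one_right' z.2
  · intro h
    refine ⟨⟨(t ^ n)⁻¹ * (x - y), ?_⟩, Subtype.ext ?_⟩
    · rw [Valuation.mem_valuationSubring_iff, map_mul, map_inv₀]
      exact (inv_mul_le_one₀ (zero_lt_iff.2 htn)).2 h
    · exact (mul_inv_cancel_left₀ (pow_ne_zero n h0) _).symm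

theorem isAdicComplete_valuationSubring [MulArchimedean Γ] [CompleteSpace K] {t : K} (h0 : t ≠ 0)
    (ht : t ∈ hv.v.valuationSubring) (h1 : hv.v t < 1) :
    IsAdicComplete (Ideal.span {(⟨t, ht⟩ : hv.v.valuationSubring)}) hv.v.valuationSubring := by
  have hlt {a : K} (ha : a ≠ 0) : ∃ n : ℕ, hv.v t ^ n < hv.v a :=
    exists_pow_lt₀ h1 (Units.mk0 (hv.v a) (by simpa using ha))
  refine { haus' := fun x hx => ?_, prec' := fun f hf => ?_ }
  · by_contra hne
    obtain ⟨n, hn⟩ := hlt (a := (x : K)) (by simpa using hne)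
    have := (smodEq_span_pow_iff h0 ht n x 0).1 (hx n)
    rw [ZeroMemClass.coe_zero, sub_zero] at this
    exact absurd hn this.not_gt
  · have hf' {m n : ℕ} (hmn : m ≤ n) : hv.v ((f m : K) - f n) ≤ hv.v t ^ m :=
      (smodEq_span_pow_iff h0 ht m _ _).1 (hf hmn)
    have hc : CauchySeq fun n => (f n : K) := by
      refine (Valued.hasBasis_uniformity K Γ).cauchySeq_iff'.2 fun γ _ => ?_
      obtain ⟨n, hn⟩ := exists_pow_lt₀ h1
        (Units.map (MonoidWithZeroHom.ValueGroup₀.embedding (f := .ofClass hv.v)) γ)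
      refine ⟨n, fun m hm => ?_⟩
      rw [Set.mem_ofPred_eq, Valuation.restrict_lt_iff_lt_embedding]
      exact (hf' hm).trans_lt hn
    obtain ⟨a, ha⟩ := cauchySeq_tendsto_of_complete hc
    have key (n : ℕ) : hv.v ((f n : K) - a) ≤ hv.v t ^ n := by
      have hcl := Valued.isClosed_closedBall K (hv.v.restrict (t ^ n))
      have := hcl.mem_of_tendsto (ha.const_sub (f n : K)) (eventually_atTop.2 ⟨n, fun m hm => by
        rw [Set.mem_ofPred_eq, Valuation.restrict_le_iff, map_pow]
        exact hf' hm⟩)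
      rwa [Set.mem_ofPred_eq, Valuation.restrict_le_iff, map_pow] at this
    refine ⟨⟨a, ?_⟩, fun n => (smodEq_span_pow_iff h0 ht n _ _).2 (key n)⟩
    have := sub_mem (f 0).2 (show (f 0 : K) - a ∈ hv.v.valuationSubring by simpa using key 0)
    simpa using this

theorem exists_isAdicComplete (C : Type u) [Field C] (u : Valuation C Zm0) {π : C}
    (hπ : IsUniformizer u π) (hexc : ExcellentCompletion C u) :
    ∃ (E : Type u) (_ : Field E) (B : ValuationSubring E) (j : C →+* E), Sep j ∧
      (∀ c, j c ∈ B ↔ u c ≤ 1) ∧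
      (∃ hB : j π ∈ B, IsAdicComplete (Ideal.span {(⟨j π, hB⟩ : B)}) B) ∧
      ∀ x ∈ B, ∃ c, u c ≤ 1 ∧ ∃ y ∈ B, x = j c + j π * y := by
  let _ : Valued C Zm0 := Valued.mk' u
  let _ : Field (UniformSpace.Completion C) := UniformSpace.Completion.instField
  have hval (c : C) : Valued.v (c : UniformSpace.Completion C) = u c :=
    Valued.valuedCompletion_apply c
  have h0 : ((π : C) : UniformSpace.Completion C) ≠ 0 := fun h => hπ.1.ne' (by
    rw [← hval, h, map_zero])
  have hm : ((π : C) : UniformSpace.Completion C) ∈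
      (Valued.v (R := UniformSpace.Completion C) (Γ₀ := Zm0)).valuationSubring :=
    (hval π).trans_le hπ.2.1.le
  refine ⟨UniformSpace.Completion C, inferInstance, Valued.v.valuationSubring,
    UniformSpace.Completion.coeRingHom, hexc.sep, fun c => ?_, ⟨hm, ?_⟩, fun x hx => ?_⟩
  · rw [← hval c]
    rfl
  · exact isAdicComplete_valuationSubring h0 hm ((hval π).trans_lt hπ.2.1)
  · have hopen := Valued.isOpen_ball (UniformSpace.Completion C)
      ((Valued.v (R := UniformSpace.Completion C) (Γ₀ := Zm0)).restrict (π : C))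
    obtain ⟨c, hc⟩ := UniformSpace.Completion.denseRange_coe.exists_mem_open
      (hopen.preimage (f := fun y => x - y) (continuous_const.sub continuous_id))
      ⟨x, by
        rw [Set.mem_preimage, Set.mem_ofPred_eq, Valuation.restrict_lt_iff, sub_self, map_zero,
          hval]
        exact hπ.1⟩
    rw [Set.mem_preimage, Set.mem_ofPred_eq, Valuation.restrict_lt_iff, hval] at hc
    refine ⟨c, ?_, (π : UniformSpace.Completion C)⁻¹ * (x - c), ?_, ?_⟩
    · rw [← hval]
      have := sub_mem hx (show x - c ∈ Valued.v.valuationSubring from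
        (hc.trans hπ.2.1).le)
      rwa [sub_sub_cancel] at this
    · rw [Valuation.mem_valuationSubring_iff, map_mul, map_inv₀, hval]
      exact (inv_mul_le_one₀ hπ.1).2 hc.le
    · exact (by rw [mul_inv_cancel_left₀ h0, add_sub_cancel] :
        x = (c : UniformSpace.Completion C) + π * ((π : UniformSpace.Completion C)⁻¹ * (x - c)))

end Completion

end Paper

namespace Paper

/-! ### Complete rings with a principal maximal ideal -/

/-- `ρ : S →+* k` is the residue map of a `t`-adically complete ring `S`, with `t` a nonzerodivisor
generating the kernel. -/
structure IsPres {S k : Type*} [CommRing S] [Field k] (ρ : S →+* k) (t : S) : Prop where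
  complete : IsAdicComplete (Ideal.span {t}) S
  surjective : Function.Surjective ρ
  ker_eq : RingHom.ker ρ = Ideal.span {t}
  eq_zero : ∀ x, t * x = 0 → x = 0

section Pres

variable {R S T c k l : Type*} [CommRing R] [CommRing S] [CommRing T] [Field c] [Field k] [Field l]
variable {ρ₀ : R →+* c} {π : R} {ρ : S →+* k} {t : S} {ρ' : T →+* l} {t' : T}

theorem IsPres.map_eq_zero (h : IsPres ρ t) {x : S} : ρ x = 0 ↔ t ∣ x := by
  rw [← RingHom.mem_ker, h.ker_eq, Ideal.mem_span_singleton]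

/-- Lifting along the residue map of a complete ring. -/
theorem IsPres.exists_lift {f : c →+* k} (hf : Sep f) (h : IsPres ρ' t') {ι : c →+* T}
    {φ : k →+* l} (hφ : φ.comp f = ρ'.comp ι) : ∃ σ : k →+* T, ρ'.comp σ = φ ∧ σ.comp f = ι := by
  let _ := f.toAlgebra
  let _ := ι.toAlgebra
  have := formallySmooth_of_sep (K := c) (L := k) hf
  have := h.complete
  let q : T ⧸ Ideal.span {t'} →+* l :=
    Ideal.Quotient.lift _ ρ' fun a ha => by rwa [← h.ker_eq] at ha
  have hq : Function.Injective q := by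
    rw [injective_iff_map_eq_zero]
    intro x hx
    obtain ⟨x, rfl⟩ := Ideal.Quotient.mk_surjective x
    rw [Ideal.Quotient.eq_zero_iff_mem, Ideal.mem_span_singleton, ← h.map_eq_zero]
    exact hx
  have hq' : Function.Surjective q := fun y => by
    obtain ⟨x, rfl⟩ := h.surjective y
    exact ⟨Ideal.Quotient.mk _ x, rfl⟩
  let e := RingEquiv.ofBijective q ⟨hq, hq'⟩
  let ψ : k →ₐ[c] T ⧸ Ideal.span {t'} :=
    { (e.symm : l →+* _).comp φ with
      commutes' := fun a => e.symm_apply_eq.2 (RingHom.congr_fun hφ a) }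
  obtain ⟨g, hg⟩ := Algebra.FormallySmooth.exists_mkₐ_comp_eq_of_isAdicComplete ψ
  refine ⟨g, RingHom.ext fun x => ?_, RingHom.ext fun x => g.commutes x⟩
  have h1 : Ideal.Quotient.mk (Ideal.span {t'}) (g x) = e.symm (φ x) := DFunLike.congr_fun hg x
  exact (congrArg q h1).trans (e.apply_symm_apply _)

theorem IsPres.exists_section (h : IsPres ρ' t') {f : c →+* l} (hf : Sep f) {ι : c →+* T}
    (hι : f = ρ'.comp ι) : ∃ σ : l →+* T, ρ'.comp σ = RingHom.id l ∧ σ.comp f = ι :=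
  h.exists_lift hf (by rw [RingHom.id_comp, hι])

theorem IsPres.exists_powerSeries (h : IsPres ρ t) {σ : k →+* S} (hσ : ρ.comp σ = RingHom.id k) :
    ∃ e : PowerSeries k ≃+* S, (∀ a, e (PowerSeries.C a) = σ a) ∧ e PowerSeries.X = t := by
  have := h.complete
  have hs (a : k) : ρ (σ a) = a := RingHom.congr_fun hσ a
  refine ⟨RingEquiv.ofBijective (evalPS σ t) ⟨evalPS_injective σ (fun a ha => ?_) h.eq_zero,
    evalPS_surjective σ fun x => ⟨ρ x, ?_⟩⟩, evalPS_C σ, evalPS_X σ⟩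
  · rwa [← h.map_eq_zero, hs] at ha
  · obtain ⟨y, hy⟩ := h.map_eq_zero.1 (show ρ (x - σ (ρ x)) = 0 by rw [map_sub, hs, sub_self])
    exact ⟨y, by rw [← hy]; ring⟩

theorem IsPres.ringHom_ext (h₀ : IsPres ρ₀ π) {σ₀ : c →+* R} (hσ : ρ₀.comp σ₀ = RingHom.id c)
    {f g : R →+* T} (h : IsPres ρ' (f π)) (hc : f.comp σ₀ = g.comp σ₀) (hπ : f π = g π) : f = g := by
  have := h.complete.toIsHausdorff
  refine ringHom_ext_of_complete (c := Set.range σ₀) ?_ hπ fun x => ⟨_, ⟨ρ₀ x, rfl⟩, ?_⟩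
  · rintro _ ⟨a, rfl⟩
    exact RingHom.congr_fun hc a
  · obtain ⟨y, hy⟩ := h₀.map_eq_zero.1 (show ρ₀ (x - σ₀ (ρ₀ x)) = 0 by
      rw [map_sub, sub_eq_zero]; exact (RingHom.congr_fun hσ (ρ₀ x)).symm)
    exact ⟨y, by rw [← hy]; ring⟩

theorem IsPres.exists_ringHom (h₀ : IsPres ρ₀ π) {σ₀ : c →+* R}
    (hσ : ρ₀.comp σ₀ = RingHom.id c) {a : R →+* S} {b : R →+* T} (h : IsPres ρ (a π))
    (h' : IsPres ρ' (b π)) {φ : c →+* k} (hφ : Sep φ) {ψ : c →+* l} {θ : k →+* l}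
    (hθ : θ.comp φ = ψ) (ha : φ.comp ρ₀ = ρ.comp a) (hb : ψ.comp ρ₀ = ρ'.comp b) :
    ∃ g : S →+* T, g.comp a = b := by
  obtain ⟨σ, hs, hs'⟩ := h.exists_section hφ (ι := a.comp σ₀) (by
    rw [← RingHom.comp_assoc, ← ha, RingHom.comp_assoc, hσ, RingHom.comp_id])
  obtain ⟨τ, -, hτ⟩ := h'.exists_lift hφ (ι := b.comp σ₀) (φ := θ) (by
    rw [← RingHom.comp_assoc, ← hb, RingHom.comp_assoc, hσ, hθ, RingHom.comp_id])
  obtain ⟨e, he, heX⟩ := h.exists_powerSeries hs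
  have := h'.complete
  have hgX : ((evalPS τ (b π)).comp (e.symm : S →+* PowerSeries k)) (a π) = b π := by
    rw [← heX]
    exact (congrArg _ (e.symm_apply_apply _)).trans (evalPS_X τ)
  refine ⟨(evalPS τ (b π)).comp (e.symm : S →+* PowerSeries k),
    (h₀.ringHom_ext hσ h' (RingHom.ext fun x => ?_) hgX.symm).symm⟩
  have h1 : a (σ₀ x) = σ (φ x) := (RingHom.congr_fun hs' x).symm
  have h2 : b (σ₀ x) = τ (φ x) := (RingHom.congr_fun hτ x).symm
  change b (σ₀ x) = evalPS τ (b π) (e.symm (a (σ₀ x)))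
  rw [h1, h2, ← he, e.symm_apply_apply, evalPS_C]

theorem IsPres.macLane {p : ℕ} (hp : p.Prime) [CharP k p] (h₀ : IsPres ρ₀ π) {σ₀ : c →+* R}
    (hσ : ρ₀.comp σ₀ = RingHom.id c) {a : R →+* S} (h : IsPres ρ (a π)) {φ : c →+* k}
    (hφ : Sep φ) (ha : φ.comp ρ₀ = ρ.comp a) : MacLane p a := by
  have := φ.charP φ.injective p
  obtain ⟨σ, hs, hs'⟩ := h.exists_section hφ (ι := a.comp σ₀) (by
    rw [← RingHom.comp_assoc, ← ha, RingHom.comp_assoc, hσ, RingHom.comp_id])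
  obtain ⟨e, he, heX⟩ := h.exists_powerSeries hs
  obtain ⟨e₀, he₀, heX₀⟩ := h₀.exists_powerSeries hσ
  have key : a = (e : PowerSeries k →+* S).comp
      ((PowerSeries.map φ).comp (e₀.symm : R →+* PowerSeries c)) := by
    refine h₀.ringHom_ext hσ h (RingHom.ext fun x => ?_) ?_
    · change a (σ₀ x) = e (PowerSeries.map φ (e₀.symm (σ₀ x)))
      rw [← he₀, e₀.symm_apply_apply, PowerSeries.map_C, he, he₀]
      exact (RingHom.congr_fun hs' x).symm
    · change a π = e (PowerSeries.map φ (e₀.symm π))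
      rw [← heX₀, e₀.symm_apply_apply, PowerSeries.map_X, heX, heX₀]
  rw [key]
  exact (macLane_of_equiv e p).comp ((macLane_map_powerSeries hp (hφ p hp this)).comp
    (macLane_of_equiv e₀.symm p))

end Pres

end Paper

namespace Paper

/-! ### Extending homomorphisms to completions -/

theorem exists_extension {R B S : Type*} [CommRing R] [CommRing B] [CommRing S] {π : R}
    {i : R →+* B} {f : R →+* S} (h₁ : ∀ x, ∃ r y, x = i r + i π * y)
    (h₂ : ∀ r, i π ∣ i r → π ∣ r) (h₃ : ∀ x, i π * x = 0 → x = 0)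
    (hS : IsAdicComplete (Ideal.span {f π}) S) : ∃ a : B →+* S, a.comp i = f := by
  have h₁' (n : ℕ) (x : B) : ∃ r y, x = i r + i π ^ n * y := by
    induction n generalizing x with
    | zero => exact ⟨0, x, by simp⟩
    | succ n ih =>
      obtain ⟨r, y, rfl⟩ := h₁ x
      obtain ⟨s, z, rfl⟩ := ih y
      exact ⟨r + π * s, z, by rw [map_add, map_mul]; ring⟩
  have h₂' (n : ℕ) (r : R) (hr : i π ^ n ∣ i r) : π ^ n ∣ r := by
    induction n generalizing r with
    | zero => simp
    | succ n ih =>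
      obtain ⟨s, rfl⟩ := h₂ r ((dvd_pow_self _ n.succ_ne_zero).trans hr)
      obtain ⟨y, hy⟩ := hr
      rw [pow_succ']
      refine mul_dvd_mul_left _ (ih s ⟨y, ?_⟩)
      rw [← sub_eq_zero]
      apply h₃
      rw [mul_sub, ← map_mul, hy]
      ring
  let j (n : ℕ) : R →+* B ⧸ Ideal.span {i π} ^ n := (Ideal.Quotient.mk _).comp i
  have hj (n : ℕ) : Function.Surjective (j n) := fun x => by
    obtain ⟨x, rfl⟩ := Ideal.Quotient.mk_surjective x
    obtain ⟨r, y, rfl⟩ := h₁' n x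
    refine ⟨r, Ideal.Quotient.eq.2 ?_⟩
    rw [Ideal.span_singleton_pow, Ideal.mem_span_singleton]
    exact ⟨-y, by ring⟩
  have hker (n : ℕ) : RingHom.ker (j n) ≤
      RingHom.ker ((Ideal.Quotient.mk (Ideal.span {f π} ^ n)).comp f) := fun r hr => by
    rw [RingHom.mem_ker, RingHom.comp_apply, Ideal.Quotient.eq_zero_iff_mem,
      Ideal.span_singleton_pow, Ideal.mem_span_singleton] at hr ⊢
    rw [← map_pow]
    exact map_dvd f (h₂' n r hr)
  let g (n : ℕ) : B →+* S ⧸ Ideal.span {f π} ^ n :=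
    ((j n).liftOfSurjective (hj n) ⟨_, hker n⟩).comp (Ideal.Quotient.mk _)
  have hg (n : ℕ) (r : R) : g n (i r) = Ideal.Quotient.mk _ (f r) :=
    (j n).liftOfRightInverse_comp_apply _ (Function.rightInverse_surjInv (hj n)) ⟨_, hker n⟩ r
  have hg' (n : ℕ) (x : B) : g n (i π ^ n * x) = 0 := by
    have h0 : Ideal.Quotient.mk (Ideal.span {i π} ^ n) (i π ^ n * x) = 0 := by
      rw [Ideal.Quotient.eq_zero_iff_mem, Ideal.span_singleton_pow, Ideal.mem_span_singleton]
      exact dvd_mul_right _ _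
    change (j n).liftOfSurjective (hj n) ⟨_, hker n⟩ (Ideal.Quotient.mk _ (i π ^ n * x)) = 0
    rw [h0, map_zero]
  have hcomp {m n : ℕ} (hle : m ≤ n) :
      (Ideal.Quotient.factorPow (Ideal.span {f π}) hle).comp (g n) = g m := by
    ext x
    obtain ⟨r, y, rfl⟩ := h₁' n x
    have : i π ^ n * y = i π ^ m * (i π ^ (n - m) * y) := by
      rw [← mul_assoc, ← pow_add, Nat.add_sub_cancel' hle]
    rw [RingHom.comp_apply, map_add, map_add, map_add, hg, hg, hg', this, hg', map_zero]
    rfl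
  refine ⟨IsAdicComplete.liftRingHom (Ideal.span {f π}) g hcomp, RingHom.ext fun r => ?_⟩
  refine eq_of_forall_mk (t := f π) fun n => ?_
  rw [RingHom.comp_apply, IsAdicComplete.mk_liftRingHom, hg]

theorem MacLane.of_isFractionRing_left {p : ℕ} {R C K : Type*} [CommRing R] [IsDomain R] [Field C]
    [CommRing K] [Algebra R C] [IsFractionRing R C] {f : C →+* K}
    (h : MacLane p (f.comp (algebraMap R C))) : MacLane p f := by
  intro n c x hx hsum
  obtain ⟨b, hb⟩ := IsLocalization.exist_integer_multiples_of_finite (nonZeroDivisors R) c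
  choose d hd using hb
  have hinj := IsFractionRing.injective R C
  have hb0 : algebraMap R C b ≠ 0 := (map_ne_zero_iff _ hinj).2 (nonZeroDivisors.ne_zero b.2)
  have hd' (i : Fin n) : algebraMap R C (d i) = algebraMap R C b * c i := by
    rw [hd, Algebra.smul_def]
  obtain ⟨y, ⟨j, hj⟩, hy⟩ := h n d x hx (by
    have h2 := congrArg (f (algebraMap R C b) * ·) hsum
    simp only [mul_zero, Finset.mul_sum] at h2
    rw [← h2]
    exact Finset.sum_congr rfl fun i _ => by rw [RingHom.comp_apply, hd', map_mul]; ring)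
  refine ⟨fun i => algebraMap R C (y i), ⟨j, (map_ne_zero_iff _ hinj).2 hj⟩, ?_⟩
  have h3 := congrArg (algebraMap R C) hy
  simp only [map_sum, map_mul, map_pow, map_zero, hd', mul_assoc] at h3
  rw [← Finset.mul_sum] at h3
  exact (mul_eq_zero.1 h3).resolve_left hb0

theorem sep_zmod (p : ℕ) [Fact p.Prime] {K : Type*} [Field K] (f : ZMod p →+* K) : Sep f := by
  intro q hq hqp
  obtain rfl : q = p := CharP.eq (ZMod p) hqp (ZMod.charP p)
  have := charP_of_injective_ringHom f.injective q
  let _ := f.toAlgebra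
  refine macLane_of_linearIndependent_pow hq fun n e he => ?_
  rw [Fintype.linearIndependent_iff] at he ⊢
  intro c hc
  refine he c (pow_eq_zero_iff hq.ne_zero |>.1 ?_)
  rw [sum_pow_char, ← hc]
  exact Finset.sum_congr rfl fun i _ => by rw [smul_pow, ZMod.pow_card]

theorem sep_of_charZero {F K : Type*} [Field F] [CharZero F] [CommRing K] (f : F →+* K) :
    Sep f := fun _ hp hF => (hp.ne_zero (CharP.eq F hF (CharP.ofCharZero F))).elim

/-- An equicharacteristic valuation ring contains a perfect field. -/
theorem exists_sep_valuationSubring {C : Type*} [Field C] (A : ValuationSubring C)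
    (h : ringChar C = ringChar (IsLocalRing.ResidueField A)) :
    ∃ (F : Type) (_ : Field F) (ι : F →+* A), Sep ((IsLocalRing.residue A).comp ι) := by
  obtain ⟨p, hp⟩ := CharP.exists C
  obtain rfl := ringChar.eq C p
  have hk : CharP (IsLocalRing.ResidueField A) (ringChar C) := h ▸ ringChar.charP _
  rcases CharP.char_is_prime_or_zero C (ringChar C) with hp | hp
  · have : Fact (ringChar C).Prime := ⟨hp⟩
    have : CharP A (ringChar C) :=
      (RingHom.charP_iff A.subtype Subtype.val_injective _).2 inferInstance
    exact ⟨ZMod (ringChar C), inferInstance, ZMod.castHom dvd_rfl A, sep_zmod _ _⟩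
  · rw [hp] at hk
    have := CharP.charP_to_charZero (IsLocalRing.ResidueField A)
    refine ⟨ℚ, inferInstance, IsLocalization.lift (M := nonZeroDivisors ℤ) (g := Int.castRingHom A)
      fun y => ?_, sep_of_charZero _⟩
    rw [← IsLocalRing.residue_ne_zero_iff_isUnit, eq_intCast, map_intCast, Int.cast_ne_zero]
    exact nonZeroDivisors.ne_zero y.2

end Paper

namespace Paper

section Pres

variable {R B S T c k l : Type*} [CommRing R] [CommRing B] [CommRing S] [CommRing T] [Field c]
  [Field k] [Field l]
variable {i : R →+* B} {r : R →+* c} {ρ₀ : B →+* c} {π : R} {ρ : S →+* k} {ρ' : T →+* l}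

theorem IsPres.exists_eq_add (h : IsPres ρ₀ (i π)) (hr : Function.Surjective r)
    (hi : ρ₀.comp i = r) (x : B) : ∃ a y, x = i a + i π * y := by
  obtain ⟨a, ha⟩ := hr (ρ₀ x)
  obtain ⟨y, hy⟩ := h.map_eq_zero.1 (show ρ₀ (x - i a) = 0 by
    rw [map_sub, ← ha, ← hi]; exact sub_self _)
  exact ⟨a, y, by rw [← hy]; ring⟩

theorem IsPres.exists_extension {f : R →+* S} (h : IsPres ρ₀ (i π)) (hr : Function.Surjective r)
    (hk : ∀ x, r x = 0 → π ∣ x) (hi : ρ₀.comp i = r) (hS : IsPres ρ (f π)) {φ : c →+* k}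
    (hφ : φ.comp r = ρ.comp f) : ∃ a : B →+* S, a.comp i = f ∧ φ.comp ρ₀ = ρ.comp a := by
  obtain ⟨a, rfl⟩ := Paper.exists_extension (f := f) (h.exists_eq_add hr hi)
    (fun x hx => hk x (hi ▸ h.map_eq_zero.2 hx)) h.eq_zero hS.complete
  refine ⟨a, rfl, RingHom.ext fun x => ?_⟩
  obtain ⟨x, y, rfl⟩ := h.exists_eq_add hr hi x
  have h1 : ρ₀ (i π * y) = 0 := h.map_eq_zero.2 (dvd_mul_right _ _)
  have h2 : ρ (a (i π * y)) = 0 := hS.map_eq_zero.2 (by rw [map_mul]; exact dvd_mul_right _ _)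
  rw [RingHom.comp_apply, RingHom.comp_apply, map_add, map_add a, map_add ρ, h1, h2, add_zero,
    add_zero]
  subst hi
  exact RingHom.congr_fun hφ x

end Pres

theorem resMap_eq_zero {K Γ : Type*} [Field K] [LinearOrderedCommGroupWithZero Γ]
    {v : Valuation K Γ} {x : v.valuationSubring} : resMap v x = 0 ↔ v x < 1 := by
  rw [IsLocalRing.residue_eq_zero_iff, ← coe_mem_mx, mem_mx_iff, Valuation.mem_valuationSubring_iff,
    map_inv₀]
  rcases eq_or_ne (x : K) 0 with h | h
  · simp [h]
  · rw [not_le, one_lt_inv₀ (zero_lt_iff.2 (by simpa using h))]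
    simp [h]

theorem IsUniformizer.dvd_of_resMap_eq_zero {K Γ : Type*} [Field K]
    [LinearOrderedCommGroupWithZero Γ] {v : Valuation K Γ} {π : K} (hπ : IsUniformizer v π)
    {x : v.valuationSubring} (hx : resMap v x = 0) :
    (⟨π, hπ.2.1.le⟩ : v.valuationSubring) ∣ x := by
  refine ⟨⟨π⁻¹ * x, ?_⟩, Subtype.ext (mul_inv_cancel_left₀ hπ.ne_zero _).symm⟩
  rw [Valuation.mem_valuationSubring_iff, map_mul, map_inv₀]
  exact (inv_mul_le_one₀ hπ.1).2 (hπ.2.2 _ (resMap_eq_zero.1 hx))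

/-- The completion of an excellent equicharacteristic discrete valuation ring. -/
theorem exists_isPres (C : Type u) [Field C] (u : Valuation C Zm0) {π : C}
    (hequichar : ringChar C = ringChar (ResF u)) (hπ : IsUniformizer u π)
    (hexc : ExcellentCompletion C u) :
    ∃ (B : Type u) (_ : CommRing B) (i : u.valuationSubring →+* B) (ρ : B →+* ResF u)
      (σ : ResF u →+* B), IsPres ρ (i ⟨π, hπ.2.1.le⟩) ∧ ρ.comp σ = RingHom.id _ ∧
      ρ.comp i = resMap u ∧ Sep i := by
  obtain ⟨E, _, B, j, hj, hjB, ⟨hB, hcomp⟩, hdense⟩ := exists_isAdicComplete C u hπ hexc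
  have h0 : j π ≠ 0 := (map_ne_zero j).2 (hπ.ne_zero)
  let i : u.valuationSubring →+* B := codVal (j.comp u.valuationSubring.subtype) B
    fun x => (hjB x).2 x.2
  have hi (x : u.valuationSubring) : (i x : E) = j x := rfl
  have h₁ (x : B) : ∃ r y, x = i r + i ⟨π, hπ.2.1.le⟩ * y := by
    obtain ⟨c, hc, y, hy, hx⟩ := hdense x x.2
    exact ⟨⟨c, hc⟩, ⟨y, hy⟩, Subtype.ext hx⟩
  have h₂ (r : u.valuationSubring) (hr : i ⟨π, hπ.2.1.le⟩ ∣ i r) :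
      (⟨π, hπ.2.1.le⟩ : u.valuationSubring) ∣ r := by
    obtain ⟨y, hy⟩ := hr
    have hy' : j (π⁻¹ * r) = y := by
      rw [map_mul, map_inv₀]
      exact (inv_mul_eq_iff_eq_mul₀ h0).2 (congrArg Subtype.val hy)
    refine ⟨⟨π⁻¹ * r, (hjB _).1 (hy' ▸ y.2)⟩, Subtype.ext ?_⟩
    exact (mul_inv_cancel_left₀ ((map_ne_zero j).1 h0) _).symm
  have h₃ (x : B) (hx : i ⟨π, hπ.2.1.le⟩ * x = 0) : x = 0 :=
    (mul_eq_zero.1 hx).resolve_left fun h => h0 (congrArg Subtype.val h)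
  have hres : resMap u ⟨π, hπ.2.1.le⟩ = 0 := resMap_eq_zero.2 hπ.2.1
  have hdvd (x : u.valuationSubring) (hx : resMap u x = 0) :
      (⟨π, hπ.2.1.le⟩ : u.valuationSubring) ∣ x := hπ.dvd_of_resMap_eq_zero hx
  obtain ⟨ρ, hρ⟩ := exists_extension (f := resMap u) h₁ h₂ h₃ (by
    rw [hres, Ideal.span_singleton_zero]; infer_instance)
  have hρi (x) : ρ (i x) = resMap u x := RingHom.congr_fun hρ x
  have hpres : IsPres ρ (i ⟨π, hπ.2.1.le⟩) := by
    refine ⟨hcomp, fun y => ?_, ?_, h₃⟩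
    · obtain ⟨y, rfl⟩ := IsLocalRing.residue_surjective y
      exact ⟨i y, hρi y⟩
    · ext x
      rw [RingHom.mem_ker, Ideal.mem_span_singleton]
      obtain ⟨r, y, rfl⟩ := h₁ x
      rw [map_add, map_mul, hρi, hρi, hres, zero_mul, add_zero]
      exact ⟨fun h => dvd_add (map_dvd i (hdvd r h)) (dvd_mul_right _ _),
        fun h => by
          obtain ⟨s, rfl⟩ := h₂ r ((dvd_add_left (dvd_mul_right _ _)).1 h)
          rw [map_mul, hres, zero_mul]⟩
  obtain ⟨F, _, ι, hι⟩ := exists_sep_valuationSubring u.valuationSubring hequichar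
  obtain ⟨σ, hσ, -⟩ := hpres.exists_section hι (ι := i.comp ι) (by
    rw [← RingHom.comp_assoc, hρ])
  refine ⟨B, inferInstance, i, ρ, σ, hpres, hσ, hρ, fun p hp hu => ?_⟩
  have hC : CharP C p := charP_of_injective_ringHom (f := u.valuationSubring.subtype)
    Subtype.val_injective p
  have h4 : MacLane p (algebraMap u.valuationSubring C) :=
    MacLane.of_isFractionRing (f := RingHom.id _) fun n c x hx h => ⟨x, hx, h⟩
  exact MacLane.of_comp (g := B.subtype) Subtype.val_injective ((hj p hp hC).comp h4)

theorem IsPres.sep {S k : Type*} [CommRing S] [Field k]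
    {C : Type u} [Field C] {u : Valuation C Zm0} {π : C}
    (hequichar : ringChar C = ringChar (ResF u)) (hπ : IsUniformizer u π)
    (hexc : ExcellentCompletion C u) {f : u.valuationSubring →+* S} {ρ : S →+* k}
    (hf : IsPres ρ (f ⟨π, hπ.2.1.le⟩)) {φ : ResF u →+* k} (hφ : Sep φ)
    (hφf : φ.comp (resMap u) = ρ.comp f) :
    Sep f := by
  obtain ⟨B, _, i, ρ₀, σ, h₀, hσ, hi, hsep⟩ := exists_isPres C u hequichar hπ hexc
  obtain ⟨a, rfl, ha⟩ := h₀.exists_extension IsLocalRing.residue_surjective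
    (fun x => hπ.dvd_of_resMap_eq_zero) hi hf hφf
  intro p hp hu
  have : CharP C p := charP_of_injective_ringHom (f := u.valuationSubring.subtype)
    Subtype.val_injective p
  have hk : CharP (ResF u) p := ringChar.of_eq (hequichar ▸ ringChar.eq C p)
  have := charP_of_injective_ringHom φ.injective p
  exact (h₀.macLane hp hσ (a := a) hf hφ ha).comp (hsep p hp hu)

theorem IsPres.exists_ringHom_of_residue {S T k l : Type*} [CommRing S] [CommRing T] [Field k]
    [Field l]
    {C : Type u} [Field C] {u : Valuation C Zm0} {π : C}
    (hequichar : ringChar C = ringChar (ResF u)) (hπ : IsUniformizer u π)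
    (hexc : ExcellentCompletion C u) {f : u.valuationSubring →+* S} {ρ : S →+* k}
    (hf : IsPres ρ (f ⟨π, hπ.2.1.le⟩)) {φ : ResF u →+* k} (hφ : Sep φ)
    (hφf : φ.comp (resMap u) = ρ.comp f)
    {g : u.valuationSubring →+* T} {ρ' : T →+* l} (hg : IsPres ρ' (g ⟨π, hπ.2.1.le⟩)) {θ : k →+* l}
    (hθ : (θ.comp φ).comp (resMap u) = ρ'.comp g) : ∃ a : S →+* T, a.comp f = g := by
  obtain ⟨B, _, i, ρ₀, σ, h₀, hσ, hi, hsep⟩ := exists_isPres C u hequichar hπ hexc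
  obtain ⟨a, rfl, ha⟩ := h₀.exists_extension IsLocalRing.residue_surjective
    (fun x => hπ.dvd_of_resMap_eq_zero) hi hf hφf
  obtain ⟨b, rfl, hb⟩ := h₀.exists_extension IsLocalRing.residue_surjective
    (fun x => hπ.dvd_of_resMap_eq_zero) hi hg hθ
  obtain ⟨e, rfl⟩ := h₀.exists_ringHom hσ hf hg hφ rfl ha hb
  exact ⟨e, rfl⟩

end Paper

namespace Paper

/-! ### Extensions of a discretely valued field with the same uniformizer -/

/-- `j : C → E` is an extension from the valuation `u` to the valuation ring `O`, in which `π` is a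
uniformizer. -/
structure IsExt {C E : Type*} [Field C] [Field E] (u : Valuation C Zm0) (π : C) (j : C →+* E)
    (O : ValuationSubring E) : Prop where
  mem_iff : ∀ c, j c ∈ O ↔ u c ≤ 1
  mem_mx : j π ∈ mx O
  dvd : ∀ x ∈ mx O, (j π)⁻¹ * x ∈ O

namespace IsExt

theorem of_valuation {C E Γ : Type*} [Field C] [Field E] [LinearOrderedCommGroupWithZero Γ]
    {u : Valuation C Zm0} {π : C} {j : C →+* E} {v : Valuation E Γ} (hj : (v.comap j).IsEquiv u)
    (hπ : IsUniformizer v (j π)) : IsExt u π j v.valuationSubring where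
  mem_iff c := (Valuation.mem_valuationSubring_iff _ _).trans hj.le_one_iff_le_one
  mem_mx := (v.isEquiv_valuation_valuationSubring.lt_one_iff_lt_one).1 hπ.2.1
  dvd x hx := by
    rw [Valuation.mem_valuationSubring_iff, map_mul, map_inv₀]
    exact (inv_mul_le_one₀ hπ.1).2 (hπ.2.2 x
      ((v.isEquiv_valuation_valuationSubring.lt_one_iff_lt_one).2 hx))

theorem ultra {C E I : Type*} [Field C] [Field E] {u : Valuation C Zm0} {π : C} {j : C →+* E}
    {O : ValuationSubring E} (h : IsExt u π j O) (U : Ultrafilter I) :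
    IsExt u π ((UP.diag U E).comp j) (Paper.ultra U O) where
  mem_iff c := diag_mem_ultra.trans (h.mem_iff c)
  mem_mx := diag_mem_mx_ultra.2 h.mem_mx
  dvd x hx := by
    obtain ⟨x, rfl⟩ := UP.mk_surjective x
    exact (mk_mem_mx_ultra.1 hx).mono fun i hi => h.dvd _ hi

variable {C E : Type*} [Field C] [Field E] {u : Valuation C Zm0} {π : C} {j : C →+* E}
  {O : ValuationSubring E}

/-- The map between the valuation rings. -/
def toO (h : IsExt u π j O) : u.valuationSubring →+* O :=
  codVal (j.comp u.valuationSubring.subtype) O fun c => (h.mem_iff c).2 c.2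

/-- The valuation ring `O[1/π]`. -/
abbrev A (h : IsExt u π j O) : ValuationSubring E := coarse O (j π) (mx_subset h.mem_mx)

theorem inv_notMem (h : IsExt u π j O) (hu : IsUniformizer u π) : (j π)⁻¹ ∉ O :=
  (mem_mx_iff.1 h.mem_mx).resolve_left ((map_ne_zero j).2 hu.ne_zero)

theorem mem_A (h : IsExt u π j O) (hu : IsUniformizer u π) (c : C) : j c ∈ h.A := by
  rcases eq_or_ne c 0 with rfl | hc
  · exact ⟨0, by simp [O.zero_mem]⟩
  · have hc' : u c ≠ 0 := (map_ne_zero u).2 hc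
    obtain ⟨n, hn⟩ := exists_pow_lt₀ hu.2.1 (Units.mk0 (u c) hc')⁻¹
    refine ⟨n, ?_⟩
    rw [← map_pow, ← map_mul, h.mem_iff, map_mul, map_pow]
    rw [Units.val_inv_eq_inv_val, Units.val_mk0, ← mul_lt_mul_iff_left₀ (zero_lt_iff.2 hc'),
      inv_mul_cancel₀ hc'] at hn
    exact hn.le

/-- The map to the residue field of `O[1/π]`. -/
noncomputable def toRes (h : IsExt u π j O) (hu : IsUniformizer u π) :
    C →+* IsLocalRing.ResidueField h.A :=
  (IsLocalRing.residue h.A).comp (codVal j h.A (h.mem_A hu))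

/-- The map to the valuation ring of the residue field of `O[1/π]`. -/
noncomputable def toS (h : IsExt u π j O) :
    u.valuationSubring →+* resRing (le_coarse (mx_subset h.mem_mx)) :=
  (toResRing _).comp h.toO

theorem exists_isPres (h : IsExt u π j O) (hu : IsUniformizer u π) (hp : Prec O (j π)) :
    ∃ ρ : resRing (le_coarse (mx_subset h.mem_mx)) →+* IsLocalRing.ResidueField O,
      IsPres ρ (h.toS ⟨π, hu.2.1.le⟩) ∧ ρ.comp h.toS = (IsLocalRing.residue O).comp h.toO := by
  have hπ := mx_subset h.mem_mx
  have h0 : j π ≠ 0 := (map_ne_zero j).2 hu.ne_zero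
  let t := toResRing (le_coarse hπ)
  have ht : Function.Surjective t := toResRing_surjective _
  have hker : RingHom.ker t ≤ RingHom.ker (IsLocalRing.residue O) := fun x hx => by
    rw [RingHom.mem_ker, IsLocalRing.residue_eq_zero_iff, ← coe_mem_mx]
    exact mx_subset_mx (le_coarse hπ) ((toResRing_eq_zero _).1 hx)
  let ρ := t.liftOfRightInverse _ (Function.rightInverse_surjInv ht) ⟨_, hker⟩
  have hρ (x : O) : ρ (t x) = IsLocalRing.residue O x :=
    RingHom.liftOfRightInverse_comp_apply _ _ (Function.rightInverse_surjInv ht) ⟨_, hker⟩ x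
  refine ⟨ρ, ⟨isAdicComplete_resRing hπ h0 (h.inv_notMem hu) hp, fun y => ?_, ?_, fun x hx => ?_⟩,
    RingHom.ext fun x => hρ _⟩
  · obtain ⟨y, rfl⟩ := IsLocalRing.residue_surjective y
    exact ⟨t y, hρ y⟩
  · ext x
    obtain ⟨x, rfl⟩ := ht x
    rw [RingHom.mem_ker, hρ, IsLocalRing.residue_eq_zero_iff, ← coe_mem_mx,
      Ideal.mem_span_singleton]
    refine ⟨fun hx => ?_, uniformizer_dvd_toResRing h.mem_mx⟩
    refine ⟨t ⟨_, h.dvd _ hx⟩, ?_⟩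
    change t x = t ⟨j π, hπ⟩ * _
    rw [← map_mul]
    exact congrArg t (Subtype.ext (mul_inv_cancel_left₀ h0 _).symm)
  · exact (mul_eq_zero.1 hx).resolve_left (toResRing_uniformizer_ne_zero hπ h0)

theorem coe_toS (h : IsExt u π j O) (hu : IsUniformizer u π) (x : u.valuationSubring) :
    (h.toS x : IsLocalRing.ResidueField h.A) = h.toRes hu x := rfl

theorem sep_toRes {C : Type u} [Field C] {u : Valuation C Zm0} {π : C} {j : C →+* E}
    (h : IsExt u π j O) (hu : IsUniformizer u π) (hp : Prec O (j π))
    (hequichar : ringChar C = ringChar (ResF u)) (hexc : ExcellentCompletion C u)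
    {φ : ResF u →+* IsLocalRing.ResidueField O} (hφ : Sep φ)
    (hφf : φ.comp (resMap u) = (IsLocalRing.residue O).comp h.toO) : Sep (h.toRes hu) := by
  obtain ⟨ρ, hρ, hρ'⟩ := h.exists_isPres hu hp
  have h1 := hρ.sep hequichar hu hexc hφ (hφf.trans hρ'.symm)
  intro p hpp hC
  have hO : CharP u.valuationSubring p :=
    (RingHom.charP_iff u.valuationSubring.subtype Subtype.val_injective p).2 hC
  have h2 := MacLane.of_isFractionRing (K := IsLocalRing.ResidueField h.A) (h1 p hpp hO)
  have h3 : (algebraMap (resRing (le_coarse (mx_subset h.mem_mx)))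
      (IsLocalRing.ResidueField h.A)).comp h.toS =
      (h.toRes hu).comp (algebraMap u.valuationSubring C) := RingHom.ext fun x => h.coe_toS hu x
  rw [h3] at h2
  exact h2.of_isFractionRing_left

theorem exists_ringHom {C : Type u} {E' : Type*} [Field C] [Field E'] {u : Valuation C Zm0} {π : C}
    {j : C →+* E} (h : IsExt u π j O) {j' : C →+* E'} {O' : ValuationSubring E'}
    (h' : IsExt u π j' O') (hu : IsUniformizer u π) (hp : Prec O (j π)) (hp' : Prec O' (j' π))
    (hequichar : ringChar C = ringChar (ResF u)) (hexc : ExcellentCompletion C u)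
    {φ : ResF u →+* IsLocalRing.ResidueField O} (hφ : Sep φ)
    (hφf : φ.comp (resMap u) = (IsLocalRing.residue O).comp h.toO)
    {θ : IsLocalRing.ResidueField O →+* IsLocalRing.ResidueField O'}
    (hθ : (θ.comp φ).comp (resMap u) = (IsLocalRing.residue O').comp h'.toO) :
    ∃ Λ : IsLocalRing.ResidueField h.A →+* IsLocalRing.ResidueField h'.A,
      Λ.comp (h.toRes hu) = h'.toRes hu := by
  obtain ⟨ρ, hρ, hρ'⟩ := h.exists_isPres hu hp
  obtain ⟨ρ₁, hρ₁, hρ₁'⟩ := h'.exists_isPres hu hp'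
  obtain ⟨a, ha⟩ := hρ.exists_ringHom_of_residue hequichar hu hexc hφ (hφf.trans hρ'.symm) hρ₁
    (hθ.trans hρ₁'.symm)
  let t := h.toS ⟨π, hu.2.1.le⟩
  have hat : a t ≠ 0 := by
    rw [← RingHom.comp_apply, ha]
    exact toResRing_uniformizer_ne_zero _ ((map_ne_zero j').2 hu.ne_zero)
  have hinj : Function.Injective a := by
    rw [injective_iff_map_eq_zero]
    intro x hx
    have hdvd (n : ℕ) : t ^ n ∣ x := (ValuationRing.dvd_total _ _).resolve_right fun hd => by
      have := map_dvd a hd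
      rw [hx, zero_dvd_iff, map_pow] at this
      exact pow_ne_zero n hat this
    refine hρ.complete.toIsHausdorff.haus' x fun n => ?_
    rw [SModEq.zero, smul_eq_mul, Ideal.mul_top, Ideal.span_singleton_pow, Ideal.mem_span_singleton]
    exact hdvd n
  let Λ : IsLocalRing.ResidueField h.A →+* IsLocalRing.ResidueField h'.A :=
    IsFractionRing.lift (A := resRing (le_coarse (mx_subset h.mem_mx)))
      (g := (resRing (le_coarse (mx_subset h'.mem_mx))).subtype.comp a)
      (Subtype.val_injective.comp hinj)
  refine ⟨Λ, IsLocalization.ringHom_ext (nonZeroDivisors u.valuationSubring) (RingHom.ext fun x => ?_)⟩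
  change Λ (algebraMap _ _ (h.toS x)) = (h'.toS x : IsLocalRing.ResidueField h'.A)
  rw [← ha]
  exact IsFractionRing.lift_algebraMap _ _

end IsExt

end Paper

namespace Paper

section Embedding

open Filter

theorem exists_embedding {c k : Type u} {l : Type*} [Field c] [Field k] [Field l] {f : c →+* k}
    {g : c →+* l}
    (h : ∀ (n : ℕ) (P : List (MvPolynomial (Fin n) c)) (q), Sol f P q → Sol g P q) :
    ∃ (I : Type u) (U : Ultrafilter I) (θ : k →+* UP U l), θ.comp f = (UP.diag U l).comp g := by
  classical
  have hpt (B : Finset (MvPolynomial k c)) : ∃ y : k → l, ∀ p ∈ B, p.eval₂ f id = 0 →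
      p.eval₂ g y = 0 := by
    let V : Finset k := B.biUnion MvPolynomial.vars
    let e : Fin V.card → k := fun i => V.equivFin.symm i
    have he : Function.Injective e := Subtype.val_injective.comp V.equivFin.symm.injective
    have hr (p : MvPolynomial k c) (hp : p ∈ B) : ∃ r, MvPolynomial.rename e r = p := by
      refine MvPolynomial.exists_rename_eq_of_vars_subset_range p e he fun x hx => ?_
      exact ⟨V.equivFin ⟨x, Finset.mem_biUnion.2 ⟨p, hp, hx⟩⟩, by simp [e]⟩
    choose! r hr using hr
    obtain ⟨x, hx, -⟩ := h _ ((B.filter fun p => p.eval₂ f id = 0).toList.map r) 1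
      ⟨e, fun p hp => by
        obtain ⟨p, hp', rfl⟩ := List.mem_map.1 hp
        rw [Finset.mem_toList, Finset.mem_filter] at hp'
        have := hp'.2
        rwa [← hr p hp'.1, MvPolynomial.eval₂_rename] at this, by simp⟩
    refine ⟨Function.extend e x 0, fun p hp hp0 => ?_⟩
    rw [← hr p hp, MvPolynomial.eval₂_rename, Function.extend_comp he]
    exact hx (r p) (List.mem_map_of_mem (Finset.mem_toList.2 (Finset.mem_filter.2 ⟨hp, hp0⟩)))
  choose y hy using hpt
  let U : Ultrafilter (Finset (MvPolynomial k c)) := Ultrafilter.of atTop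
  have hU (p : MvPolynomial k c) (hp : p.eval₂ f id = 0) : ∀ᶠ B in U, p.eval₂ g (y B) = 0 := by
    refine Ultrafilter.of_le _ ?_
    filter_upwards [eventually_ge_atTop {p}] with B hB
    exact hy B p (hB (Finset.mem_singleton_self p)) hp
  let θ : k →+* UP U l :=
    { toFun := fun a => UP.mk U l fun B => y B a
      map_one' := by
        rw [← map_one (UP.mk U l), UP.mk_eq]
        filter_upwards [hU (MvPolynomial.X 1 - 1) (by simp)] with B hB
        simpa [sub_eq_zero] using hB
      map_zero' := by
        rw [UP.mk_eq_zero]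
        filter_upwards [hU (MvPolynomial.X 0) (by simp)] with B hB
        simpa using hB
      map_add' := fun a b => by
        rw [← map_add, UP.mk_eq]
        filter_upwards [hU (MvPolynomial.X (a + b) - (MvPolynomial.X a + MvPolynomial.X b))
          (by simp)] with B hB
        simpa [sub_eq_zero] using hB
      map_mul' := fun a b => by
        rw [← map_mul, UP.mk_eq]
        filter_upwards [hU (MvPolynomial.X (a * b) - MvPolynomial.X a * MvPolynomial.X b)
          (by simp)] with B hB
        simpa [sub_eq_zero] using hB }
  refine ⟨_, U, θ, RingHom.ext fun a => UP.mk_eq.2 ?_⟩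
  filter_upwards [hU (MvPolynomial.X (f a) - MvPolynomial.C a) (by simp)] with B hB
  simpa [sub_eq_zero] using hB

theorem exists_ultra_residue {K I : Type*} [Field K] (U : Ultrafilter I) (O : ValuationSubring K) :
    ∃ κ : UP U (IsLocalRing.ResidueField O) →+* IsLocalRing.ResidueField (ultra U O),
      ∀ x : O, κ (UP.diag U _ (IsLocalRing.residue O x)) =
        IsLocalRing.residue _ ⟨UP.diag U K x, diag_mem_ultra.2 x.2⟩ := by
  let s : IsLocalRing.ResidueField O → O := Function.surjInv IsLocalRing.residue_surjective
  have hs (x) : IsLocalRing.residue O (s x) = x := Function.surjInv_eq _ x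
  let τ (f : I → IsLocalRing.ResidueField O) : ultra U O :=
    ⟨UP.mk U K fun i => s (f i), mk_mem_ultra.2 (.of_forall fun i => (s (f i)).2)⟩
  have key (g : I → O) (f : I → IsLocalRing.ResidueField O)
      (h : ∀ᶠ i in U, IsLocalRing.residue O (g i) = f i) : IsLocalRing.residue _ (τ f) =
      IsLocalRing.residue (ultra U O)
        ⟨UP.mk U K fun i => g i, mk_mem_ultra.2 (.of_forall fun i => (g i).2)⟩ := by
    rw [residue_eq_iff]
    change UP.mk U K _ - UP.mk U K _ ∈ _
    rw [← map_sub, mk_mem_mx_ultra]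
    filter_upwards [h] with i hi
    exact residue_eq_iff.1 ((hs _).trans hi.symm)
  let ρ : (I → IsLocalRing.ResidueField O) →+* IsLocalRing.ResidueField (ultra U O) :=
    { toFun := fun f => IsLocalRing.residue _ (τ f)
      map_one' := key 1 1 (.of_forall fun _ => map_one _)
      map_zero' := (key 0 0 (.of_forall fun _ => map_zero _)).trans (map_zero _)
      map_add' := fun f g => by
        rw [← map_add]
        exact key (fun i => s (f i) + s (g i)) _ (.of_forall fun i => by
          rw [map_add, hs, hs, Pi.add_apply])
      map_mul' := fun f g => by
        rw [← map_mul]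
        exact key (fun i => s (f i) * s (g i)) _ (.of_forall fun i => by
          rw [map_mul, hs, hs, Pi.mul_apply]) }
  have hsurj : Function.Surjective (UP.mk U (IsLocalRing.ResidueField O)) := UP.mk_surjective
  have hker : RingHom.ker (UP.mk U (IsLocalRing.ResidueField O)) ≤ RingHom.ker ρ := fun f hf => by
    refine (key 0 f ?_).trans (map_zero _)
    filter_upwards [UP.mk_eq_zero.1 hf] with i hi
    rw [hi, Pi.zero_apply, map_zero]
  refine ⟨(UP.mk U _).liftOfRightInverse _ (Function.rightInverse_surjInv hsurj) ⟨ρ, hker⟩,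
    fun x => ?_⟩
  rw [UP.diag_apply, RingHom.liftOfRightInverse_comp_apply]
  exact key (fun _ => x) _ (.of_forall fun _ => rfl)

end Embedding

end Paper

namespace Paper

section Transfer

open Filter

theorem resCompat_comp {C E Γ : Type*} [Field C] [Field E] [LinearOrderedCommGroupWithZero Γ]
    {u : Valuation C Zm0} {π : C} [Algebra C E] {v : Valuation E Γ} {g : ResF u →+* ResF v}
    (hg : ResCompat u v g) (h : IsExt u π (algebraMap C E) v.valuationSubring) :
    g.comp (resMap u) = (IsLocalRing.residue _).comp h.toO :=
  RingHom.ext fun c => hg c ((h.mem_iff c).2 c.2)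

/-- `(R4_n)` transfers systems from a henselian extension to the residue field of `O[1/π]`. -/
theorem IsExt.sol_toRes {C E : Type u} [Field C] [Field E] {u : Valuation C Zm0} {π : C}
    {j : C →+* E} {O : ValuationSubring E} (h : IsExt u π j O) (hu : IsUniformizer u π)
    (hO : Hens (mx O) O) (hsep : Sep (h.toRes hu)) {n : ℕ} (hR4 : R4N.{u} n)
    {P : List (MvPolynomial (Fin n) C)} {q : MvPolynomial (Fin n) C} (hs : Sol j P q) :
    Sol (h.toRes hu) P q := by
  have hF (x : j.fieldRange) : (x : E) ∈ h.A := by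
    obtain ⟨_, c, rfl⟩ := x
    exact h.mem_A hu c
  let S : Stage C π :=
    { E := E
      f := j
      O := O
      A := h.A
      F := j.fieldRange
      le := le_coarse _
      hens := hO
      f_mem := fun c => ⟨c, rfl⟩
      F_le := hF
      sep := by
        intro p hp hF'
        have hC : CharP C p := (RingHom.charP_iff j.rangeRestrictField
          j.rangeRestrictField.injective p).2 hF'
        let e : C ≃+* j.fieldRange := RingEquiv.ofBijective j.rangeRestrictField
          j.rangeRestrictField_bijective
        have h2 := (hsep p hp hC).comp (macLane_of_equiv e.symm p)
        convert h2 using 1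
        ext x
        obtain ⟨y, rfl⟩ := e.surjective x
        simp only [RingHom.comp_apply, RingHom.coe_coe, e.symm_apply_apply]
        rfl
      inv_notMem := h.inv_notMem hu }
  exact S.sol_toRes hR4 hs

theorem sol_transfer {n : ℕ}
    {C : Type u} [Field C] {u : Valuation C Zm0}
    (hequichar : ringChar C = ringChar (ResF u))
    {π : C} (hπu : IsUniformizer u π)
    (hexc : ExcellentCompletion C u)
    {K : Type u} [Field K] [Algebra C K]
    {ΓK : Type u} [LinearOrderedCommGroupWithZero ΓK] {v : Valuation K ΓK}
    (hKC : (v.comap (algebraMap C K)).IsEquiv u)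
    (hKhens : IsHenselian v) (hπv : IsUniformizer v (algebraMap C K π))
    {L : Type u} [Field L] [Algebra C L]
    {ΓL : Type u} [LinearOrderedCommGroupWithZero ΓL] {w : Valuation L ΓL}
    (hLC : (w.comap (algebraMap C L)).IsEquiv u)
    (hLhens : IsHenselian w) (hπw : IsUniformizer w (algebraMap C L π))
    {gK : ResF u →+* ResF v} (hgK : ResCompat u v gK) (hsepK : IsSepExtHom gK)
    {gL : ResF u →+* ResF w} (hgL : ResCompat u w gL)
    (hR4 : R4N.{u} n)
    (hres : ThRingSub (fun {_} φ => IsExists φ) (ResF v) gK (ResF w) gL)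
    {P : List (MvPolynomial (Fin n) C)} {q : MvPolynomial (Fin n) C}
    (hs : Sol (algebraMap C K) P q) : Sol (algebraMap C L) P q := by
  have eK := IsExt.of_valuation hKC hπv
  have eL := IsExt.of_valuation hLC hπw
  have eK' := eK.ultra (hyperfilter ℕ)
  have pK : Prec _ (((UP.diag (hyperfilter ℕ) K).comp (algebraMap C K)) π) :=
    prec_ultra v.valuationSubring (mx_subset eK.mem_mx)
  obtain ⟨κ, hκ⟩ := exists_residue_ultra (U := hyperfilter ℕ) v.valuationSubring
  obtain ⟨μ, hμ⟩ := exists_ultra_residue (hyperfilter ℕ) v.valuationSubring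
  let φ := (μ.comp (UP.diag _ _)).comp gK
  have hκμ : κ.comp (μ.comp (UP.diag _ _)) = UP.diag _ _ := by
    ext x
    obtain ⟨x, rfl⟩ := IsLocalRing.residue_surjective x
    exact (congrArg κ (hμ x)).trans (hκ x _)
  have hφ : Sep φ := fun p hp hc => by
    have h1 : MacLane p (μ.comp (UP.diag _ _)) :=
      MacLane.of_comp κ.injective (by rw [hκμ]; exact UP.macLane_diag p)
    exact h1.comp (hsepK.sep p hp hc)
  have hφf : φ.comp (resMap u) = (IsLocalRing.residue _).comp eK'.toO := by
    rw [RingHom.comp_assoc, resCompat_comp hgK eK]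
    exact RingHom.ext fun c => hμ _
  have hsep := eK'.sep_toRes hπu pK hequichar hexc hφ hφf
  have hs' : Sol (eK'.toRes hπu) P q := eK'.sol_toRes hπu
    (hens_of_henselianLocalRing hKhens).ultra hsep hR4 (UP.sol_iff.2 hs)
  -- the embedding of the residue field
  obtain ⟨I, U, θ₁, hθ₁⟩ := exists_embedding (f := φ) (g := gL) fun m P q h => by
    refine sol_of_thRingSub hres ((UP.sol_iff (U := hyperfilter ℕ)).1 ?_)
    have h1 := h.map κ.injective
    rwa [← RingHom.comp_assoc, hκμ] at h1
  have eL₁ := eL.ultra U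
  obtain ⟨μ₁, hμ₁⟩ := exists_ultra_residue U w.valuationSubring
  have eL₂ := eL₁.ultra (hyperfilter ℕ)
  obtain ⟨μ₂, hμ₂⟩ := exists_ultra_residue (hyperfilter ℕ) (ultra U w.valuationSubring)
  have pL : Prec _ (((UP.diag (hyperfilter ℕ) _).comp ((UP.diag U L).comp (algebraMap C L))) π) :=
    prec_ultra (ultra U w.valuationSubring) (mx_subset eL₁.mem_mx)
  obtain ⟨Λ, hΛ⟩ := eK'.exists_ringHom eL₂ hπu pK pL hequichar hexc hφ hφf
    (θ := (μ₂.comp (UP.diag _ _)).comp (μ₁.comp θ₁)) (by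
      refine RingHom.ext fun c => ?_
      have h1 : θ₁ (φ (resMap u c)) = UP.diag U _ (IsLocalRing.residue _ (eL.toO c)) :=
        (RingHom.congr_fun hθ₁ (resMap u c)).trans
          (congrArg (UP.diag U _) (RingHom.congr_fun (resCompat_comp hgL eL) c))
      change μ₂ (UP.diag _ _ (μ₁ (θ₁ (φ (resMap u c))))) = _
      rw [h1, hμ₁, hμ₂]
      rfl)
  have : HenselianLocalRing eL₂.A := by
    have h1 := (hens_of_henselianLocalRing hLhens).ultra (U := U)
    exact ((h1.ultra (U := hyperfilter ℕ)).mono (mx_subset_mx (le_coarse _))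
      (le_coarse _)).henselianLocalRing
  have h1 := Sol.lift hsep (codVal _ eL₂.A (eL₂.mem_A hπu)) Λ hΛ hs'
  have h2 := h1.map (g := eL₂.A.subtype) Subtype.val_injective
  exact UP.sol_iff.1 (UP.sol_iff.1 h2)

theorem hensUnif_of_valuation {C E : Type u} [Field C] [Field E] {Γ : Type u}
    [LinearOrderedCommGroupWithZero Γ] {v : Valuation E Γ} {π : C} {j : C →+* E}
    (hv : IsHenselian v) (hπ : IsUniformizer v (j π)) : HensUnif ⟨E, j, Oset v⟩ π := by
  have e := v.isEquiv_valuation_valuationSubring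
  refine ⟨v.valuationSubring, rfl, hens_of_henselianLocalRing hv, ?_, ?_, fun x hx => ?_⟩
  · exact zero_lt_iff.2 ((map_ne_zero _).2 hπ.ne_zero)
  · exact e.lt_one_iff_lt_one.1 hπ.2.1
  · exact (e _ _).1 (hπ.2.2 x (e.lt_one_iff_lt_one.2 hx))

end Transfer

end Paper

namespace Paper

/-- Proposition `prop:main` of the paper.
With `(C, u)` equicharacteristic `ℤ`-valued with excellent valuation ring and uniformizer `π`,
and `(K, v)`, `(L, w)` henselian extensions with uniformizer `π` and separable residue
extensions: if `Th_∃(Kv, Cu) ⊆ Th_∃(Lw, Cu)` and `(R4_{n+1})` holds, then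
`Th_{∃_{n+1}}(K, C) ⊆ Th_{∃_{n+1}}(L, C)` and `Th_{∃_n}(K, v, C) ⊆ Th_{∃_n}(L, w, C)`. -/
theorem statement3 (n : ℕ)
    (C : Type u) [Field C] (u : Valuation C Zm0) (hZ : Function.Surjective u)
    (hequichar : ringChar C = ringChar (ResF u))
    (π : C) (hπu : IsUniformizer u π)
    (hexc : ExcellentCompletion C u)
    (K : Type u) [Field K] [Algebra C K]
    (ΓK : Type u) [LinearOrderedCommGroupWithZero ΓK] (v : Valuation K ΓK)
    (hKC : (v.comap (algebraMap C K)).IsEquiv u)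
    (hKhens : IsHenselian v) (hπv : IsUniformizer v (algebraMap C K π))
    (L : Type u) [Field L] [Algebra C L]
    (ΓL : Type u) [LinearOrderedCommGroupWithZero ΓL] (w : Valuation L ΓL)
    (hLC : (w.comap (algebraMap C L)).IsEquiv u)
    (hLhens : IsHenselian w) (hπw : IsUniformizer w (algebraMap C L π))
    (gK : ResF u →+* ResF v) (hgK : ResCompat u v gK) (hsepK : IsSepExtHom gK)
    (gL : ResF u →+* ResF w) (hgL : ResCompat u w gL) (hsepL : IsSepExtHom gL)
    -- `(R4_{n+1})`
    (hR4 : R4N.{u} (n + 1))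
    -- `Th_∃(Kv, Cu) ⊆ Th_∃(Lw, Cu)`
    (hres : ThRingSub (fun {k} φ => IsExists φ) (ResF v) gK (ResF w) gL) :
    -- `Th_{∃_{n+1}}(K, C) ⊆ Th_{∃_{n+1}}(L, C)` and `Th_{∃_n}(K, v, C) ⊆ Th_{∃_n}(L, w, C)`
    ThRingSub (fun {k} φ => IsExistsN (n + 1) φ) K (algebraMap C K) L (algebraMap C L) ∧
    ThValSub (fun {k} φ => IsExistsN n φ) K (Oset v) (algebraMap C K)
      L (Oset w) (algebraMap C L) := by
  have h {P : List (MvPolynomial (Fin (n + 1)) C)} {q} (hs : Sol (algebraMap C K) P q) :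
      Sol (algebraMap C L) P q :=
    sol_transfer hequichar hπu hexc hKC hKhens hπv hLC hLhens hπw hgK hsepK hgL hR4 hres hs
  exact ⟨thRingSub_of_sol fun _ _ => h, thValSub_of_sol (hensUnif_of_valuation hKhens hπv)
    (hensUnif_of_valuation hLhens hπw) fun _ _ => h⟩

end Paper
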